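/- arXiv:1005.0765 — 13 statements merged into one kernel-verified Lean document; each statement's English description precedes it below -/
import Mathlib

section
/- For any finite simple graph G with at least one vertex, γ(G) ≤ w(G) ≤ γ(G) · ⌈log₂(Δ(G) + 2)⌉, where γ(G) is the domination number and Δ(G) the maximum degree of G. -/
/-- The label of a vertex `x` with respect to a set `W` of watchers:
the set of watchers whose watching zone contains `x`. -/
def wLabel {V : Type} [DecidableEq V] (W : Finset (V × Finset V)) (x : V) :
    Finset (V × Finset V) :=
  W.filter (fun w => x ∈ w.2)

/-- `W` is a watching system for `G`: every watcher `(v, Z)` satisfies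
`Z ⊆ N_G[v]`, every label is nonempty, and distinct vertices have distinct labels. -/
def IsWatchingSystem {V : Type} [DecidableEq V] (G : SimpleGraph V)
    (W : Finset (V × Finset V)) : Prop :=
  (∀ w ∈ W, ∀ x ∈ w.2, x = w.1 ∨ G.Adj w.1 x) ∧
  (∀ x : V, (wLabel W x).Nonempty) ∧
  (∀ x y : V, wLabel W x = wLabel W y → x = y)

/-- The watching number of `G`: the minimum size of a watching system of `G`. -/
noncomputable def watchingNumber {V : Type} [DecidableEq V] (G : SimpleGraph V) : ℕ :=
  sInf {k | ∃ W : Finset (V × Finset V), IsWatchingSystem G W ∧ W.card = k}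

/-- The domination number of `G`: the minimum size of a dominating set of `G`. -/
noncomputable def dominationNumber {V : Type} (G : SimpleGraph V) : ℕ :=
  sInf {k | ∃ D : Finset V, (∀ v : V, v ∈ D ∨ ∃ u ∈ D, G.Adj v u) ∧ D.card = k}

theorem exists_code {V : Type} [Fintype V] [DecidableEq V]
    (G : SimpleGraph V) [DecidableRel G.Adj] (v : V) :
    ∃ c : V → Finset (Fin (Nat.clog 2 (G.maxDegree + 2))),
      (∀ x, (x = v ∨ G.Adj v x) → (c x).Nonempty) ∧
      (∀ x y, (x = v ∨ G.Adj v x) → (y = v ∨ G.Adj v y) → c x = c y → x = y) := by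
  classical
  have hcard : Fintype.card {x // x ∈ insert v (G.neighborFinset v)} ≤
      Fintype.card {s : Finset (Fin (Nat.clog 2 (G.maxDegree + 2))) // s ≠ ∅} := by
    have h1 : Fintype.card {x // x ∈ insert v (G.neighborFinset v)} ≤ G.maxDegree + 1 := by
      rw [Fintype.card_coe]
      refine (Finset.card_insert_le _ _).trans ?_
      rw [G.card_neighborFinset_eq_degree]
      have := G.degree_le_maxDegree v
      omega
    have h2 : Fintype.card {s : Finset (Fin (Nat.clog 2 (G.maxDegree + 2))) // s ≠ ∅}
        = 2 ^ (Nat.clog 2 (G.maxDegree + 2)) - 1 := by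
      have := Set.card_ne_eq (∅ : Finset (Fin (Nat.clog 2 (G.maxDegree + 2))))
      rw [Fintype.card_finset, Fintype.card_fin] at this
      rw [← this]
      exact Fintype.card_congr (Equiv.refl _)
    have h3 := Nat.le_pow_clog (b := 2) (by norm_num) (G.maxDegree + 2)
    omega
  obtain ⟨e⟩ := Function.Embedding.nonempty_of_card_le hcard
  have hm : ∀ x, (x = v ∨ G.Adj v x) → x ∈ insert v (G.neighborFinset v) := by
    intro x hx
    simpa using hx
  refine ⟨fun x => if h : x ∈ insert v (G.neighborFinset v) then (e ⟨x, h⟩).1 else ∅, ?_, ?_⟩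
  · intro x hx
    simp only [dif_pos (hm x hx)]
    exact Finset.nonempty_iff_ne_empty.2 (e ⟨x, hm x hx⟩).2
  · intro x y hx hy h
    simp only [dif_pos (hm x hx), dif_pos (hm y hy)] at h
    have := e.injective (Subtype.ext h)
    exact congrArg Subtype.val this

theorem exists_ws {V : Type} [Fintype V] [DecidableEq V]
    (G : SimpleGraph V) [DecidableRel G.Adj] (D : Finset V)
    (hD : ∀ v : V, v ∈ D ∨ ∃ u ∈ D, G.Adj v u) :
    ∃ W : Finset (V × Finset V), IsWatchingSystem G W ∧
      W.card ≤ D.card * Nat.clog 2 (G.maxDegree + 2) := by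
  classical
  have hf : ∀ x : V, ∃ u ∈ D, x = u ∨ G.Adj u x := by
    intro x
    rcases hD x with h | ⟨u, hu, h⟩
    · exact ⟨x, h, Or.inl rfl⟩
    · exact ⟨u, hu, Or.inr h.symm⟩
  choose f hfD hf using hf
  choose c hc1 hc2 using exists_code G
  let Z : V × Fin (Nat.clog 2 (G.maxDegree + 2)) → V × Finset V :=
    fun p => (p.1, Finset.univ.filter (fun x => f x = p.1 ∧ p.2 ∈ c p.1 x))
  let W := (D ×ˢ (Finset.univ : Finset (Fin (Nat.clog 2 (G.maxDegree + 2))))).image Z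
  have hlab : ∀ x i, i ∈ c (f x) x → Z (f x, i) ∈ wLabel W x := by
    intro x i hi
    refine Finset.mem_filter.2 ⟨Finset.mem_image_of_mem _ ?_, ?_⟩
    · simp [hfD]
    · simp [Z, hi]
  have key : ∀ x y i, wLabel W x = wLabel W y → i ∈ c (f x) x →
      f y = f x ∧ i ∈ c (f x) y := by
    intro x y i h hi
    have h1 := hlab x i hi
    rw [h] at h1
    have h2 := (Finset.mem_filter.1 h1).2
    simpa [Z] using h2
  refine ⟨W, ⟨?_, ?_, ?_⟩, ?_⟩
  · intro w hw x hx
    obtain ⟨p, -, rfl⟩ := Finset.mem_image.1 hw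
    have h2 : f x = p.1 ∧ p.2 ∈ c p.1 x := by simpa [Z] using hx
    have := hf x
    rw [h2.1] at this
    exact this
  · intro x
    obtain ⟨i, hi⟩ := hc1 (f x) x (hf x)
    exact ⟨_, hlab x i hi⟩
  · intro x y h
    obtain ⟨i, hi⟩ := hc1 (f x) x (hf x)
    have hxy := (key x y i h hi).1
    refine hc2 (f x) x y (hf x) (hxy ▸ hf y) ?_
    ext j
    constructor
    · intro hj
      exact (key x y j h hj).2
    · intro hj
      rw [← hxy] at hj ⊢
      exact (key y x j h.symm hj).2
  · refine Finset.card_image_le.trans ?_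
    simp

/-- For any finite simple graph `G` with at least one vertex,
`γ(G) ≤ w(G) ≤ γ(G) · ⌈log₂(Δ(G) + 2)⌉`. -/
theorem dominationNumber_le_watchingNumber_le {V : Type} [Fintype V] [DecidableEq V]
    [Nonempty V] (G : SimpleGraph V) [DecidableRel G.Adj] :
    dominationNumber G ≤ watchingNumber G ∧
    watchingNumber G ≤ dominationNumber G * Nat.clog 2 (G.maxDegree + 2) := by
  classical
  obtain ⟨D, hD, hDc⟩ : dominationNumber G ∈
      {k | ∃ D : Finset V, (∀ v : V, v ∈ D ∨ ∃ u ∈ D, G.Adj v u) ∧ D.card = k} :=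
    Nat.sInf_mem ⟨_, Finset.univ, fun v => Or.inl (Finset.mem_univ v), rfl⟩
  obtain ⟨W, hW, hWc⟩ := exists_ws G D hD
  constructor
  · obtain ⟨W', hW', hWc'⟩ : watchingNumber G ∈
        {k | ∃ W : Finset (V × Finset V), IsWatchingSystem G W ∧ W.card = k} :=
      Nat.sInf_mem ⟨_, W, hW, rfl⟩
    rw [← hWc']
    refine le_trans (Nat.sInf_le ⟨W'.image Prod.fst, ?_, rfl⟩) Finset.card_image_le
    intro v
    obtain ⟨w, hw⟩ := hW'.2.1 v
    obtain ⟨hw1, hw2⟩ := Finset.mem_filter.1 hw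
    have hm := Finset.mem_image_of_mem Prod.fst hw1
    rcases hW'.1 w hw1 v hw2 with h | h
    · exact Or.inl (h ▸ hm)
    · exact Or.inr ⟨_, hm, h.symm⟩
  · rw [← hDc]
    exact le_trans (Nat.sInf_le ⟨W, hW, rfl⟩) hWc
end

section
/- Let T be a finite tree, x a leaf of T, and y the unique neighbour of x. Then there exists a watching system of T of minimum size containing at least one watcher located at y. -/
/-- If `x` is a leaf of a finite tree `T` with unique neighbour `y`, then there is a
minimum watching system of `T` with a watcher located at `y`. -/
theorem exists_min_watchingSystem_watcher_at_support {V : Type} [Fintype V] [DecidableEq V]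
    (T : SimpleGraph V) (hT : T.IsTree) (x y : V)
    (hxy : T.Adj x y) (hleaf : ∀ z : V, T.Adj x z → z = y) :
    ∃ W : Finset (V × Finset V), IsWatchingSystem T W ∧ W.card = watchingNumber T ∧
      ∃ w ∈ W, w.1 = y := by
  have hne : {k | ∃ W : Finset (V × Finset V), IsWatchingSystem T W ∧ W.card = k}.Nonempty := by
    refine ⟨_, Finset.univ.image (fun v : V => (v, ({v} : Finset V))), ⟨?_, ?_, ?_⟩, rfl⟩
    · intro w hw a ha
      simp only [Finset.mem_image, Finset.mem_univ, true_and] at hw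
      obtain ⟨v, rfl⟩ := hw
      left
      simpa using ha
    · intro a
      exact ⟨(a, {a}), by simp [wLabel]⟩
    · intro a b h
      have : (a, ({a} : Finset V)) ∈ wLabel (Finset.univ.image (fun v : V => (v, ({v} : Finset V)))) b := by
        rw [← h]; simp [wLabel]
      simp only [wLabel, Finset.mem_filter, Finset.mem_singleton] at this
      exact this.2.symm
  obtain ⟨W, ⟨h1, h2, h3⟩, hc⟩ := Nat.sInf_mem hne
  by_cases hy : ∃ w ∈ W, w.1 = y
  · exact ⟨W, ⟨h1, h2, h3⟩, hc, hy⟩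
  let f : V × Finset V → V × Finset V := fun w => if w.1 = x then (y, w.2) else w
  have f2 : ∀ w, (f w).2 = w.2 := by
    intro w; simp only [f]; split_ifs <;> rfl
  have hmem : ∀ w a, w ∈ W → a ∈ w.2 → f w ∈ wLabel (W.image f) a := by
    intro w a hw ha
    simp only [wLabel, Finset.mem_filter, f2]
    exact ⟨Finset.mem_image_of_mem _ hw, ha⟩
  have hsub : ∀ a b, wLabel (W.image f) a = wLabel (W.image f) b → ∀ w ∈ W, a ∈ w.2 → b ∈ w.2 := by
    intro a b h w hw ha
    have := hmem w a hw ha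
    rw [h] at this
    simp only [wLabel, Finset.mem_filter, f2] at this
    exact this.2
  have hW : IsWatchingSystem T (W.image f) := by
    refine ⟨?_, ?_, ?_⟩
    · intro w' hw' a ha
      obtain ⟨w, hw, rfl⟩ := Finset.mem_image.1 hw'
      rw [f2] at ha
      have := h1 w hw a ha
      by_cases hx : w.1 = x
      · simp only [f, if_pos hx]
        rw [hx] at this
        rcases this with rfl | h
        · exact Or.inr hxy.symm
        · exact Or.inl (hleaf _ h)
      · simpa only [f, if_neg hx] using this
    · intro a
      obtain ⟨w, hw⟩ := h2 a
      obtain ⟨hw, ha⟩ := Finset.mem_filter.1 hw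
      exact ⟨f w, hmem w a hw ha⟩
    · intro a b h
      apply h3
      exact Finset.filter_congr fun w hw => ⟨hsub a b h w hw, hsub b a h.symm w hw⟩
  refine ⟨W.image f, hW, le_antisymm ?_ (Nat.sInf_le ⟨_, hW, rfl⟩), ?_⟩
  · exact Finset.card_image_le.trans hc.le
  · obtain ⟨w, hw⟩ := h2 x
    obtain ⟨hw, ha⟩ := Finset.mem_filter.1 hw
    refine ⟨f w, Finset.mem_image_of_mem _ hw, ?_⟩
    rcases h1 w hw x ha with h | h
    · simp only [f, if_pos h.symm]
    · exact absurd ⟨w, hw, hleaf _ h.symm⟩ hy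
end

section
/- Let T be a finite tree, x a leaf of T, and y the unique neighbour of x. If y has degree 2 with second neighbour z, then there exists a watching system of T of minimum size containing at least one watcher located at z. -/
/-- If `x` is a leaf of a finite tree `T` with unique neighbour `y`, and `y` has degree 2
with second neighbour `z`, then there is a minimum watching system of `T` with a watcher
located at `z`. -/
theorem exists_min_watchingSystem_watcher_at_second_neighbour {V : Type} [Fintype V]
    [DecidableEq V] (T : SimpleGraph V) (hT : T.IsTree) (x y z : V)
    (hxy : T.Adj x y) (hleaf : ∀ u : V, T.Adj x u → u = y)
    (hyz : T.Adj y z) (hzx : z ≠ x) (hdeg2 : ∀ u : V, T.Adj y u → u = x ∨ u = z) :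
    ∃ W : Finset (V × Finset V), IsWatchingSystem T W ∧ W.card = watchingNumber T ∧
      ∃ w ∈ W, w.1 = z := by
  have hne : {k | ∃ W : Finset (V × Finset V), IsWatchingSystem T W ∧ W.card = k}.Nonempty := by
    refine ⟨_, Finset.univ.image (fun v : V => (v, ({v} : Finset V))), ⟨?_, ?_, ?_⟩, rfl⟩
    · intro w hw u hu
      simp only [Finset.mem_image, Finset.mem_univ, true_and] at hw
      obtain ⟨v, rfl⟩ := hw
      left
      simpa using hu
    · intro u
      exact ⟨(u, {u}), by simp [wLabel]⟩
    · intro u v h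
      have h1 : (u, ({u} : Finset V)) ∈
          wLabel (Finset.univ.image (fun v : V => (v, ({v} : Finset V)))) u := by simp [wLabel]
      rw [h] at h1
      have h2 := (Finset.mem_filter.1 h1).2
      exact (Finset.mem_singleton.1 h2).symm
  obtain ⟨W, hW, hcard⟩ := Nat.sInf_mem hne
  change W.card = watchingNumber T at hcard
  by_cases hz : ∃ w ∈ W, w.1 = z
  · exact ⟨W, hW, hcard, hz⟩
  obtain ⟨h1, h2, h3⟩ := hW
  have nxy : x ≠ y := hxy.ne
  have nyz : y ≠ z := hyz.ne
  have hlx : ∀ w ∈ W, x ∈ w.2 → w.1 = x ∨ w.1 = y := by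
    intro w hw hx
    rcases h1 w hw x hx with h | h
    · exact Or.inl h.symm
    · exact Or.inr (hleaf _ h.symm)
  have hly : ∀ w ∈ W, y ∈ w.2 → w.1 = x ∨ w.1 = y := by
    intro w hw hy
    rcases h1 w hw y hy with h | h
    · exact Or.inr h.symm
    · rcases hdeg2 _ h.symm with h | h
      · exact Or.inl h
      · exact absurd ⟨w, hw, h⟩ hz
  have hlo : ∀ w ∈ W, ∀ u ∈ w.2, u ≠ x → u ≠ y → u ≠ z → ¬ (w.1 = x ∨ w.1 = y) := by
    intro w hw u hu ux uy uz hor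
    have h := h1 w hw u hu
    rcases hor with e | e <;> rw [e] at h <;> rcases h with h | h
    · exact ux h
    · exact uy (hleaf _ h)
    · exact uy h
    · rcases hdeg2 _ h with h | h
      · exact ux h
      · exact uz h
  let A := W.filter (fun w => w.1 = x ∨ w.1 = y)
  let B := W.filter (fun w => ¬ (w.1 = x ∨ w.1 = y))
  have hAB : A.card + B.card = W.card := Finset.card_filter_add_card_filter_not _
  have hA : 2 ≤ A.card := by
    by_contra hlt
    have hA1 : A.card ≤ 1 := by omega
    rw [Finset.card_le_one] at hA1
    have key : ∀ a ∈ wLabel W x, ∀ b ∈ wLabel W y, a = b := by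
      intro a ha b hb
      have ha := Finset.mem_filter.1 ha
      have hb := Finset.mem_filter.1 hb
      exact hA1 a (Finset.mem_filter.2 ⟨ha.1, hlx a ha.1 ha.2⟩) b
        (Finset.mem_filter.2 ⟨hb.1, hly b hb.1 hb.2⟩)
    obtain ⟨a, ha⟩ := h2 x
    obtain ⟨b, hb⟩ := h2 y
    apply nxy
    apply h3
    ext w
    constructor
    · intro hw
      rw [key w hw b hb]; exact hb
    · intro hw
      rw [← key a ha w hw]; exact ha
  let w1 : V × Finset V := (y, {x, y})
  let w2 : V × Finset V := (z, {y, z})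
  let W' : Finset (V × Finset V) := insert w1 (insert w2 B)
  have hW'c : W'.card ≤ W.card := by
    have := Finset.card_insert_le w1 (insert w2 B)
    have := Finset.card_insert_le w2 B
    change (insert w1 (insert w2 B)).card ≤ _
    omega
  have m1 : ∀ u, w1 ∈ wLabel W' u ↔ u = x ∨ u = y := by
    intro u; simp [wLabel, W', w1]
  have m2 : ∀ u, w2 ∈ wLabel W' u ↔ u = y ∨ u = z := by
    intro u; simp [wLabel, W', w2]
  have mo : ∀ u, u ≠ x → u ≠ y → u ≠ z → wLabel W' u = wLabel W u := by
    intro u ux uy uz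
    ext w
    simp only [wLabel, W', B, Finset.mem_filter, Finset.mem_insert]
    constructor
    · rintro ⟨rfl | rfl | h, hu⟩
      · simp [w1, ux, uy] at hu
      · simp [w2, uz, uy] at hu
      · exact ⟨h.1, hu⟩
    · rintro ⟨h, hu⟩
      exact ⟨Or.inr (Or.inr ⟨h, hlo w h u hu ux uy uz⟩), hu⟩
  have hW' : IsWatchingSystem T W' := by
    refine ⟨?_, ?_, ?_⟩
    · intro w hw u hu
      simp only [W', B, Finset.mem_filter, Finset.mem_insert] at hw
      rcases hw with rfl | rfl | hw
      · simp only [w1, Finset.mem_insert, Finset.mem_singleton] at hu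
        rcases hu with rfl | rfl
        · exact Or.inr hxy.symm
        · exact Or.inl rfl
      · simp only [w2, Finset.mem_insert, Finset.mem_singleton] at hu
        rcases hu with rfl | rfl
        · exact Or.inr hyz.symm
        · exact Or.inl rfl
      · exact h1 w hw.1 u hu
    · intro u
      by_cases ux : u = x
      · exact ⟨w1, (m1 u).2 (Or.inl ux)⟩
      by_cases uy : u = y
      · exact ⟨w1, (m1 u).2 (Or.inr uy)⟩
      by_cases uz : u = z
      · exact ⟨w2, (m2 u).2 (Or.inr uz)⟩
      rw [mo u ux uy uz]
      exact h2 u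
    · intro u v h
      have e1 : (u = x ∨ u = y) ↔ (v = x ∨ v = y) := by rw [← m1, ← m1, h]
      have e2 : (u = y ∨ u = z) ↔ (v = y ∨ v = z) := by rw [← m2, ← m2, h]
      by_cases hu : u = x ∨ u = y ∨ u = z
      · grind
      · have hv : ¬ (v = x ∨ v = y ∨ v = z) := by grind
        push Not at hu hv
        rw [mo u hu.1 hu.2.1 hu.2.2, mo v hv.1 hv.2.1 hv.2.2] at h
        exact h3 u v h
  refine ⟨W', hW', le_antisymm (hcard ▸ hW'c) (Nat.sInf_le ⟨W', hW', rfl⟩), w2, ?_, rfl⟩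
  simp [W']
end

section
/- Let T be a tree with exactly four vertices and let v be a vertex of T. Then there exists a set W of two watchers in T such that every vertex of V(T) \ {v} is covered by at least one watcher of W, any two distinct vertices of V(T) \ {v} are separated by some watcher of W (i.e., have distinct labels), and v is covered by at least one watcher of W. -/
theorem w_cut {V : Type} (T : SimpleGraph V) (hT : T.Connected) (S : Set V) (x y : V)
    (hx : x ∈ S) (hy : y ∉ S) : ∃ p q, p ∈ S ∧ q ∉ S ∧ T.Adj p q := by
  obtain ⟨w⟩ := hT.preconnected x y
  obtain ⟨d, _, h1, h2⟩ := w.exists_boundary_dart S hx hy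
  exact ⟨d.fst, d.snd, h1, h2, d.adj⟩

theorem w_key {V : Type} [DecidableEq V] (T : SimpleGraph V) (v a b c x y : V)
    (hva : v ≠ a) (hvb : v ≠ b) (hvc : v ≠ c) (hab : a ≠ b) (hac : a ≠ c) (hbc : b ≠ c)
    (hall : ∀ u, u = v ∨ u = a ∨ u = b ∨ u = c)
    (h1 : v = x ∨ T.Adj x v) (h2 : a = x ∨ T.Adj x a) (h3 : b = x ∨ T.Adj x b)
    (h4 : b = y ∨ T.Adj y b) (h5 : c = y ∨ T.Adj y c) :
    ∃ W : Finset (V × Finset V), W.card = 2 ∧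
      (∀ w ∈ W, ∀ x ∈ w.2, x = w.1 ∨ T.Adj w.1 x) ∧
      (∀ u : V, u ≠ v → (wLabel W u).Nonempty) ∧
      (∀ u u' : V, u ≠ v → u' ≠ v → wLabel W u = wLabel W u' → u = u') ∧
      (wLabel W v).Nonempty := by
  have hne : ((x, {v, a, b}) : V × Finset V) ≠ (y, {b, c}) := by
    intro h
    have h' : ({v, a, b} : Finset V) = {b, c} := (Prod.ext_iff.1 h).2
    have : a ∈ ({b, c} : Finset V) := h' ▸ (by simp : a ∈ ({v, a, b} : Finset V))
    simp [hab, hac] at this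
  have m : ∀ u w, w ∈ wLabel {((x, {v, a, b}) : V × Finset V), (y, {b, c})} u ↔
      (w = (x, {v, a, b}) ∧ (u = v ∨ u = a ∨ u = b)) ∨ (w = (y, {b, c}) ∧ (u = b ∨ u = c)) := by
    intro u w
    simp only [wLabel, Finset.mem_filter, Finset.mem_insert, Finset.mem_singleton]
    constructor
    · rintro ⟨rfl | rfl, h⟩
      · left; simpa using h
      · right; simpa using h
    · rintro (⟨rfl, h⟩ | ⟨rfl, h⟩)
      · simpa using h
      · simpa using h
  refine ⟨{(x, {v, a, b}), (y, {b, c})}, Finset.card_pair hne, ?_, ?_, ?_, ?_⟩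
  · intro w hw z hz
    simp only [Finset.mem_insert, Finset.mem_singleton] at hw
    rcases hw with rfl | rfl
    · simp only [Finset.mem_insert, Finset.mem_singleton] at hz
      rcases hz with rfl | rfl | rfl <;> assumption
    · simp only [Finset.mem_insert, Finset.mem_singleton] at hz
      rcases hz with rfl | rfl <;> assumption
  · intro u hu
    rcases hall u with h | h | h | h
    · exact absurd h hu
    · exact ⟨(x, {v, a, b}), (m _ _).2 (Or.inl ⟨rfl, by simp [h]⟩)⟩
    · exact ⟨(x, {v, a, b}), (m _ _).2 (Or.inl ⟨rfl, by simp [h]⟩)⟩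
    · exact ⟨(y, {b, c}), (m _ _).2 (Or.inr ⟨rfl, by simp [h]⟩)⟩
  · intro u u' hu hu' h
    have e1 : (u = v ∨ u = a ∨ u = b) ↔ (u' = v ∨ u' = a ∨ u' = b) := by
      have := m u (x, {v, a, b})
      rw [h, m] at this
      simp only [hne, true_and, false_and, or_false] at this
      exact this.symm
    have e2 : (u = b ∨ u = c) ↔ (u' = b ∨ u' = c) := by
      have := m u (y, {b, c})
      rw [h, m] at this
      simp only [hne.symm, true_and, false_and, false_or] at this
      exact this.symm
    have := hall u
    have := hall u'
    grind
  · exact ⟨(x, {v, a, b}), (m _ _).2 (Or.inl ⟨rfl, by simp⟩)⟩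

theorem w_bool : ∀ va vb vc ab ac bc : Prop,
    (va ∨ vb ∨ vc) → (va ∨ ab ∨ ac) → (vb ∨ ab ∨ bc) → (vc ∨ ac ∨ bc) →
    (vb ∨ vc ∨ ab ∨ ac) → (va ∨ vc ∨ ab ∨ bc) → (va ∨ vb ∨ ac ∨ bc) →
    let P := fun va vb vc ab ac bc : Prop =>
      ((va ∧ vb) ∨ (va ∧ ab) ∨ (vb ∧ ab) ∨ (vc ∧ ac ∧ bc)) ∧ (bc ∨ (vb ∧ vc) ∨ (ab ∧ ac))
    P va vb vc ab ac bc ∨ P va vc vb ac ab bc ∨ P vb va vc ab bc ac ∨ P vb vc va bc ab ac ∨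
    P vc va vb ac bc ab ∨ P vc vb va bc ac ab := by
  intro va vb vc ab ac bc h1 h2 h3 h4 h5 h6 h7 P
  by_cases va <;> by_cases vb <;> by_cases vc <;> by_cases ab <;> by_cases ac <;> by_cases bc <;>
    simp_all [P]

theorem w_key2 {V : Type} [DecidableEq V] (T : SimpleGraph V) (v a b c : V)
    (hva : v ≠ a) (hvb : v ≠ b) (hvc : v ≠ c) (hab : a ≠ b) (hac : a ≠ c) (hbc : b ≠ c)
    (hall : ∀ u, u = v ∨ u = a ∨ u = b ∨ u = c)
    (h : ((T.Adj v a ∧ T.Adj v b) ∨ (T.Adj v a ∧ T.Adj a b) ∨ (T.Adj v b ∧ T.Adj a b) ∨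
      (T.Adj v c ∧ T.Adj a c ∧ T.Adj b c)) ∧
      (T.Adj b c ∨ (T.Adj v b ∧ T.Adj v c) ∨ (T.Adj a b ∧ T.Adj a c))) :
    ∃ W : Finset (V × Finset V), W.card = 2 ∧
      (∀ w ∈ W, ∀ x ∈ w.2, x = w.1 ∨ T.Adj w.1 x) ∧
      (∀ u : V, u ≠ v → (wLabel W u).Nonempty) ∧
      (∀ u u' : V, u ≠ v → u' ≠ v → wLabel W u = wLabel W u' → u = u') ∧
      (wLabel W v).Nonempty := by
  obtain ⟨x, h1, h2, h3⟩ : ∃ x, (v = x ∨ T.Adj x v) ∧ (a = x ∨ T.Adj x a) ∧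
      (b = x ∨ T.Adj x b) := by
    rcases h.1 with h | h | h | h
    · exact ⟨v, by simp [h]⟩
    · exact ⟨a, by simp [h, h.1.symm]⟩
    · exact ⟨b, by simp [h.1.symm, h.2.symm]⟩
    · exact ⟨c, by simp [h.1.symm, h.2.1.symm, h.2.2.symm]⟩
  obtain ⟨y, h4, h5⟩ : ∃ y, (b = y ∨ T.Adj y b) ∧ (c = y ∨ T.Adj y c) := by
    rcases h.2 with h | h | h
    · exact ⟨b, by simp [h]⟩
    · exact ⟨v, by simp [h]⟩
    · exact ⟨a, by simp [h]⟩
  exact w_key T v a b c x y hva hvb hvc hab hac hbc hall h1 h2 h3 h4 h5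

/-- In a tree `T` with four vertices, for any vertex `v` there is a set of two watchers
covering and pairwise separating all vertices other than `v`, and covering `v`. -/
theorem tree_order_four_two_watchers {V : Type} [Fintype V] [DecidableEq V]
    (T : SimpleGraph V) (hT : T.IsTree) (hcard : Fintype.card V = 4) (v : V) :
    ∃ W : Finset (V × Finset V), W.card = 2 ∧
      (∀ w ∈ W, ∀ x ∈ w.2, x = w.1 ∨ T.Adj w.1 x) ∧
      (∀ u : V, u ≠ v → (wLabel W u).Nonempty) ∧
      (∀ u u' : V, u ≠ v → u' ≠ v → wLabel W u = wLabel W u' → u = u') ∧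
      (wLabel W v).Nonempty := by
  have h3 : (Finset.univ.erase v).card = 3 := by
    rw [Finset.card_erase_of_mem (Finset.mem_univ v), Finset.card_univ, hcard]
  obtain ⟨a, b, c, hab, hac, hbc, he⟩ := Finset.card_eq_three.1 h3
  have hm : ∀ u, u ≠ v ↔ (u = a ∨ u = b ∨ u = c) := by
    intro u
    have : u ∈ Finset.univ.erase v ↔ u ∈ ({a, b, c} : Finset V) := by rw [he]
    simpa using this
  have hva : v ≠ a := ((hm a).2 (by simp)).symm
  have hvb : v ≠ b := ((hm b).2 (by simp)).symm
  have hvc : v ≠ c := ((hm c).2 (by simp)).symm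
  have hall : ∀ u, u = v ∨ u = a ∨ u = b ∨ u = c := by
    intro u
    have := hm u
    tauto
  have cut := w_cut T hT.1
  have sy : ∀ p q, T.Adj p q ↔ T.Adj q p := fun p q => T.adj_comm p q
  have c1 := cut {v} v a (by simp) (by simp [hva.symm])
  have c2 := cut {a} a v (by simp) (by simp [hva])
  have c3 := cut {b} b v (by simp) (by simp [hvb])
  have c4 := cut {c} c v (by simp) (by simp [hvc])
  have c5 := cut {v, a} v b (by simp) (by simp [hvb.symm, hab.symm])
  have c6 := cut {v, b} v a (by simp) (by simp [hva.symm, hab])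
  have c7 := cut {v, c} v a (by simp) (by simp [hva.symm, hac])
  simp only [Set.mem_insert_iff, Set.mem_singleton_iff] at c1 c2 c3 c4 c5 c6 c7
  have sba := sy b a
  have sca := sy c a
  have scb := sy c b
  have B := w_bool (T.Adj v a) (T.Adj v b) (T.Adj v c) (T.Adj a b) (T.Adj a c) (T.Adj b c)
    (by obtain ⟨p, q, hp, hq, h⟩ := c1; have := hall q; grind)
    (by obtain ⟨p, q, hp, hq, h⟩ := c2; have := hall q; grind)
    (by obtain ⟨p, q, hp, hq, h⟩ := c3; have := hall q; grind)
    (by obtain ⟨p, q, hp, hq, h⟩ := c4; have := hall q; grind)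
    (by obtain ⟨p, q, hp, hq, h⟩ := c5; have := hall q; grind)
    (by obtain ⟨p, q, hp, hq, h⟩ := c6; have := hall q; grind)
    (by obtain ⟨p, q, hp, hq, h⟩ := c7; have := hall q; grind)
  rcases B with h | h | h | h | h | h
  · exact w_key2 T v a b c hva hvb hvc hab hac hbc hall h
  · exact w_key2 T v a c b hva hvc hvb hac hab hbc.symm (fun u => by rcases hall u with h | h | h | h <;> simp [h]) (by rw [scb]; exact h)
  · exact w_key2 T v b a c hvb hva hvc hab.symm hbc hac (fun u => by rcases hall u with h | h | h | h <;> simp [h]) (by rw [sba]; exact h)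
  · exact w_key2 T v b c a hvb hvc hva hbc hab.symm hac.symm (fun u => by rcases hall u with h | h | h | h <;> simp [h]) (by rw [sba, sca]; exact h)
  · exact w_key2 T v c a b hvc hva hvb hac.symm hbc.symm hab (fun u => by rcases hall u with h | h | h | h <;> simp [h]) (by rw [sca, scb]; exact h)
  · exact w_key2 T v c b a hvc hvb hva hbc.symm hac.symm hab.symm (fun u => by rcases hall u with h | h | h | h <;> simp [h])
      (by rw [sca, scb, sba]; exact h)
end

section
/- Let G be a finite connected simple graph with n vertices. If n = 1 then w(G) = 1; if n = 2 or n = 3 then w(G) = 2; if n = 4 or n = 5 then w(G) = 3. -/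
theorem ws_lower {V : Type} [Fintype V] [DecidableEq V] (G : SimpleGraph V)
    (W : Finset (V × Finset V)) (h : IsWatchingSystem G W) :
    Fintype.card V < 2 ^ W.card := by
  have h1 : (Finset.univ.image (wLabel W)) ⊆ W.powerset.erase ∅ := by
    intro L hL
    obtain ⟨x, -, rfl⟩ := Finset.mem_image.1 hL
    rw [Finset.mem_erase, Finset.mem_powerset]
    exact ⟨(h.2.1 x).ne_empty, Finset.filter_subset _ _⟩
  have h2 := Finset.card_le_card h1
  rw [Finset.card_image_of_injective _ (fun x y => h.2.2 x y),
    Finset.card_erase_of_mem (Finset.empty_mem_powerset W), Finset.card_powerset,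
    Finset.card_univ] at h2
  have : 0 < 2 ^ W.card := by positivity
  omega

theorem ws_eq {V : Type} [Fintype V] [DecidableEq V] (G : SimpleGraph V) (k : ℕ)
    (hk : 2 ^ k ≤ Fintype.card V)
    (h : ∃ W, IsWatchingSystem G W ∧ W.card ≤ k + 1) : watchingNumber G = k + 1 := by
  have low : ∀ W, IsWatchingSystem G W → k + 1 ≤ W.card := by
    intro W hW
    have := ws_lower G W hW
    exact (Nat.pow_lt_pow_iff_right (by norm_num : 1 < 2)).1 (hk.trans_lt this)
  obtain ⟨W, hW, hc⟩ := h
  unfold watchingNumber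
  apply le_antisymm
  · exact le_trans (Nat.sInf_le (Set.mem_setOf.2 ⟨W, hW, rfl⟩)) hc
  · refine le_csInf ⟨_, W, hW, rfl⟩ ?_
    rintro m ⟨W', hW', rfl⟩
    exact low W' hW'

theorem ws_mk {V : Type} [DecidableEq V] (G : SimpleGraph V)
    (l : List V) (hl : ∀ x, x ∈ l) (v1 v2 v3 : V) (Z1 Z2 Z3 : Finset V)
    (h1 : ∀ x ∈ Z1, x = v1 ∨ G.Adj v1 x) (h2 : ∀ x ∈ Z2, x = v2 ∨ G.Adj v2 x)
    (h3 : ∀ x ∈ Z3, x = v3 ∨ G.Adj v3 x)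
    (hc : ∀ x ∈ l, x ∈ Z1 ∨ x ∈ Z2 ∨ x ∈ Z3)
    (hs : ∀ x ∈ l, ∀ y ∈ l, (x ∈ Z1 ↔ y ∈ Z1) → (x ∈ Z2 ↔ y ∈ Z2) → (x ∈ Z3 ↔ y ∈ Z3) → x = y) :
    IsWatchingSystem G {(v1, Z1), (v2, Z2), (v3, Z3)} := by
  refine ⟨?_, ?_, ?_⟩
  · intro w hw
    simp only [Finset.mem_insert, Finset.mem_singleton] at hw
    rcases hw with rfl | rfl | rfl <;> assumption
  · intro x
    rcases hc x (hl x) with h | h | h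
    · exact ⟨(v1, Z1), by simp [wLabel, h]⟩
    · exact ⟨(v2, Z2), by simp [wLabel, h]⟩
    · exact ⟨(v3, Z3), by simp [wLabel, h]⟩
  · intro x y h
    have key : ∀ w ∈ ({(v1, Z1), (v2, Z2), (v3, Z3)} : Finset (V × Finset V)),
        (x ∈ w.2 ↔ y ∈ w.2) := by
      intro w hw
      have := Finset.ext_iff.1 h w
      simpa only [wLabel, Finset.mem_filter, hw, true_and] using this
    exact hs x (hl x) y (hl y) (key (v1, Z1) (by simp)) (key (v2, Z2) (by simp)) (key (v3, Z3) (by simp))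

theorem ws_exit {V : Type} [Fintype V] [DecidableEq V] (G : SimpleGraph V) (hG : G.Connected)
    (S : Finset V) (u : V) (hu : u ∈ S) (hS : S.card < Fintype.card V) :
    ∃ a ∈ S, ∃ b ∉ S, G.Adj a b := by
  obtain ⟨v, hv⟩ : ∃ v, v ∉ S := by
    by_contra! h
    rw [Finset.eq_univ_iff_forall.2 h, Finset.card_univ] at hS
    exact lt_irrefl _ hS
  obtain ⟨p⟩ := hG.preconnected u v
  obtain ⟨d, -, h1, h2⟩ := p.exists_boundary_dart (S : Set V) hu hv
  exact ⟨d.fst, h1, d.snd, h2, d.adj⟩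

theorem ws_all {V : Type} [Fintype V] [DecidableEq V] (S : Finset V)
    (h : S.card = Fintype.card V) (x : V) : x ∈ S := by
  rw [Finset.eq_univ_of_card S h]; exact Finset.mem_univ x

theorem ws_p3 {V : Type} [Fintype V] [DecidableEq V] (G : SimpleGraph V) (hG : G.Connected)
    (h : 3 ≤ Fintype.card V) : ∃ p q r, [p, q, r].Nodup ∧ G.Adj q p ∧ G.Adj q r := by
  obtain ⟨a⟩ := hG.nonempty
  obtain ⟨a', ha', b, hb, hab⟩ := ws_exit G hG {a} a (by simp) (by simp; omega)
  simp only [Finset.mem_singleton] at ha' hb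
  subst ha'
  obtain ⟨x, hx, c, hc, hxc⟩ := ws_exit G hG {a', b} a' (by simp)
    (Finset.card_le_two.trans_lt (by omega))
  simp only [Finset.mem_insert, Finset.mem_singleton, not_or] at hx hc
  rcases hx with rfl | rfl
  · exact ⟨b, x, c, by simp; grind, hab, hxc⟩
  · exact ⟨a', x, c, by simp; grind, hab.symm, hxc⟩

theorem ws_p4 {V : Type} [Fintype V] [DecidableEq V] (G : SimpleGraph V) (hG : G.Connected)
    (h : 4 ≤ Fintype.card V) : ∃ p q r s, [p, q, r, s].Nodup ∧ G.Adj q p ∧ G.Adj q r ∧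
      (G.Adj q s ∨ G.Adj r s) := by
  obtain ⟨p, q, r, hn, h1, h2⟩ := ws_p3 G hG (by omega)
  obtain ⟨x, hx, c, hc, hxc⟩ := ws_exit G hG {p, q, r} p (by simp)
    (Finset.card_le_three.trans_lt (by omega))
  simp only [Finset.mem_insert, Finset.mem_singleton, not_or] at hx hc
  rcases hx with rfl | rfl | rfl
  · exact ⟨r, q, x, c, by simp at *; grind, h2, h1, .inr hxc⟩
  · exact ⟨p, x, r, c, by simp at *; grind, h1, h2, .inl hxc⟩
  · exact ⟨p, q, x, c, by simp at *; grind, h1, h2, .inr hxc⟩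

/-- star, chair, path on five vertices -/
theorem ws_p5 {V : Type} [Fintype V] [DecidableEq V] (G : SimpleGraph V) (hG : G.Connected)
    (h : 5 ≤ Fintype.card V) : ∃ a b c d e, [a, b, c, d, e].Nodup ∧
      ((G.Adj c a ∧ G.Adj c b ∧ G.Adj c d ∧ (G.Adj c e ∨ G.Adj d e)) ∨
      (G.Adj b a ∧ G.Adj c b ∧ G.Adj c d ∧ G.Adj d e)) := by
  obtain ⟨p, q, r, s, hn, h1, h2, h3⟩ := ws_p4 G hG (by omega)
  obtain ⟨x, hx, c, hc, hxc⟩ := ws_exit G hG {p, q, r, s} p (by simp)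
    (Finset.card_le_four.trans_lt (by omega))
  simp only [Finset.mem_insert, Finset.mem_singleton, not_or] at hx hc
  rcases h3 with h3 | h3
  · rcases hx with rfl | rfl | rfl | rfl
    · exact ⟨r, s, q, x, c, by simp at *; grind, .inl ⟨h2, h3, h1, .inr hxc⟩⟩
    · exact ⟨p, r, x, s, c, by simp at *; grind, .inl ⟨h1, h2, h3, .inl hxc⟩⟩
    · exact ⟨p, s, q, x, c, by simp at *; grind, .inl ⟨h1, h3, h2, .inr hxc⟩⟩
    · exact ⟨p, r, q, x, c, by simp at *; grind, .inl ⟨h1, h2, h3, .inr hxc⟩⟩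
  · rcases hx with rfl | rfl | rfl | rfl
    · exact ⟨c, x, q, r, s, by simp at *; grind, .inr ⟨hxc, h1, h2, h3⟩⟩
    · exact ⟨p, c, x, r, s, by simp at *; grind, .inl ⟨h1, hxc, h2, .inr h3⟩⟩
    · exact ⟨s, c, x, q, p, by simp at *; grind, .inl ⟨h3, hxc, h2.symm, .inr h1⟩⟩
    · exact ⟨p, q, r, x, c, by simp at *; grind, .inr ⟨h1, h2.symm, h3, hxc⟩⟩

theorem ws_list {V : Type} [Fintype V] [DecidableEq V] (l : List V) (hl : l.Nodup)
    (h : l.length = Fintype.card V) (x : V) : x ∈ l := by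
  have := ws_all l.toFinset (by rw [List.toFinset_card_of_nodup hl, h]) x
  simpa using this

theorem watchingNumber_small_orders {V : Type} [Fintype V] [DecidableEq V]
    (G : SimpleGraph V) (hG : G.Connected) :
    (Fintype.card V = 1 → watchingNumber G = 1) ∧
    (Fintype.card V = 2 ∨ Fintype.card V = 3 → watchingNumber G = 2) ∧
    (Fintype.card V = 4 ∨ Fintype.card V = 5 → watchingNumber G = 3) := by
  refine ⟨fun h => ?_, fun h => ?_, fun h => ?_⟩
  · obtain ⟨a⟩ := hG.nonempty
    have hall := ws_list [a] (by simp) (by simp [h])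
    refine ws_eq G 0 (by omega) ⟨_, ws_mk G _ hall a a a {a} {a} {a} ?_ ?_ ?_ ?_ ?_, by simp⟩ <;>
      (clear hall; simp at * <;> grind)
  · rcases h with h | h
    · obtain ⟨a, b, hab⟩ := Fintype.exists_pair_of_one_lt_card (by omega : 1 < Fintype.card V)
      have hall := ws_list [a, b] (by simpa using hab) (by simp [h])
      refine ws_eq G 1 (by omega) ⟨_, ws_mk G _ hall a b b {a} {b} {b} ?_ ?_ ?_ ?_ ?_, ?_⟩
      on_goal 6 => simpa using Finset.card_le_two
      all_goals clear hall; simp at * <;> grind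
    · obtain ⟨a, c, b, hn, h1, h2⟩ := ws_p3 G hG (by omega)
      have hall := ws_list _ hn (by simp [h])
      refine ws_eq G 1 (by omega) ⟨_, ws_mk G _ hall c c c {c, a} {c, b} {c, b} ?_ ?_ ?_ ?_ ?_, ?_⟩
      on_goal 6 => simpa using Finset.card_le_two
      all_goals clear hall; simp at * <;> grind
  · rcases h with h | h
    · obtain ⟨p, q, r, s, hn, h1, h2, h3⟩ := ws_p4 G hG (by omega)
      have hall := ws_list _ hn (by simp [h])
      refine ws_eq G 2 (by omega)
        ⟨_, ws_mk G _ hall q q s {q, p} {q, r} {s} ?_ ?_ ?_ ?_ ?_, Finset.card_le_three⟩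
      all_goals clear hall; simp at * <;> grind
    · obtain ⟨a, b, c, d, e, hn, ⟨h1, h2, h3, h4 | h4⟩ | ⟨h1, h2, h3, h4⟩⟩ := ws_p5 G hG (by omega)
      all_goals have hall := ws_list _ hn (by simp [h])
      · refine ws_eq G 2 (by omega)
          ⟨_, ws_mk G _ hall c c c {a, c, d} {b, c} {d, e} ?_ ?_ ?_ ?_ ?_, Finset.card_le_three⟩
        all_goals clear hall; simp at * <;> grind
      · refine ws_eq G 2 (by omega)
          ⟨_, ws_mk G _ hall c c d {a, c, d} {b, c} {d, e} ?_ ?_ ?_ ?_ ?_, Finset.card_le_three⟩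
        all_goals clear hall; simp at * <;> grind
      · refine ws_eq G 2 (by omega)
          ⟨_, ws_mk G _ hall b d c {a, b} {d, e} {b, c, d} ?_ ?_ ?_ ?_ ?_, Finset.card_le_three⟩
        all_goals clear hall; simp at * <;> grind [SimpleGraph.Adj.symm]
end

section
/- Let G be a finite connected simple graph with n vertices, where n ∉ {1, 2, 4}. Then w(G) ≤ 2n/3. -/
/-- Cut-connectedness of a finite set of vertices. -/
def CConn {V : Type} [DecidableEq V] (G : SimpleGraph V) (S : Finset V) : Prop :=
  S.Nonempty ∧ ∀ A ⊆ S, A.Nonempty → A ≠ S → ∃ a ∈ A, ∃ b ∈ S, b ∉ A ∧ G.Adj a b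

/-- Indexed watching system of size `k` for the set `S`. -/
def GoodW {V : Type} [DecidableEq V] (G : SimpleGraph V) (S : Finset V) (k : ℕ) : Prop :=
  ∃ (ι : Type) (_ : Fintype ι) (c : ι → V) (Z : ι → V → Prop), Fintype.card ι = k ∧
    (∀ i x, Z i x → x ∈ S ∧ (x = c i ∨ G.Adj (c i) x)) ∧
    (∀ x ∈ S, ∃ i, Z i x) ∧
    (∀ x ∈ S, ∀ y ∈ S, (∀ i, Z i x ↔ Z i y) → x = y)

/-- Near decomposition of `X` around `v`. -/
def NearD {V : Type} [DecidableEq V] (G : SimpleGraph V) (v : V) (X : Finset V) : Prop :=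
  ∃ (L R Q : Finset V) (ι : Type) (_ : Fintype ι) (c : ι → V) (Z : ι → V → Prop),
    X = L ∪ R ∧ Disjoint L R ∧ Q ⊆ R ∧ (∀ x ∈ L, G.Adj v x) ∧ (∀ x ∈ Q, G.Adj v x) ∧
    2 * Fintype.card ι = R.card ∧
    (∀ i x, Z i x → x ∈ R ∧ (x = c i ∨ G.Adj (c i) x)) ∧
    (∀ x ∈ R, ∃ i, Z i x) ∧
    (∀ x ∈ R, ∀ y ∈ R, (∀ i, Z i x ↔ Z i y) → (x ∈ Q ↔ y ∈ Q) → x = y)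

theorem GoodW.union {V : Type} [DecidableEq V] {G : SimpleGraph V} {A B : Finset V} {k l : ℕ}
    (hA : GoodW G A k) (hB : GoodW G B l) (hd : Disjoint A B) : GoodW G (A ∪ B) (k + l) := by
  obtain ⟨ι, _, c, Z, h1, h2, h3, h4⟩ := hA
  obtain ⟨κ, _, d, Y, g1, g2, g3, g4⟩ := hB
  have hd' : ∀ x, x ∈ A → x ∈ B → False := fun x hx hy => Finset.disjoint_left.1 hd hx hy
  refine ⟨ι ⊕ κ, inferInstance, Sum.elim c d, Sum.elim Z Y, by simp [h1, g1], ?_, ?_, ?_⟩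
  · rintro (i | i) x h
    · exact ⟨Finset.mem_union_left _ (h2 i x h).1, (h2 i x h).2⟩
    · exact ⟨Finset.mem_union_right _ (g2 i x h).1, (g2 i x h).2⟩
  · intro x hx
    rcases Finset.mem_union.1 hx with hx | hx
    · obtain ⟨i, hi⟩ := h3 x hx
      exact ⟨Sum.inl i, hi⟩
    · obtain ⟨i, hi⟩ := g3 x hx
      exact ⟨Sum.inr i, hi⟩
  · intro x hx y hy h
    have hl : ∀ i, Z i x ↔ Z i y := fun i => h (Sum.inl i)
    have hr : ∀ i, Y i x ↔ Y i y := fun i => h (Sum.inr i)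
    rcases Finset.mem_union.1 hx with hx | hx <;> rcases Finset.mem_union.1 hy with hy | hy
    · exact h4 x hx y hy hl
    · obtain ⟨i, hi⟩ := h3 x hx
      exact (hd' y (h2 i y ((hl i).1 hi)).1 hy).elim
    · obtain ⟨i, hi⟩ := h3 y hy
      exact (hd' x (h2 i x ((hl i).2 hi)).1 hx).elim
    · exact g4 x hx y hy hr

theorem NearD.union {V : Type} [DecidableEq V] {G : SimpleGraph V} {v : V} {A B : Finset V}
    (hA : NearD G v A) (hB : NearD G v B) (hd : Disjoint A B) : NearD G v (A ∪ B) := by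
  obtain ⟨L, R, Q, ι, _, c, Z, rfl, h1, h2, h3, h4, h5, h6, h7, h8⟩ := hA
  obtain ⟨L', R', Q', κ, _, d, Y, rfl, g1, g2, g3, g4, g5, g6, g7, g8⟩ := hB
  simp only [Finset.disjoint_union_left, Finset.disjoint_union_right] at hd
  have hd' : ∀ x, x ∈ R → x ∈ R' → False := fun x hx hy => Finset.disjoint_left.1 hd.2.2 hx hy
  refine ⟨L ∪ L', R ∪ R', Q ∪ Q', ι ⊕ κ, inferInstance, Sum.elim c d, Sum.elim Z Y,
    ?_, ?_, ?_, ?_, ?_, ?_, ?_, ?_, ?_⟩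
  · ext x; simp only [Finset.mem_union]; tauto
  · simp only [Finset.disjoint_union_left, Finset.disjoint_union_right]
    exact ⟨⟨h1, hd.1.2.symm⟩, ⟨hd.2.1, g1⟩⟩
  · exact Finset.union_subset_union h2 g2
  · intro x hx
    exact (Finset.mem_union.1 hx).elim (h3 x) (g3 x)
  · intro x hx
    exact (Finset.mem_union.1 hx).elim (h4 x) (g4 x)
  · rw [Finset.card_union_of_disjoint hd.2.2, Fintype.card_sum]; omega
  · rintro (i | i) x h
    · exact ⟨Finset.mem_union_left _ (h6 i x h).1, (h6 i x h).2⟩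
    · exact ⟨Finset.mem_union_right _ (g6 i x h).1, (g6 i x h).2⟩
  · intro x hx
    rcases Finset.mem_union.1 hx with hx | hx
    · obtain ⟨i, hi⟩ := h7 x hx
      exact ⟨Sum.inl i, hi⟩
    · obtain ⟨i, hi⟩ := g7 x hx
      exact ⟨Sum.inr i, hi⟩
  · intro x hx y hy h hq
    have hl : ∀ i, Z i x ↔ Z i y := fun i => h (Sum.inl i)
    have hr : ∀ i, Y i x ↔ Y i y := fun i => h (Sum.inr i)
    simp only [Finset.mem_union] at hq
    rcases Finset.mem_union.1 hx with hx | hx <;> rcases Finset.mem_union.1 hy with hy | hy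
    · refine h8 x hx y hy hl ?_
      have := fun h => hd' x hx (g2 h)
      have := fun h => hd' y hy (g2 h)
      tauto
    · obtain ⟨i, hi⟩ := h7 x hx
      exact (hd' y (h6 i y ((hl i).1 hi)).1 hy).elim
    · obtain ⟨i, hi⟩ := h7 y hy
      exact (hd' x (h6 i x ((hl i).2 hi)).1 hx).elim
    · refine g8 x hx y hy hr ?_
      have := fun h => hd' x (h2 h) hx
      have := fun h => hd' y (h2 h) hy
      tauto

theorem NearD.empty {V : Type} [DecidableEq V] {G : SimpleGraph V} {v : V} :
    NearD G v ∅ :=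
  ⟨∅, ∅, ∅, Empty, inferInstance, Empty.elim, fun i _ => i.elim, by simp⟩

theorem NearD.one {V : Type} [DecidableEq V] {G : SimpleGraph V} {v r : V} (h : G.Adj v r) :
    NearD G v {r} :=
  ⟨{r}, ∅, ∅, Empty, inferInstance, Empty.elim, fun i _ => i.elim, by simp [h]⟩

theorem NearD.two {V : Type} [DecidableEq V] {G : SimpleGraph V} {v r x : V} (h : G.Adj v r)
    (hx : G.Adj r x) : NearD G v {r, x} := by
  have hne := hx.ne
  refine ⟨∅, {r, x}, {r}, Unit, inferInstance, fun _ => r, fun _ y => y = r ∨ y = x,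
    by simp, by simp, by simp, by simp, by simp [h], ?_, ?_, ?_, ?_⟩
  · simp [Finset.card_pair hne]
  · rintro _ y (rfl | rfl) <;> simp [hx]
  · intro y hy; exact ⟨(), by simpa using hy⟩
  · intro a ha b hb _ hq
    simp only [Finset.mem_insert, Finset.mem_singleton] at ha hb hq
    grind

theorem NearD.four {V : Type} [DecidableEq V] {G : SimpleGraph V} {v r y z w : V} (s t : V)
    (h : G.Adj v r) (h1 : r ≠ y) (h2 : r ≠ z) (h3 : r ≠ w) (h4 : y ≠ z) (h5 : y ≠ w) (h6 : z ≠ w)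
    (hs : ∀ x, x = r ∨ x = y ∨ x = z → x = s ∨ G.Adj s x)
    (ht : ∀ x, x = z ∨ x = w → x = t ∨ G.Adj t x) :
    NearD G v {r, y, z, w} := by
  refine ⟨∅, {r, y, z, w}, {r}, Bool, inferInstance, fun b => if b then s else t,
    fun b x => if b then x = r ∨ x = y ∨ x = z else x = z ∨ x = w,
    by simp, by simp, by simp, by simp, by simp [h], ?_, ?_, ?_, ?_⟩
  · simp [h1, h2, h3, h4, h5, h6]
  · rintro (_ | _) x hx
    · simp only [Bool.false_eq_true, if_false] at hx ⊢
      exact ⟨by simp only [Finset.mem_insert, Finset.mem_singleton]; tauto, ht x hx⟩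
    · simp only [if_true] at hx ⊢
      exact ⟨by simp only [Finset.mem_insert, Finset.mem_singleton]; tauto, hs x hx⟩
  · intro x hx
    simp only [Finset.mem_insert, Finset.mem_singleton] at hx
    rcases hx with rfl | rfl | rfl | rfl
    · exact ⟨true, by simp⟩
    · exact ⟨true, by simp⟩
    · exact ⟨true, by simp⟩
    · exact ⟨false, by simp⟩
  · intro a ha b hb hl hq
    have e1 := hl true
    have e2 := hl false
    simp only [if_true, Bool.false_eq_true, if_false] at e1 e2
    simp only [Finset.mem_insert, Finset.mem_singleton] at ha hb hq
    grind

theorem NearD.branch {V : Type} [DecidableEq V] {G : SimpleGraph V} {v r : V} {B : Finset V}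
    (h : G.Adj v r) (hr : r ∈ B) (hB : CConn G B)
    (hc : B.card = 1 ∨ B.card = 2 ∨ B.card = 4) : NearD G v B := by
  have step : ∀ A : Finset V, A ⊆ B → A.Nonempty → A.card < B.card →
      ∃ a ∈ A, ∃ b ∈ B, b ∉ A ∧ G.Adj a b := fun A h1 h2 h3 =>
    hB.2 A h1 h2 (fun h => by rw [h] at h3; exact lt_irrefl _ h3)
  rcases hc with hc | hc | hc
  · obtain ⟨x, rfl⟩ := Finset.card_eq_one.1 hc
    rw [Finset.mem_singleton] at hr
    subst hr
    exact NearD.one h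
  · obtain ⟨a, ha, b, hb, hba, hab⟩ := step {r} (by simpa using hr) (by simp) (by simp [hc])
    rw [Finset.mem_singleton] at ha
    subst ha
    have : ({a, b} : Finset V) = B := Finset.eq_of_subset_of_card_le
      (by intro x; simp only [Finset.mem_insert, Finset.mem_singleton]; rintro (rfl | rfl) <;> assumption)
      (by rw [Finset.card_pair hab.ne, hc])
    rw [← this]
    exact NearD.two h hab
  · obtain ⟨r', hr', a, haB, har, hra⟩ := step {r} (by simpa using hr) (by simp) (by simp [hc])
    rw [Finset.mem_singleton] at hr' har
    subst hr'
    obtain ⟨p, hp, b, hbB, hb, hpb⟩ := step {r', a}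
      (by intro x; simp only [Finset.mem_insert, Finset.mem_singleton]; rintro (rfl | rfl) <;> assumption)
      (by simp) (by rw [hc]; exact lt_of_le_of_lt Finset.card_le_two (by norm_num))
    obtain ⟨q, hq, c, hcB, hcc, hqc⟩ := step {r', a, b}
      (by intro x; simp only [Finset.mem_insert, Finset.mem_singleton]; rintro (rfl | rfl | rfl) <;> assumption)
      (by simp) (by rw [hc]; exact lt_of_le_of_lt Finset.card_le_three (by norm_num))
    simp only [Finset.mem_insert, Finset.mem_singleton, not_or] at hp hb hq hcc
    have key : ∀ y z w : V, ({r', y, z, w} : Finset V) = {r', a, b, c} →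
        ({r', y, z, w} : Finset V) = B := by
      intro y z w e
      rw [e]
      refine Finset.eq_of_subset_of_card_le ?_ ?_
      · intro x; simp only [Finset.mem_insert, Finset.mem_singleton]
        rintro (rfl | rfl | rfl | rfl) <;> assumption
      · rw [hc]
        have : ({r', a, b, c} : Finset V).card = 4 := by
          have n1 := hra.ne
          have n2 := Ne.symm hb.1
          have n3 := Ne.symm hb.2
          have n4 := Ne.symm hcc.1
          have n5 := Ne.symm hcc.2.1
          have n6 := Ne.symm hcc.2.2
          simp [n1, n2, n3, n4, n5, n6]
        omega
    have fin : ∀ y z w s t : V, ({r', y, z, w} : Finset V) = {r', a, b, c} →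
        (r' ≠ y ∧ r' ≠ z ∧ r' ≠ w ∧ y ≠ z ∧ y ≠ w ∧ z ≠ w) →
        (∀ x, x = r' ∨ x = y ∨ x = z → x = s ∨ G.Adj s x) →
        (∀ x, x = z ∨ x = w → x = t ∨ G.Adj t x) → NearD G v B := by
      intro y z w s t e hne hs ht
      rw [← key y z w e]
      exact NearD.four s t h hne.1 hne.2.1 hne.2.2.1 hne.2.2.2.1 hne.2.2.2.2.1 hne.2.2.2.2.2 hs ht
    have hsym := hra.symm
    have hpb' := hpb.symm
    have hqc' := hqc.symm
    have n1 := hra.ne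
    rcases hp with rfl | rfl <;> rcases hq with rfl | rfl | rfl
    · exact fin a b c q q rfl (by grind) (by grind) (by grind)
    · exact fin b q c p q (by grind) (by grind) (by grind) (by grind)
    · exact fin a q c p q (by grind) (by grind) (by grind) (by grind)
    · exact fin c p b q p (by grind) (by grind) (by grind) (by grind)
    · exact fin b q c q q (by grind) (by grind) (by grind) (by grind)
    · exact fin p q c p q (by grind) (by grind) (by grind) (by grind)

theorem exists_log (p m : ℕ) (h : 1 + p + 2 * m ≠ 1 ∧ 1 + p + 2 * m ≠ 2 ∧ 1 + p + 2 * m ≠ 4) :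
    ∃ k, 0 < k ∧ p + 2 ≤ 2 ^ k ∧ 3 * k ≤ 2 + 2 * p + m := by
  have big : ∀ p, 4 ≤ p → ∃ k, 0 < k ∧ p + 2 ≤ 2 ^ k ∧ 3 * k ≤ 2 + 2 * p := by
    intro p hp
    induction p using Nat.strong_induction_on with
    | _ p ih =>
      by_cases h6 : p ≤ 6
      · exact ⟨3, by norm_num, by norm_num; omega, by omega⟩
      · by_cases h7 : p = 7
        · exact ⟨4, by norm_num, by norm_num; omega, by omega⟩
        obtain ⟨k, h1, h2, h3⟩ := ih (p - 2) (by omega) (by omega)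
        exact ⟨k + 1, by omega, by rw [pow_succ]; omega, by omega⟩
  by_cases h4 : 4 ≤ p
  · obtain ⟨k, h1, h2, h3⟩ := big p h4
    exact ⟨k, h1, h2, by omega⟩
  · have : p = 0 ∨ p = 1 ∨ p = 2 ∨ p = 3 := by omega
    rcases this with rfl | rfl | rfl | rfl
    · exact ⟨1, by norm_num, by norm_num, by omega⟩
    · exact ⟨2, by norm_num, by norm_num, by omega⟩
    · exact ⟨2, by norm_num, by norm_num, by omega⟩
    · exact ⟨3, by norm_num, by norm_num, by omega⟩

theorem exists_code_s8 {V : Type} [DecidableEq V] (S : Finset V) (k : ℕ) (h : S.card + 1 ≤ 2 ^ k) :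
    ∃ g : V → Finset (Fin k), (∀ x ∈ S, (g x).Nonempty) ∧
      ∀ x ∈ S, ∀ y ∈ S, g x = g y → x = y := by
  have hc : S.card ≤ ((Finset.univ : Finset (Finset (Fin k))).erase ∅).card := by
    rw [Finset.card_erase_of_mem (Finset.mem_univ _)]
    simp
    omega
  have : Fintype.card S ≤ Fintype.card ((Finset.univ : Finset (Finset (Fin k))).erase ∅) := by
    simpa only [Fintype.card_coe] using hc
  obtain ⟨e⟩ := Function.Embedding.nonempty_of_card_le this
  refine ⟨fun x => if hx : x ∈ S then (e ⟨x, hx⟩).1 else ∅, ?_, ?_⟩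
  · intro x hx
    simp only [hx, dif_pos]
    exact Finset.nonempty_iff_ne_empty.2 (Finset.mem_erase.1 (e ⟨x, hx⟩).2).1
  · intro x hx y hy he
    simp only [hx, hy, dif_pos] at he
    have := e.injective (Subtype.ext he)
    exact congrArg Subtype.val this

theorem NearD.good {V : Type} [DecidableEq V] {G : SimpleGraph V} {v : V} {X : Finset V}
    (hX : NearD G v X) (hv : v ∉ X)
    (hc : X.card + 1 ≠ 1 ∧ X.card + 1 ≠ 2 ∧ X.card + 1 ≠ 4) :
    ∃ k, GoodW G (insert v X) k ∧ 3 * k ≤ 2 * (X.card + 1) := by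
  obtain ⟨L, R, Q, ι, _, c, Z, rfl, h1, h2, h3, h4, h5, h6, h7, h8⟩ := hX
  rw [Finset.card_union_of_disjoint h1] at hc ⊢
  obtain ⟨k, k0, k1, k2⟩ := exists_log L.card (Fintype.card ι) (by omega)
  have hvL : v ∉ L := fun h => hv (Finset.mem_union_left _ h)
  have hvR : v ∉ R := fun h => hv (Finset.mem_union_right _ h)
  obtain ⟨g, g1, g2⟩ := exists_code_s8 (insert v L) k
    (by rw [Finset.card_insert_of_notMem hvL]; omega)
  have hd : ∀ x, x ∈ insert v L → x ∉ R := by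
    intro x hx
    rcases Finset.mem_insert.1 hx with rfl | hx
    · exact hvR
    · exact Finset.disjoint_left.1 h1 hx
  have hm : ∀ x, x ∈ insert v (L ∪ R) ↔ x ∈ insert v L ∨ x ∈ R := by
    intro x; simp only [Finset.mem_insert, Finset.mem_union]; tauto
  refine ⟨Fintype.card ι + k, ⟨ι ⊕ Fin k, inferInstance, Sum.elim c (fun _ => v),
    Sum.elim Z (fun j x => x ∈ Q ∨ (x ∈ insert v L ∧ j ∈ g x)), by simp, ?_, ?_, ?_⟩, by omega⟩
  · rintro (i | i) x h
    · exact ⟨(hm x).2 (Or.inr (h6 i x h).1), (h6 i x h).2⟩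
    · rcases h with h | ⟨h, _⟩
      · exact ⟨(hm x).2 (Or.inr (h2 h)), Or.inr (h4 x h)⟩
      · refine ⟨(hm x).2 (Or.inl h), ?_⟩
        rcases Finset.mem_insert.1 h with rfl | h
        · exact Or.inl rfl
        · exact Or.inr (h3 x h)
  · intro x hx
    rcases (hm x).1 hx with hx | hx
    · obtain ⟨j, hj⟩ := g1 x hx
      exact ⟨Sum.inr j, Or.inr ⟨hx, hj⟩⟩
    · obtain ⟨i, hi⟩ := h7 x hx
      exact ⟨Sum.inl i, hi⟩
  · intro x hx y hy h
    have hl : ∀ i, Z i x ↔ Z i y := fun i => h (Sum.inl i)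
    have hr : ∀ j, (x ∈ Q ∨ (x ∈ insert v L ∧ j ∈ g x)) ↔ (y ∈ Q ∨ (y ∈ insert v L ∧ j ∈ g y)) :=
      fun i => h (Sum.inr i)
    rcases (hm x).1 hx with hx | hx <;> rcases (hm y).1 hy with hy | hy
    · refine g2 x hx y hy ?_
      ext j
      have a1 := fun h => hd x hx (h2 h)
      have a2 := fun h => hd y hy (h2 h)
      have := hr j
      tauto
    · obtain ⟨i, hi⟩ := h7 y hy
      exact (hd x hx (h6 i x ((hl i).2 hi)).1).elim
    · obtain ⟨i, hi⟩ := h7 x hx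
      exact (hd y hy (h6 i y ((hl i).1 hi)).1).elim
    · refine h8 x hx y hy hl ?_
      have a1 := fun h => hd x h hx
      have a2 := fun h => hd y h hy
      have := hr ⟨0, k0⟩
      tauto

/-- Complement of a component of `D \ v` is connected. -/
theorem CConn.compl {V : Type} [DecidableEq V] {G : SimpleGraph V} {S D C : Finset V} {v : V}
    (hDS : D ⊆ S) (hD : CConn G D) (hv : v ∈ D) (hCv : v ∉ C) (hCD : C ⊆ D) (hCne : C.Nonempty)
    (hcl : ∀ x ∈ C, ∀ y ∈ D, y ∉ C → y ≠ v → ¬ G.Adj x y)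
    (hco : D = S ∨ (CConn G (S \ D) ∧ ∃ w ∈ S \ D, G.Adj v w)) : CConn G (S \ C) := by
  have hvS : v ∈ S \ C := Finset.mem_sdiff.2 ⟨hDS hv, hCv⟩
  refine ⟨⟨v, hvS⟩, ?_⟩
  -- key claim: a closed set containing v is everything
  have key : ∀ A ⊆ S \ C, v ∈ A → (∀ a ∈ A, ∀ b ∈ S \ C, b ∉ A → ¬ G.Adj a b) → A = S \ C := by
    intro A hA hvA hAcl
    refine Finset.Subset.antisymm hA ?_
    have hout : ∀ x ∈ S \ D, x ∈ A := by
      rcases hco with rfl | ⟨hconn, w, hw, hvw⟩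
      · simp
      have hsub : ∀ x ∈ S \ D, x ∈ S \ C := by
        intro x hx
        rw [Finset.mem_sdiff] at hx ⊢
        exact ⟨hx.1, fun h => hx.2 (hCD h)⟩
      have hwA : w ∈ A := by
        by_contra hwA
        exact hAcl v hvA w (hsub w hw) hwA hvw
      by_contra hcon
      push Not at hcon
      obtain ⟨x, hx, hxA⟩ := hcon
      obtain ⟨a, ha, b, hb, hba, hab⟩ := hconn.2 ((S \ D) ∩ A) Finset.inter_subset_left
        ⟨w, Finset.mem_inter.2 ⟨hw, hwA⟩⟩
        (fun h => hxA (Finset.mem_inter.1 (h.symm ▸ hx)).2)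
      refine hAcl a (Finset.mem_inter.1 ha).2 b (hsub b hb) ?_ hab
      exact fun h => hba (Finset.mem_inter.2 ⟨hb, h⟩)
    intro x hx
    by_contra hxA
    have hxD : x ∈ D := by
      by_contra hxD
      exact hxA (hout x (Finset.mem_sdiff.2 ⟨(Finset.mem_sdiff.1 hx).1, hxD⟩))
    obtain ⟨a, ha, b, hb, hba, hab⟩ := hD.2 ((D \ C) \ A)
      (fun z hz => (Finset.mem_sdiff.1 (Finset.mem_sdiff.1 hz).1).1)
      ⟨x, by simp only [Finset.mem_sdiff] at hx ⊢; exact ⟨⟨hxD, hx.2⟩, hxA⟩⟩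
      (fun h => by
        have := h.symm ▸ hv
        exact (Finset.mem_sdiff.1 this).2 hvA)
    simp only [Finset.mem_sdiff] at ha hba
    by_cases hbC : b ∈ C
    · exact hcl b hbC a ha.1.1 ha.1.2 (fun h => ha.2 (h ▸ hvA)) hab.symm
    · have hbA : b ∈ A := by tauto
      exact hAcl b hbA a (Finset.mem_sdiff.2 ⟨hDS ha.1.1, ha.1.2⟩) ha.2 hab.symm
  intro A hA hne hAS
  by_contra hcon
  push Not at hcon
  by_cases hvA : v ∈ A
  · exact hAS (key A hA hvA hcon)
  · have := key ((S \ C) \ A) Finset.sdiff_subset (Finset.mem_sdiff.2 ⟨hvS, hvA⟩) (by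
      intro a ha b hb hbA hab
      rw [Finset.mem_sdiff] at ha hbA
      have hbA' : b ∈ A := by tauto
      exact hcon b hbA' a ha.1 ha.2 hab.symm)
    obtain ⟨x, hx⟩ := hne
    have h2 := this.symm ▸ hA hx
    exact (Finset.mem_sdiff.1 h2).2 hx

theorem main_aux {V : Type} [DecidableEq V] (G : SimpleGraph V) (N : ℕ) :
    ∀ S : Finset V, S.card = N → CConn G S → (S.card ≠ 1 ∧ S.card ≠ 2 ∧ S.card ≠ 4) →
      ∃ k, GoodW G S k ∧ 3 * k ≤ 2 * S.card := by
  induction N using Nat.strong_induction_on with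
  | _ N ih =>
  intro S hSN hS hcard
  let P : ℕ → Prop := fun d => ∃ D : Finset V, ∃ v : V, D.card = d ∧ D ⊆ S ∧ CConn G D ∧ v ∈ D ∧
    (D.card ≠ 1 ∧ D.card ≠ 2 ∧ D.card ≠ 4) ∧
    (D = S ∨ (CConn G (S \ D) ∧ ∃ w ∈ S \ D, G.Adj v w))
  have hP : ∃ d, P d := by
    obtain ⟨v, hv⟩ := hS.1
    exact ⟨S.card, S, v, rfl, Finset.Subset.refl _, hS, hv, hcard, Or.inl rfl⟩
  classical
  obtain ⟨D, v, hDc, hDS, hD, hvD, hDn, hco⟩ := Nat.find_spec hP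
  have hmin : ∀ d, d < D.card → ¬ P d := fun d hd => Nat.find_min hP (hDc ▸ hd)
  -- all closed subsets of D \ v are near-decomposable
  have closed : ∀ M : ℕ, ∀ X : Finset V, X.card = M → X ⊆ D → v ∉ X →
      (∀ x ∈ X, ∀ y ∈ D, y ∉ X → y ≠ v → ¬ G.Adj x y) → NearD G v X := by
    intro M
    induction M using Nat.strong_induction_on with
    | _ M ihM =>
    intro X hXM hXD hvX hXcl
    by_cases hXe : X = ∅
    · rw [hXe]; exact NearD.empty
    let T : ℕ → Prop := fun d => ∃ C : Finset V, C.card = d ∧ C ⊆ X ∧ C.Nonempty ∧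
      (∀ x ∈ C, ∀ y ∈ D, y ∉ C → y ≠ v → ¬ G.Adj x y)
    have hT : ∃ d, T d :=
      ⟨X.card, X, rfl, Finset.Subset.refl _, Finset.nonempty_iff_ne_empty.2 hXe, hXcl⟩
    obtain ⟨C, hCc, hCX, hCne, hCcl⟩ := Nat.find_spec hT
    have hCmin : ∀ d, d < C.card → ¬ T d := fun d hd => Nat.find_min hT (hCc ▸ hd)
    have hvC : v ∉ C := fun h => hvX (hCX h)
    have hCD := hCX.trans hXD
    have hC : CConn G C := by
      refine ⟨hCne, ?_⟩
      intro A hA hAne hAC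
      by_contra hcon
      push Not at hcon
      refine hCmin A.card (Finset.card_lt_card (Finset.ssubset_iff_subset_ne.2 ⟨hA, hAC⟩))
        ⟨A, rfl, hA.trans hCX, hAne, ?_⟩
      intro x hx y hy hyA hyv
      by_cases hyC : y ∈ C
      · exact hcon x hx y hyC hyA
      · exact hCcl x (hA hx) y hy hyC hyv
    obtain ⟨u, hu, v', hv', hv'C, huv⟩ := hD.2 C hCD hCne (fun h => hvC (h ▸ hvD))
    have hvv : v' = v := by
      by_contra hne
      exact hCcl u hu v' hv' hv'C hne huv
    subst hvv
    have hCn : C.card = 1 ∨ C.card = 2 ∨ C.card = 4 := by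
      by_contra hcon
      refine hmin C.card (Finset.card_lt_card (Finset.ssubset_iff_subset_ne.2
        ⟨hCD, fun h => hvC (h ▸ hvD)⟩)) ⟨C, u, rfl, hCD.trans hDS, hC, hu, by tauto, Or.inr ⟨?_, ?_⟩⟩
      · exact CConn.compl hDS hD hvD hvC hCD hCne hCcl hco
      · exact ⟨v', Finset.mem_sdiff.2 ⟨hDS hvD, hvC⟩, huv⟩
    have hbr := NearD.branch huv.symm hu hC hCn
    have hrest := ihM (X \ C).card
      (by rw [← hXM]; exact Finset.card_lt_card (Finset.sdiff_ssubset hCX hCne))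
      (X \ C) rfl (Finset.sdiff_subset.trans hXD) (fun h => hvX (Finset.mem_sdiff.1 h).1) (by
        intro x hx y hy hyX hyv hxy
        rw [Finset.mem_sdiff] at hx hyX
        by_cases hyC : y ∈ C
        · exact hCcl y hyC x (hXD hx.1) hx.2 (fun h => hvX (h ▸ hx.1)) hxy.symm
        · exact hXcl x hx.1 y hy (by tauto) hyv hxy)
    have := hrest.union hbr Finset.sdiff_disjoint
    rwa [Finset.sdiff_union_of_subset hCX] at this
  have hnd : NearD G v (D.erase v) := closed _ (D.erase v) rfl (Finset.erase_subset _ _)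
    (Finset.notMem_erase _ _) (by
      intro x hx y hy hyD hyv
      exact (hyD (Finset.mem_erase.2 ⟨hyv, hy⟩)).elim)
  have fin : ∀ X : Finset V, NearD G v X → v ∉ X → insert v X = S →
      ∃ k, GoodW G S k ∧ 3 * k ≤ 2 * S.card := by
    intro X hX hvX hXS
    have hc : S.card = X.card + 1 := by rw [← hXS, Finset.card_insert_of_notMem hvX]
    obtain ⟨k, hk, hk2⟩ := hX.good hvX (by rw [← hc]; exact hcard)
    exact ⟨k, hXS ▸ hk, by omega⟩
  rcases hco with rfl | ⟨hconn, w, hw, hvw⟩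
  · exact fin _ hnd (Finset.notMem_erase _ _) (Finset.insert_erase hvD)
  · have hsum : (S \ D).card + D.card = S.card := Finset.card_sdiff_add_card_eq_card hDS
    by_cases hsm : (S \ D).card = 1 ∨ (S \ D).card = 2 ∨ (S \ D).card = 4
    · have hbr := NearD.branch hvw hw hconn hsm
      have hd : Disjoint (D.erase v) (S \ D) :=
        Finset.disjoint_of_subset_left (Finset.erase_subset _ _) Finset.disjoint_sdiff
      refine fin _ (hnd.union hbr hd) ?_ ?_
      · simp [hvD]
      · rw [← Finset.insert_union, Finset.insert_erase hvD, Finset.union_sdiff_of_subset hDS]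
    · have p1 : 0 < D.card := Finset.card_pos.2 ⟨v, hvD⟩
      have p2 : 0 < (S \ D).card := Finset.card_pos.2 ⟨w, hw⟩
      obtain ⟨k, hk, hk2⟩ := ih D.card (by omega) D rfl hD hDn
      obtain ⟨l, hl, hl2⟩ := ih (S \ D).card (by omega) (S \ D) rfl hconn (by tauto)
      have := hk.union hl Finset.disjoint_sdiff
      rw [Finset.union_sdiff_of_subset hDS] at this
      exact ⟨k + l, this, by omega⟩

theorem CConn.univ {V : Type} [Fintype V] [DecidableEq V] (G : SimpleGraph V) (hG : G.Connected) :
    CConn G Finset.univ := by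
  haveI := hG.nonempty
  refine ⟨Finset.univ_nonempty, ?_⟩
  intro A _ ⟨a, ha⟩ hne
  obtain ⟨b, hb⟩ : ∃ b, b ∉ A := by
    by_contra h
    push Not at h
    exact hne (Finset.eq_univ_iff_forall.2 h)
  obtain ⟨p⟩ := hG.preconnected a b
  obtain ⟨d, _, h1, h2⟩ := p.exists_boundary_dart (↑A : Set V) ha hb
  exact ⟨d.fst, h1, d.snd, Finset.mem_univ _, h2, d.adj⟩

/-- For a finite connected simple graph `G` on `n` vertices with `n ∉ {1, 2, 4}`,
`w(G) ≤ 2n/3`. -/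
theorem watchingNumber_le_two_thirds {V : Type} [Fintype V] [DecidableEq V]
    (G : SimpleGraph V) (hG : G.Connected)
    (hn : Fintype.card V ∉ ({1, 2, 4} : Set ℕ)) :
    3 * watchingNumber G ≤ 2 * Fintype.card V := by
  simp only [Set.mem_insert_iff, Set.mem_singleton_iff, not_or] at hn
  obtain ⟨k, ⟨ι, _, c, Z, h1, h2, h3, h4⟩, hk⟩ := main_aux G _ Finset.univ rfl (CConn.univ G hG)
    (by rw [Finset.card_univ]; exact hn)
  rw [Finset.card_univ] at hk
  classical
  let f : ι → V × Finset V := fun i => (c i, Finset.univ.filter (fun x => Z i x))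
  let W : Finset (V × Finset V) := Finset.univ.image f
  have hlab : ∀ i x, f i ∈ wLabel W x ↔ Z i x := by
    intro i x
    have hm : f i ∈ W := Finset.mem_image_of_mem f (Finset.mem_univ i)
    simp only [wLabel, Finset.mem_filter, hm, true_and]
    simp [f]
  have hW : IsWatchingSystem G W := by
    refine ⟨?_, ?_, ?_⟩
    · intro w hw x hx
      obtain ⟨i, _, rfl⟩ := Finset.mem_image.1 hw
      exact (h2 i x (by simpa [f] using hx)).2
    · intro x
      obtain ⟨i, hi⟩ := h3 x (Finset.mem_univ _)
      exact ⟨f i, (hlab i x).2 hi⟩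
    · intro x y hxy
      refine h4 x (Finset.mem_univ _) y (Finset.mem_univ _) fun i => ?_
      rw [← hlab, ← hlab, hxy]
  have hle : watchingNumber G ≤ W.card := Nat.sInf_le ⟨W, hW, rfl⟩
  have hc : W.card ≤ k := by
    rw [← h1, ← Finset.card_univ]
    exact Finset.card_image_le
  omega
end

section
/- Let G be a finite simple graph and W a compressed watching system in G. Then for every vertex v of G, 2^{|L_W(v)|} − 1 ≤ |B_G(v, 2)|, where B_G(v, 2) is the ball of radius 2 centred at v. -/
/-- For a compressed watching system `W` in `G` and any vertex `v`,
`2^{|L_W(v)|} − 1 ≤ |B_G(v, 2)|`. -/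
theorem compressed_label_card_bound {V : Type} [Fintype V] [DecidableEq V]
    (G : SimpleGraph V) (W : Finset (V × Finset V)) (hW : IsWatchingSystem G W)
    (hcompressed : ∀ v : V, ∀ A : Finset (V × Finset V),
      A ⊆ wLabel W v → A.Nonempty → A ≠ wLabel W v → ∃ v' : V, wLabel W v' = A) :
    ∀ v : V, 2 ^ (wLabel W v).card - 1 ≤
      Set.ncard {x : V | x = v ∨ G.Adj v x ∨ ∃ y : V, G.Adj v y ∧ G.Adj y x} := by
  classical
  intro v
  obtain ⟨h1, -, -⟩ := hW
  set S : Set V := {x : V | x = v ∨ G.Adj v x ∨ ∃ y : V, G.Adj v y ∧ G.Adj y x} with hS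
  have hsub : (wLabel W v).powerset.erase ∅ ⊆ S.toFinset.image (wLabel W) := by
    intro A hA
    rw [Finset.mem_erase, Finset.mem_powerset] at hA
    obtain ⟨hne, hAs⟩ := hA
    have hne' : A.Nonempty := Finset.nonempty_iff_ne_empty.mpr hne
    have hex : ∃ x : V, wLabel W x = A := by
      by_cases h : A = wLabel W v
      · exact ⟨v, h.symm⟩
      · exact hcompressed v A hAs hne' h
    obtain ⟨x, hx⟩ := hex
    rw [Finset.mem_image]
    refine ⟨x, ?_, hx⟩
    rw [Set.mem_toFinset, hS, Set.mem_setOf_eq]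
    obtain ⟨w, hw⟩ := hne'
    have hv := hAs hw
    rw [← hx] at hw
    unfold wLabel at hw hv
    rw [Finset.mem_filter] at hw hv
    rcases h1 w hw.1 x hw.2 with a | a <;> rcases h1 w hv.1 v hv.2 with b | b
    · exact Or.inl (a.trans b.symm)
    · exact Or.inr (Or.inl (a ▸ b.symm))
    · exact Or.inr (Or.inl (b ▸ a))
    · exact Or.inr (Or.inr ⟨w.1, b.symm, a⟩)
  have hc := (Finset.card_le_card hsub).trans Finset.card_image_le
  rw [Finset.card_erase_of_mem (Finset.empty_mem_powerset _), Finset.card_powerset] at hc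
  rw [Set.ncard_eq_toFinset_card']
  exact hc
end

section
/- For every n ≥ 1, the watching number of the path P_n on n vertices is w(P_n) = ⌈(n+1)/2⌉. -/
/-- The path on `n` vertices `0, 1, …, n−1`, with edges between consecutive vertices. -/
def pathG (n : ℕ) : SimpleGraph (Fin n) :=
  SimpleGraph.fromRel (fun i j => (i : ℕ) + 1 = (j : ℕ))

/-- The cycle on `n` vertices `0, 1, …, n−1`, with edges between consecutive vertices
modulo `n`. -/
def cycleG (n : ℕ) : SimpleGraph (Fin n) :=
  SimpleGraph.fromRel (fun i j => ((i : ℕ) + 1) % n = (j : ℕ))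

theorem watch_core {ι : Type} [DecidableEq ι] (Z : ι → Finset ℕ) (c : ι → ℕ)
    (hZ : ∀ i, Z i ⊆ Finset.Icc (c i) (c i + 2)) :
    ∀ (m : ℕ) (W : Finset ι), W.card = m → W.Nonempty → ∀ F : Finset ℕ,
      (∀ x ∈ F, ∃ i ∈ W, x ∈ Z i) →
      (∀ x ∈ F, ∀ y ∈ F, (∀ i ∈ W, x ∈ Z i ↔ y ∈ Z i) → x = y) →
      F.card + 1 ≤ 2 * W.card := by
  intro m
  induction m with
  | zero =>
    intro W hW hne
    rw [Finset.card_eq_zero] at hW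
    simp [hW] at hne
  | succ m ih =>
    intro W hW hne F hcov hinj
    by_cases hs : ∃ w ∈ W, (Z w).card ≤ 2
    · obtain ⟨w, hw, hw2⟩ := hs
      have hc : (W.erase w).card = m := by rw [Finset.card_erase_of_mem hw]; omega
      by_cases he : (W.erase w).Nonempty
      · have := ih (W.erase w) hc he (F \ Z w) (by
          intro x hx
          rw [Finset.mem_sdiff] at hx
          obtain ⟨i, hi, hxi⟩ := hcov x hx.1
          refine ⟨i, Finset.mem_erase.2 ⟨?_, hi⟩, hxi⟩
          rintro rfl
          exact hx.2 hxi) (by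
          intro x hx y hy h
          rw [Finset.mem_sdiff] at hx hy
          apply hinj x hx.1 y hy.1
          intro i hi
          by_cases hiw : i = w
          · subst hiw; tauto
          · exact h i (Finset.mem_erase.2 ⟨hiw, hi⟩))
        have h2 : F.card ≤ (F \ Z w).card + (Z w).card := by
          have := Finset.le_card_sdiff (Z w) F
          omega
        omega
      · have hall : ∀ i ∈ W, i = w := by
          intro i hi
          by_contra hne'
          exact he ⟨i, Finset.mem_erase.2 ⟨hne', hi⟩⟩
        have hmem : ∀ x ∈ F, x ∈ Z w := by
          intro x hx
          obtain ⟨i, hi, hxi⟩ := hcov x hx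
          rwa [hall i hi] at hxi
        have : F.card ≤ 1 := by
          rw [Finset.card_le_one]
          intro x hx y hy
          apply hinj x hx y hy
          intro i hi
          rw [hall i hi]
          simp [hmem x hx, hmem y hy]
        omega
    · push Not at hs
      have hfull : ∀ i ∈ W, ∀ x, x ∈ Z i ↔ c i ≤ x ∧ x ≤ c i + 2 := by
        intro i hi x
        have : Z i = Finset.Icc (c i) (c i + 2) := by
          apply Finset.eq_of_subset_of_card_le (hZ i)
          have := hs i hi
          rw [Nat.card_Icc]; omega
        rw [this, Finset.mem_Icc]
      obtain ⟨M, hM, hmax⟩ := Finset.exists_max_image W c hne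
      classical
      have hex : ∀ x, ∃ y, ∀ i ∈ W, y ∈ Z i ↔ x ∈ Z i := fun x => ⟨x, fun _ _ => Iff.rfl⟩
      let f : ℕ → ℕ := fun x => Nat.find (hex x)
      have hf : ∀ x, ∀ i ∈ W, f x ∈ Z i ↔ x ∈ Z i := fun x => Nat.find_spec (hex x)
      have hmin : ∀ x y, y < f x → ¬ ∀ i ∈ W, y ∈ Z i ↔ x ∈ Z i :=
        fun x y h => Nat.find_min (hex x) h
      have hsub : F.image f ⊆ ((W.image c) ∪ (W.image (fun i => c i + 3))).erase (c M + 3) := by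
        intro z hz
        obtain ⟨x, hx, rfl⟩ := Finset.mem_image.1 hz
        obtain ⟨i, hi, hxi⟩ := hcov x hx
        have hfi := (hf x i hi).2 hxi
        rw [hfull i hi] at hfi
        rw [Finset.mem_erase]
        constructor
        · have := hmax i hi
          omega
        · rw [Finset.mem_union, Finset.mem_image, Finset.mem_image]
          by_cases h0 : f x = 0
          · left; exact ⟨i, hi, by omega⟩
          · have := hmin x (f x - 1) (by omega)
            push Not at this
            obtain ⟨j, hj, hj2⟩ := this
            rw [← hf x j hj, hfull j hj, hfull j hj] at hj2
            by_cases h : c j = f x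
            · left; exact ⟨j, hj, h⟩
            · right; exact ⟨j, hj, by omega⟩
      have h1 : (F.image f).card = F.card := by
        apply Finset.card_image_of_injOn
        intro x hx y hy hxy
        apply hinj x hx y hy
        intro i hi
        rw [← hf x i hi, ← hf y i hi, hxy]
      have h2 := Finset.card_le_card hsub
      rw [Finset.card_erase_of_mem (by
        rw [Finset.mem_union, Finset.mem_image, Finset.mem_image]
        right; exact ⟨M, hM, rfl⟩)] at h2
      have h3 := Finset.card_union_le (W.image c) (W.image (fun i => c i + 3))
      have h4 := Finset.card_image_le (s := W) (f := c)
      have h5 := Finset.card_image_le (s := W) (f := fun i => c i + 3)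
      omega

theorem watch_lower (n : ℕ) (hn : 1 ≤ n) (W : Finset (Fin n × Finset (Fin n)))
    (h : IsWatchingSystem (pathG n) W) : n + 1 ≤ 2 * W.card := by
  obtain ⟨hZ, hcov, hinj⟩ := h
  have hmem : ∀ (s : Finset (Fin n)) (x : Fin n), (x : ℕ) ∈ s.image Fin.val ↔ x ∈ s := by
    intro s x
    rw [Finset.mem_image]
    constructor
    · rintro ⟨y, hy, hyx⟩
      rwa [← Fin.ext hyx]
    · intro hx; exact ⟨x, hx, rfl⟩
  let Z : {w // w ∈ W} → Finset ℕ := fun w => w.1.2.image Fin.val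
  have key := watch_core Z (fun w => (w.1.1 : ℕ) - 1) (by
    intro w x hx
    obtain ⟨y, hy, rfl⟩ := Finset.mem_image.1 hx
    have := hZ w.1 w.2 y hy
    simp only [pathG, SimpleGraph.fromRel_adj, Fin.ext_iff] at this
    rw [Finset.mem_Icc]
    omega) _ W.attach rfl (by
    obtain ⟨w, hw⟩ := hcov ⟨0, hn⟩
    exact ⟨⟨w, (Finset.mem_filter.1 hw).1⟩, Finset.mem_attach _ _⟩) (Finset.range n) (by
    intro x hx
    obtain ⟨w, hw⟩ := hcov ⟨x, Finset.mem_range.1 hx⟩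
    have hw := Finset.mem_filter.1 hw
    exact ⟨⟨w, hw.1⟩, Finset.mem_attach _ _, (hmem _ ⟨x, Finset.mem_range.1 hx⟩).2 hw.2⟩) (by
    intro x hx y hy hxy
    have := hinj ⟨x, Finset.mem_range.1 hx⟩ ⟨y, Finset.mem_range.1 hy⟩ (by
      apply Finset.filter_congr
      intro w hw
      rw [← hmem, ← hmem]
      exact hxy ⟨w, hw⟩ (Finset.mem_attach _ _))
    simpa using this)
  simpa using key

theorem watch_upper (n : ℕ) (hn : 1 ≤ n) : ∃ W : Finset (Fin n × Finset (Fin n)),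
    IsWatchingSystem (pathG n) W ∧ W.card ≤ (n + 2) / 2 := by
  let g : ℕ → Fin n × Finset (Fin n) := fun j =>
    (⟨min (2 * j) (n - 1), by omega⟩,
      Finset.univ.filter (fun x : Fin n => (x : ℕ) ≤ 2 * j + 1 ∧ 2 * j ≤ (x : ℕ) + 1))
  have hg : ∀ j (x : Fin n), x ∈ (g j).2 ↔ (x : ℕ) ≤ 2 * j + 1 ∧ 2 * j ≤ (x : ℕ) + 1 := by
    intro j x; simp [g]
  have hl : ∀ j, j < (n + 2) / 2 → ∀ x : Fin n,
      g j ∈ wLabel ((Finset.range ((n + 2) / 2)).image g) x ↔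
        (x : ℕ) ≤ 2 * j + 1 ∧ 2 * j ≤ (x : ℕ) + 1 := by
    intro j hj x
    unfold wLabel
    rw [Finset.mem_filter, hg]
    have : g j ∈ (Finset.range ((n + 2) / 2)).image g :=
      Finset.mem_image_of_mem _ (Finset.mem_range.2 hj)
    tauto
  refine ⟨(Finset.range ((n + 2) / 2)).image g, ⟨?_, ?_, ?_⟩, ?_⟩
  · intro w hw x hx
    obtain ⟨j, hj, rfl⟩ := Finset.mem_image.1 hw
    rw [Finset.mem_range] at hj
    rw [hg] at hx
    have hxn := x.2
    simp only [pathG, SimpleGraph.fromRel_adj, Fin.ext_iff, g, ne_eq]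
    omega
  · intro x
    have hxn := x.2
    exact ⟨g (x / 2), (hl _ (by omega) x).2 (by omega)⟩
  · intro x y hxy
    have hxn := x.2
    have hyn := y.2
    have H : ∀ j, j < (n + 2) / 2 → (((x : ℕ) ≤ 2 * j + 1 ∧ 2 * j ≤ (x : ℕ) + 1) ↔
        ((y : ℕ) ≤ 2 * j + 1 ∧ 2 * j ≤ (y : ℕ) + 1)) := by
      intro j hj
      rw [← hl j hj x, ← hl j hj y, hxy]
    have h1 := H (x / 2) (by omega)
    have h2 := H ((x + 1) / 2) (by omega)
    have h3 := H (y / 2) (by omega)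
    have h4 := H ((y + 1) / 2) (by omega)
    apply Fin.ext
    omega
  · exact Finset.card_image_le.trans (by simp)

/-- For every `n ≥ 1`, `w(P_n) = ⌈(n+1)/2⌉`. -/
theorem watchingNumber_path (n : ℕ) (hn : 1 ≤ n) :
    watchingNumber (pathG n) = (n + 2) / 2 := by
  obtain ⟨W, hW, hc⟩ := watch_upper n hn
  have hm : W.card ∈ {k | ∃ W : Finset (Fin n × Finset (Fin n)),
      IsWatchingSystem (pathG n) W ∧ W.card = k} := ⟨W, hW, rfl⟩
  unfold watchingNumber
  apply le_antisymm
  · exact (Nat.sInf_le hm).trans hc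
  · obtain ⟨W', hW', h'⟩ := Nat.sInf_mem ⟨_, hm⟩
    have := watch_lower n hn W' hW'
    omega
end

section
/- The watching number of the cycle C_4 is w(C_4) = 3, and for n = 3 and every n ≥ 5, the watching number of the cycle C_n on n vertices is w(C_n) = ⌈n/2⌉. -/
theorem cyc_adj (n : ℕ) (v x : Fin n) (h : x = v ∨ (cycleG n).Adj v x) :
    x = v ∨ ((v : ℕ) + 1) % n = x ∨ ((x : ℕ) + 1) % n = v := by
  rcases h with h | h
  · exact Or.inl h
  · simp only [cycleG, SimpleGraph.fromRel_adj] at h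
    exact Or.inr h.2

theorem adj_cyc (n : ℕ) (v x : Fin n)
    (h : (x : ℕ) = v ∨ ((v : ℕ) + 1) % n = x ∨ ((x : ℕ) + 1) % n = v) :
    x = v ∨ (cycleG n).Adj v x := by
  by_cases e : x = v
  · exact Or.inl e
  · right
    simp only [cycleG, SimpleGraph.fromRel_adj]
    refine ⟨fun h => e h.symm, ?_⟩
    rcases h with h | h
    · exact absurd (Fin.ext h) e
    · exact h

theorem zone_card (n : ℕ) (hn : 3 ≤ n) (v : Fin n) (Z : Finset (Fin n))
    (h : ∀ x ∈ Z, x = v ∨ (cycleG n).Adj v x) : Z.card ≤ 3 := by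
  have hs : Z ⊆ {v, ⟨((v : ℕ) + 1) % n, Nat.mod_lt _ (by omega)⟩,
      ⟨((v : ℕ) + n - 1) % n, Nat.mod_lt _ (by omega)⟩} := by
    intro x hx
    have := cyc_adj n v x (h x hx)
    simp only [Finset.mem_insert, Finset.mem_singleton, Fin.ext_iff]
    have hv := v.2
    have hx := x.2
    rcases this with h | h | h
    · left; rw [h]
    · right; left; exact h.symm
    · right; right
      rcases Nat.lt_or_ge ((x : ℕ) + 1) n with h1 | h1
      · rw [Nat.mod_eq_of_lt h1] at h
        rw [← h, show (x : ℕ) + 1 + n - 1 = x + n by omega, Nat.add_mod_right,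
          Nat.mod_eq_of_lt hx]
      · have h2 : (x : ℕ) + 1 = n := by omega
        rw [h2, Nat.mod_self] at h
        rw [← h, Nat.mod_eq_of_lt (by omega)]
        omega
  exact (Finset.card_le_card hs).trans Finset.card_le_three

theorem cyc_lower (n : ℕ) (hn : 3 ≤ n) (W : Finset (Fin n × Finset (Fin n)))
    (hW : IsWatchingSystem (cycleG n) W) : n ≤ 2 * W.card := by
  obtain ⟨h1, h2, h3⟩ := hW
  have hdc : ∑ x : Fin n, (wLabel W x).card = ∑ w ∈ W, w.2.card := by
    have := Finset.sum_card_bipartiteAbove_eq_sum_card_bipartiteBelow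
      (s := (Finset.univ : Finset (Fin n))) (t := W) (fun x w => x ∈ w.2)
    simp only [Finset.bipartiteAbove, Finset.bipartiteBelow] at this
    unfold wLabel
    rw [this]
    refine Finset.sum_congr rfl fun w _ => ?_
    congr 1
    ext x
    simp
  have hup : ∑ w ∈ W, w.2.card ≤ W.card * 3 :=
    Finset.sum_le_card_nsmul _ _ _ fun w hw => zone_card n hn w.1 w.2 (h1 w hw)
  have hS : (Finset.univ.filter fun x : Fin n => (wLabel W x).card = 1).card ≤ W.card := by
    have : (W.powersetCard 1).card = W.card := by simp
    rw [← this]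
    refine Finset.card_le_card_of_injOn (wLabel W) ?_ (fun x _ y _ h => h3 x y h)
    intro x hx
    simp only [Finset.coe_filter, Finset.mem_univ, true_and, Set.mem_ofPred_eq] at hx
    simp only [Finset.mem_coe, Finset.mem_powersetCard]
    exact ⟨Finset.filter_subset _ _, hx⟩
  have hlow : ∑ x : Fin n, 2 ≤
      ∑ x : Fin n, ((wLabel W x).card + if (wLabel W x).card = 1 then 1 else 0) := by
    refine Finset.sum_le_sum fun x _ => ?_
    have := (h2 x).card_pos
    split_ifs <;> omega
  rw [Finset.sum_add_distrib, ← Finset.card_filter] at hlow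
  simp only [Finset.sum_const, Finset.card_univ, Fintype.card_fin, smul_eq_mul] at hlow
  omega

theorem wn_eq {V : Type} [DecidableEq V] (G : SimpleGraph V) (k : ℕ)
    (hlow : ∀ W, IsWatchingSystem G W → k ≤ W.card)
    (hup : ∃ W, IsWatchingSystem G W ∧ W.card ≤ k) : watchingNumber G = k := by
  obtain ⟨W, hW, hk⟩ := hup
  have hm : W.card ∈ {k | ∃ W : Finset (V × Finset V), IsWatchingSystem G W ∧ W.card = k} :=
    ⟨W, hW, rfl⟩
  apply le_antisymm
  · exact (Nat.sInf_le hm).trans hk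
  · refine le_csInf ⟨_, hm⟩ ?_
    rintro _ ⟨W', hW', rfl⟩
    exact hlow W' hW'

def cycZone (n : ℕ) (i : ℕ) : Finset (Fin n) :=
  Finset.univ.filter fun x => (x : ℕ) = 2 * i ∨ (x : ℕ) = 2 * i + 1 ∨ (x : ℕ) = 2 * i + 2 ∨
    ((x : ℕ) = 0 ∧ i + 1 = (n + 1) / 2)

theorem cyc_upper (n : ℕ) (hn : 5 ≤ n) :
    ∃ W, IsWatchingSystem (cycleG n) W ∧ W.card ≤ (n + 1) / 2 := by
  let f : ℕ → Fin n × Finset (Fin n) :=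
    fun i => (⟨(2 * i + 1) % n, Nat.mod_lt _ (by omega)⟩, cycZone n i)
  have key : ∀ x i, i < (n + 1) / 2 →
      (f i ∈ wLabel ((Finset.range ((n + 1) / 2)).image f) x ↔ x ∈ cycZone n i) := by
    intro x i hi
    simp only [wLabel, Finset.mem_filter]
    constructor
    · exact fun h => h.2
    · exact fun h => ⟨Finset.mem_image_of_mem f (Finset.mem_range.2 hi), h⟩
  refine ⟨(Finset.range ((n + 1) / 2)).image f, ⟨?_, ?_, ?_⟩, ?_⟩
  · intro w hw x hx
    obtain ⟨i, hi, rfl⟩ := Finset.mem_image.1 hw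
    rw [Finset.mem_range] at hi
    apply adj_cyc
    simp only [f, cycZone, Finset.mem_filter, Finset.mem_univ, true_and] at hx ⊢
    have hxn := x.2
    rcases Nat.lt_or_ge (2 * i + 1) n with h | h
    · rw [Nat.mod_eq_of_lt h]
      rcases hx with hx | hx | hx | ⟨hx, hk⟩
      · right; right; rw [hx, Nat.mod_eq_of_lt h]
      · left; exact hx
      · right; left; rw [hx] at hxn; rw [hx, Nat.mod_eq_of_lt (by omega)]
      · right; left; rw [show 2 * i + 1 + 1 = n by omega, Nat.mod_self, hx]
    · have e : 2 * i + 1 = n := by omega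
      rw [e, Nat.mod_self]
      rcases hx with hx | hx | hx | ⟨hx, hk⟩
      · right; right; rw [hx, e, Nat.mod_self]
      · omega
      · omega
      · left; exact hx
  · intro x
    have hxn := x.2
    refine ⟨f ((x : ℕ) / 2), (key x _ (by omega)).2 ?_⟩
    simp only [cycZone, Finset.mem_filter, Finset.mem_univ, true_and]
    omega
  · intro x y hxy
    have hxn := x.2
    have hyn := y.2
    have H : ∀ i, i < (n + 1) / 2 → (x ∈ cycZone n i ↔ y ∈ cycZone n i) := by
      intro i hi
      rw [← key x i hi, ← key y i hi, hxy]
    simp only [cycZone, Finset.mem_filter, Finset.mem_univ, true_and] at H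
    apply Fin.ext
    have a1 := H ((x : ℕ) / 2) (by omega)
    have a2 := H ((y : ℕ) / 2) (by omega)
    have a3 := H (((x : ℕ) - 1) / 2) (by omega)
    have a4 := H (((y : ℕ) - 1) / 2) (by omega)
    have a5 := H ((n + 1) / 2 - 1) (by omega)
    clear H key hxy
    generalize (x : ℕ) = a at *
    generalize (y : ℕ) = b at *
    omega
  · exact Finset.card_image_le.trans (by simp)

theorem cyc4_lower (W : Finset (Fin 4 × Finset (Fin 4)))
    (hW : IsWatchingSystem (cycleG 4) W) : 3 ≤ W.card := by
  obtain ⟨_, h2, h3⟩ := hW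
  have : (Finset.univ : Finset (Fin 4)).card ≤ (W.powerset.erase ∅).card := by
    refine Finset.card_le_card_of_injOn (wLabel W) ?_ (fun x _ y _ h => h3 x y h)
    intro x _
    simp only [Finset.mem_coe, Finset.mem_erase, Finset.mem_powerset]
    exact ⟨(h2 x).ne_empty, Finset.filter_subset _ _⟩
  rw [Finset.card_erase_of_mem (Finset.empty_mem_powerset _), Finset.card_powerset] at this
  simp only [Finset.card_univ, Fintype.card_fin] at this
  by_contra hc
  have : 2 ^ W.card ≤ 2 ^ 2 := Nat.pow_le_pow_right (by norm_num) (by omega)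
  omega

theorem cyc4_upper : ∃ W, IsWatchingSystem (cycleG 4) W ∧ W.card ≤ 3 := by
  refine ⟨{(0, {0, 1}), (1, {1, 2}), (2, {3})}, ⟨?_, ?_, ?_⟩, Finset.card_le_three⟩
  · intro w hw x hx
    apply adj_cyc
    revert w x
    decide
  · intro x
    rw [← Finset.card_pos]
    revert x
    decide
  · decide

theorem cyc3_upper : ∃ W, IsWatchingSystem (cycleG 3) W ∧ W.card ≤ 2 := by
  refine ⟨{(0, {0, 1}), (1, {1, 2})}, ⟨?_, ?_, ?_⟩, Finset.card_le_two⟩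
  · intro w hw x hx
    apply adj_cyc
    revert w x
    decide
  · intro x
    rw [← Finset.card_pos]
    revert x
    decide
  · decide

/-- `w(C_4) = 3`, and for `n = 3` and every `n ≥ 5`, `w(C_n) = ⌈n/2⌉`. -/
theorem watchingNumber_cycle :
    watchingNumber (cycleG 4) = 3 ∧
    ∀ n : ℕ, (n = 3 ∨ 5 ≤ n) → watchingNumber (cycleG n) = (n + 1) / 2 := by
  refine ⟨wn_eq _ _ cyc4_lower cyc4_upper, ?_⟩
  rintro n (rfl | hn)
  · exact wn_eq _ _ (fun W hW => by have := cyc_lower 3 le_rfl W hW; omega) cyc3_upper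
  · exact wn_eq _ _ (fun W hW => by have := cyc_lower n (by omega) W hW; omega) (cyc_upper n hn)
end

section
/- For 1 ≤ k ≤ 4, the only 2-superimposed family on a set X with k elements that has at least k member sets is the family of all k singletons of X. -/
/-- A family `S` of distinct nonempty subsets of `X` is `ℓ`-superimposed if the unions of
any two distinct nonempty subfamilies of `S` of size at most `ℓ` are distinct. -/
def IsSuperimposed {X : Type} [DecidableEq X] (ℓ : ℕ) (S : Finset (Finset X)) : Prop :=
  (∀ s ∈ S, s.Nonempty) ∧
  ∀ I J : Finset (Finset X), I ⊆ S → J ⊆ S → I.Nonempty → J.Nonempty →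
    I.card ≤ ℓ → J.card ≤ ℓ → I.sup id = J.sup id → I = J

theorem IsSuperimposed.antichain {X : Type} [DecidableEq X] {S : Finset (Finset X)}
    (hS : IsSuperimposed 2 S) {a b : Finset X} (ha : a ∈ S) (hb : b ∈ S) (h : a ⊆ b) : a = b := by
  have h1 := hS.2 {a, b} {b} (by intro z hz; simp at hz; rcases hz with rfl | rfl <;> assumption)
    (by simpa using hb) (by simp) (by simp) Finset.card_le_two (by simp)
    (by simpa using h)
  have : a ∈ ({b} : Finset (Finset X)) := by rw [← h1]; simp
  simpa using this

theorem superimposed_aux {X : Type} [DecidableEq X] (n : ℕ) :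
    ∀ (A : Finset X) (S : Finset (Finset X)), A.card = n → n ≤ 4 → (∀ s ∈ S, s ⊆ A) →
    n ≤ S.card → IsSuperimposed 2 S → ∀ x ∈ A, ({x} : Finset X) ∈ S := by
  induction n with
  | zero =>
    intro A S hA _ _ _ _ x hx
    rw [Finset.card_eq_zero] at hA
    simp [hA] at hx
  | succ n ih =>
    intro A S hA hn hSA hSn hS
    by_cases hx : ∃ x ∈ A, ({x} : Finset X) ∈ S
    · obtain ⟨x, hxA, hxS⟩ := hx
      intro y hy
      by_cases hyx : y = x
      · rw [hyx]; exact hxS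
      have := ih (A.erase x) (S.erase {x}) (by rw [Finset.card_erase_of_mem hxA]; omega)
        (by omega) (by
          intro s hs
          rw [Finset.mem_erase] at hs
          rw [Finset.subset_erase]
          refine ⟨hSA s hs.2, fun hxs => hs.1 ?_⟩
          exact (hS.antichain hxS hs.2 (by simpa using hxs)).symm)
        (by rw [Finset.card_erase_of_mem hxS]; omega)
        ⟨fun s hs => hS.1 s (Finset.mem_of_mem_erase hs), fun I J hI hJ =>
          hS.2 I J (hI.trans (Finset.erase_subset _ _)) (hJ.trans (Finset.erase_subset _ _))⟩
        y (Finset.mem_erase.2 ⟨hyx, hy⟩)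
      exact Finset.mem_of_mem_erase this
    · exfalso
      push Not at hx
      have h2 : ∀ s ∈ S, 2 ≤ s.card := by
        intro s hs
        have h1 := (hS.1 s hs).card_pos
        by_contra hlt
        obtain ⟨z, rfl⟩ := Finset.card_eq_one.1 (show s.card = 1 by omega)
        exact hx z (hSA _ hs (by simp)) hs
      have hmaps : ∀ I ∈ S.powersetCard 2, I.sup id ∈ A.powersetCard 3 ∪ A.powersetCard 4 := by
        intro I hI
        rw [Finset.mem_powersetCard] at hI
        obtain ⟨a, b, hab, rfl⟩ := Finset.card_eq_two.1 hI.2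
        have ha : a ∈ S := hI.1 (by simp)
        have hb : b ∈ S := hI.1 (by simp)
        have hsub : a ∪ b ⊆ A := Finset.union_subset (hSA a ha) (hSA b hb)
        have hle := Finset.card_le_card hsub
        have hlt : a.card < (a ∪ b).card := by
          apply Finset.card_lt_card
          refine ⟨Finset.subset_union_left, fun h => hab ?_⟩
          exact (hS.antichain hb ha (Finset.subset_union_right.trans h)).symm
        have h2a := h2 a ha
        have : ({a, b} : Finset (Finset X)).sup id = a ∪ b := by simp
        rw [this, Finset.mem_union, Finset.mem_powersetCard, Finset.mem_powersetCard]
        have : (a ∪ b).card = 3 ∨ (a ∪ b).card = 4 := by omega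
        tauto
      have hcard := Finset.card_le_card_of_injOn (fun I : Finset (Finset X) => I.sup id) hmaps (by
        intro I hI J hJ h
        rw [Finset.mem_coe, Finset.mem_powersetCard] at hI hJ
        exact hS.2 I J hI.1 hJ.1 (Finset.card_pos.1 (by omega)) (Finset.card_pos.1 (by omega))
          (by omega) (by omega) h)
      have hu := Finset.card_union_le (A.powersetCard 3) (A.powersetCard 4)
      simp only [Finset.card_powersetCard, hA] at hcard hu
      have hm := Nat.choose_le_choose 2 hSn
      obtain ⟨s, hs⟩ := Finset.card_pos.1 (show 0 < S.card by omega)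
      have h3 := h2 s hs
      have h4 := Finset.card_le_card (hSA s hs)
      have hn' : n = 1 ∨ n = 2 ∨ n = 3 := by omega
      rcases hn' with rfl | rfl | rfl <;> simp only [Nat.choose] at hm hu <;> omega

/-- For `1 ≤ k ≤ 4`, the only 2-superimposed family on a set `X` with `k` elements having
at least `k` member sets is the family of all `k` singletons of `X`. -/
theorem superimposed_small_is_singletons {X : Type} [Fintype X] [DecidableEq X]
    (k : ℕ) (hk1 : 1 ≤ k) (hk4 : k ≤ 4) (hcard : Fintype.card X = k)
    (S : Finset (Finset X)) (hS : IsSuperimposed 2 S) (hSk : k ≤ S.card) :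
    S = Finset.univ.image (fun x : X => ({x} : Finset X)) := by
  have h := superimposed_aux k Finset.univ S hcard hk4 (fun s _ => Finset.subset_univ s) hSk hS
  ext s
  simp only [Finset.mem_image, Finset.mem_univ, true_and]
  constructor
  · intro hs
    obtain ⟨x, hx⟩ := hS.1 s hs
    exact ⟨x, hS.antichain (h x (Finset.mem_univ x)) hs (by simpa using hx)⟩
  · rintro ⟨x, rfl⟩
    exact h x (Finset.mem_univ x)
end

section
/- For every n ≥ 1, the minimum size of a (1, ≤ 2)-watching system in the path P_n on n vertices equals min(n, ⌈5(n+1)/6⌉); in particular it equals n if n ≤ 10 and equals ⌈5(n+1)/6⌉ if n ≥ 5. -/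
/-- The label of a set `A` of vertices with respect to a set `W` of watchers:
the set of watchers whose watching zone meets `A`. -/
def wLabelSet {V : Type} [DecidableEq V] (W : Finset (V × Finset V)) (A : Finset V) :
    Finset (V × Finset V) :=
  W.filter (fun w => ∃ x ∈ A, x ∈ w.2)

/-- `W` is a `(1, ≤ ℓ)`-watching system for `G`: every watcher `(v, Z)` satisfies
`Z ⊆ N_G[v]`, and the labels of all nonempty sets of at most `ℓ` vertices are
nonempty and pairwise distinct. -/
def IsWatchingSystemLe {V : Type} [DecidableEq V] (G : SimpleGraph V) (ℓ : ℕ)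
    (W : Finset (V × Finset V)) : Prop :=
  (∀ w ∈ W, ∀ x ∈ w.2, x = w.1 ∨ G.Adj w.1 x) ∧
  (∀ A : Finset V, A.Nonempty → A.card ≤ ℓ → (wLabelSet W A).Nonempty) ∧
  (∀ A B : Finset V, A.Nonempty → B.Nonempty → A.card ≤ ℓ → B.card ≤ ℓ →
    wLabelSet W A = wLabelSet W B → A = B)

/-- The minimum size of a `(1, ≤ ℓ)`-watching system of `G`. -/
noncomputable def watchingNumberLe {V : Type} [DecidableEq V] (G : SimpleGraph V)
    (ℓ : ℕ) : ℕ :=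
  sInf {k | ∃ W : Finset (V × Finset V), IsWatchingSystemLe G ℓ W ∧ W.card = k}

def Ed (l h : ℤ) : Prop :=
  (h = l + 1 ∧ (l % 5 = 0 ∨ l % 5 = 1 ∨ l % 5 = 4)) ∨ (h = l + 2 ∧ (l % 5 = 1 ∨ l % 5 = 2 ∨ l % 5 = 3))

theorem Ed.lt {l h : ℤ} (e : Ed l h) : l < h := by
  unfold Ed at e
  omega

/-- adjacency -/
def Ad (u v : ℤ) : Prop := Ed u v ∨ Ed v u

theorem Ad.symm {u v : ℤ} (h : Ad u v) : Ad v u := Or.symm h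

theorem Ad.cases {u v : ℤ} (h : Ad u v) : v = u+1 ∨ v = u+2 ∨ v = u-1 ∨ v = u-2 := by
  unfold Ad Ed at h
  omega

theorem no3 {u v w : ℤ} (h1 : Ad u v) (h2 : Ad v w) (h3 : Ad w u) : False := by
  have a := h1.cases
  have b := h2.cases
  rcases a with rfl | rfl | rfl | rfl <;> rcases b with rfl | rfl | rfl | rfl <;>
    unfold Ad Ed at * <;> omega

theorem no4 {u v w z : ℤ} (h1 : Ad u v) (h2 : Ad v w) (h3 : Ad w z) (h4 : Ad z u)
    (h5 : u ≠ w) (h6 : v ≠ z) : False := by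
  have a := h1.cases
  have b := h2.cases
  have c := h3.cases
  rcases a with rfl | rfl | rfl | rfl <;> rcases b with rfl | rfl | rfl | rfl <;>
    rcases c with rfl | rfl | rfl | rfl <;> first
    | omega
    | (unfold Ad Ed at *; omega)

theorem Ad.ne {u v : ℤ} (h : Ad u v) : u ≠ v := by
  have := h.cases
  omega

theorem two_key : ∀ x y u v w z : ℤ, Ad x y → Ad u v → Ad x w → Ad y z → y ≠ w → x ≠ z →
    (w = x ∨ w = y ∨ w = u ∨ w = v) → (z = x ∨ z = y ∨ z = u ∨ z = v) → False := by
  intro x y u v w z h1 h2 h3 h4 n1 n2 a b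
  have := h3.ne
  have := h4.ne
  rcases a with a | a | a | a
  · omega
  · omega
  · subst a
    rcases b with b | b | b | b
    · omega
    · omega
    · subst b
      exact no3 h1 h4 h3.symm
    · subst b
      exact no4 h1 h4 h2.symm h3.symm (by omega) (by omega)
  · subst a
    rcases b with b | b | b | b
    · omega
    · omega
    · subst b
      exact no4 h1 h4 h2 h3.symm (by omega) (by omega)
    · subst b
      exact no3 h1 h4 h3.symm

theorem two_edges {la ha lb hb lc hc ld hd : ℤ} (ea : Ed la ha) (eb : Ed lb hb) (ec : Ed lc hc)
    (ed : Ed ld hd)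
    (A1 : la = lc ∨ la = hc ∨ la = ld ∨ la = hd) (A2 : ha = lc ∨ ha = hc ∨ ha = ld ∨ ha = hd)
    (C1 : lc = la ∨ lc = ha ∨ lc = lb ∨ lc = hb) (C2 : hc = la ∨ hc = ha ∨ hc = lb ∨ hc = hb)
    (D1 : ld = la ∨ ld = ha ∨ ld = lb ∨ ld = hb) (D2 : hd = la ∨ hd = ha ∨ hd = lb ∨ hd = hb) :
    (la = lc ∧ ha = hc) ∨ (la = ld ∧ ha = hd) := by
  by_contra! hne
  have ia : la < ha := ea.lt
  have ic : lc < hc := ec.lt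
  have id : ld < hd := ed.lt
  have fa : Ad la ha := Or.inl ea
  have fb : Ad lb hb := Or.inl eb
  have fc : Ad lc hc := Or.inl ec
  have fd : Ad ld hd := Or.inl ed
  have hcd : ¬ (la = lc ∧ ha = hc) := fun h => hne.1 h.1 h.2
  have hcd' : ¬ (la = ld ∧ ha = hd) := fun h => hne.2 h.1 h.2
  clear hne ea eb ec ed
  rcases A1 with e | e | e | e <;> rcases A2 with f | f | f | f
  · clear C1 C2 D1 D2; omega
  · clear C1 C2 D1 D2; omega
  · exact two_key la ha lb hb _ _ fa fb (e ▸ fc) (f ▸ fd)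
      (by clear C1 C2 D1 D2; omega) (by clear C1 C2 D1 D2; omega) C2 D2
  · exact two_key la ha lb hb _ _ fa fb (e ▸ fc) (f ▸ fd.symm)
      (by clear C1 C2 D1 D2; omega) (by clear C1 C2 D1 D2; omega) C2 D1
  · clear C1 C2 D1 D2; omega
  · clear C1 C2 D1 D2; omega
  · exact two_key la ha lb hb _ _ fa fb (e ▸ fc.symm) (f ▸ fd)
      (by clear C1 C2 D1 D2; omega) (by clear C1 C2 D1 D2; omega) C1 D2
  · exact two_key la ha lb hb _ _ fa fb (e ▸ fc.symm) (f ▸ fd.symm)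
      (by clear C1 C2 D1 D2; omega) (by clear C1 C2 D1 D2; omega) C1 D1
  · exact two_key la ha lb hb _ _ fa fb (e ▸ fd) (f ▸ fc)
      (by clear C1 C2 D1 D2; omega) (by clear C1 C2 D1 D2; omega) D2 C2
  · exact two_key la ha lb hb _ _ fa fb (e ▸ fd) (f ▸ fc.symm)
      (by clear C1 C2 D1 D2; omega) (by clear C1 C2 D1 D2; omega) D2 C1
  · clear C1 C2 D1 D2; omega
  · clear C1 C2 D1 D2; omega
  · exact two_key la ha lb hb _ _ fa fb (e ▸ fd.symm) (f ▸ fc)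
      (by clear C1 C2 D1 D2; omega) (by clear C1 C2 D1 D2; omega) D1 C2
  · exact two_key la ha lb hb _ _ fa fb (e ▸ fd.symm) (f ▸ fc.symm)
      (by clear C1 C2 D1 D2; omega) (by clear C1 C2 D1 D2; omega) D1 C1
  · clear C1 C2 D1 D2; omega
  · clear C1 C2 D1 D2; omega

def lo (x : ℤ) : ℤ := 5 * (x / 6) + (if x % 6 ≤ 1 then x % 6 else x % 6 - 1)
def hi (x : ℤ) : ℤ := 5 * (x / 6) + (if x % 6 ≤ 4 then x % 6 + 1 else 5)

theorem lohi (x : ℤ) : Ed (lo x) (hi x) := by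
  unfold Ed lo hi
  split_ifs <;> omega
theorem lohi_inj (x y : ℤ) (h1 : lo x = lo y) (h2 : hi x = hi y) : x = y := by
  unfold lo hi at *
  split_ifs at * <;> omega

structure Sys (n : ℤ) (p q t : ℤ → ℤ) : Prop where
  p0 : ∀ x, 0 ≤ p x ∧ p x ≤ 1
  q0 : ∀ x, 0 ≤ q x ∧ q x ≤ 1
  t0 : ∀ x, 0 ≤ t x ∧ t x ≤ 1
  ps : ∀ x, p x ≠ 0 → 1 ≤ x ∧ x + 1 ≤ n
  qs : ∀ x, q x ≠ 0 → 1 ≤ x ∧ x + 2 ≤ n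
  ts : ∀ x, t x ≠ 0 → 1 ≤ x ∧ x + 2 ≤ n
  a1 : ∀ v, 1 ≤ v → v ≤ n → 1 ≤ p (v-1) + q (v-2) + q v + t (v-2)
  a2 : ∀ v, 1 ≤ v → v ≤ n → 1 ≤ p v + q v + q (v-2) + t v
  a3 : ∀ v, 1 ≤ v → v ≤ n → 1 ≤ p (v-1) + p v + q (v-2) + t (v-2) + t (v-1)
  a4 : ∀ v, 1 ≤ v → v ≤ n → 1 ≤ p v + p (v-1) + q v + t v + t (v-1)
  b : ∀ v, 1 ≤ v-1 → v+1 ≤ n →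
    1 ≤ p (v-2) + q (v-3) + t (v-3) + p (v+1) + q (v+1) + t (v+1)
  c1 : ∀ v, 1 ≤ v → v+2 ≤ n → 1 ≤ p (v-1) + q (v-2) + q (v-1) + q (v+1) + t (v-2)
  c2 : ∀ v, 1 ≤ v-2 → v ≤ n → 1 ≤ p v + q v + q (v-1) + q (v-3) + t v
  d : ∀ v, 1 ≤ v → v+3 ≤ n → 1 ≤ p (v-1) + p (v+1) + p (v+3) + q (v-2) + q (v-1)
    + q (v+2) + q (v+3) + t (v-2) + t (v+3)

namespace Sys

def deg (p q t : ℤ → ℤ) (v : ℤ) : ℤ :=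
  p (v-1) + p v + q (v-2) + q v + t (v-2) + t (v-1) + t v
def tau (t : ℤ → ℤ) (v : ℤ) : ℤ := t (v-2) + t (v-1) + t v
def sl (p q t : ℤ → ℤ) (v : ℤ) : ℤ := 3 * deg p q t v - 5 - tau t v
def Hub (p q t : ℤ → ℤ) (v : ℤ) : Prop := deg p q t v = 2 ∧ t (v-2) = 1 ∧ t v = 1
def Ex (p q t : ℤ → ℤ) (v : ℤ) : Prop := 3 ≤ deg p q t v
def BadL (p q t : ℤ → ℤ) (v : ℤ) : Prop := Hub p q t v ∧ Ex p q t (v-1)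
def BadR (p q t : ℤ → ℤ) (v : ℤ) : Prop := Hub p q t v ∧ Ex p q t (v+1)
def Clean (p q t : ℤ → ℤ) (v : ℤ) : Prop := Hub p q t v ∧ ¬ Ex p q t (v-1) ∧ ¬ Ex p q t (v+1)
open Classical in
noncomputable def fl (p q t : ℤ → ℤ) (v : ℤ) : ℤ := if BadL p q t v then 1 else 0
open Classical in
noncomputable def fr (p q t : ℤ → ℤ) (v : ℤ) : ℤ := if BadR p q t v then 1 else 0
/-- slack after redistribution -/
noncomputable def sp (p q t : ℤ → ℤ) (v : ℤ) : ℤ :=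
  sl p q t v + fl p q t v + fr p q t v - fl p q t (v+1) - fr p q t (v-1)

variable {n : ℤ} {p q t : ℤ → ℤ}

theorem deg2 (h : Sys n p q t) (v : ℤ) (h1 : 1 ≤ v) (h2 : v ≤ n) : 2 ≤ deg p q t v := by
  have := h.a1 v h1 h2
  have := h.a2 v h1 h2
  have := h.a3 v h1 h2
  have := h.a4 v h1 h2
  have := h.p0 v
  have := h.p0 (v-1)
  have := h.q0 v
  have := h.q0 (v-2)
  have := h.t0 v
  have := h.t0 (v-1)
  have := h.t0 (v-2)
  unfold deg
  omega

theorem hub_range (h : Sys n p q t) (v : ℤ) (hv : Hub p q t v) : 3 ≤ v ∧ v + 2 ≤ n := by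
  obtain ⟨_, h1, h2⟩ := hv
  have := h.ts (v-2) (by omega)
  have := h.ts v (by omega)
  omega

/-- left end -/
theorem left_end (h : Sys n p q t) (hn : 3 ≤ n) : p 1 = 1 ∧ q 1 = 1 ∧ q 2 = 1 := by
  have a := h.a1 1 (by omega) (by omega)
  have b := h.a3 1 (by omega) (by omega)
  have c := h.c1 1 (by omega) (by omega)
  norm_num at a b c
  have := h.p0 1
  have := h.q0 1
  have := h.q0 2
  have := h.ps 0
  have := h.qs 0
  have := h.ts 0
  have := h.qs (-1)
  have := h.ts (-1)
  omega

theorem right_end (h : Sys n p q t) (hn : 3 ≤ n) : p (n-1) = 1 ∧ q (n-2) = 1 ∧ q (n-3) = 1 := by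
  have a := h.a2 n (by omega) (by omega)
  have b := h.a4 n (by omega) (by omega)
  have c := h.c2 n (by omega) (by omega)
  have := h.p0 (n-1)
  have := h.q0 (n-2)
  have := h.q0 (n-3)
  have := h.ps n
  have := h.qs n
  have := h.ts n
  have := h.qs (n-1)
  have := h.ts (n-1)
  omega

theorem not_hub3 (h : Sys n p q t) (hn : 5 ≤ n) : ¬ Hub p q t 3 := by
  rintro ⟨h1, h2, h3⟩
  have := h.left_end (by omega)
  have := h.p0 2
  have := h.p0 3
  have := h.q0 3
  have := h.t0 2
  norm_num [deg] at *
  omega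

theorem not_hubn (h : Sys n p q t) (hn : 5 ≤ n) : ¬ Hub p q t (n-2) := by
  rintro ⟨h1, h2, h3⟩
  have := h.right_end (by omega)
  have := h.p0 (n-3)
  have := h.p0 (n-2)
  have := h.q0 (n-4)
  have := h.t0 (n-3)
  have e1 : n-2-1 = n-3 := by ring
  have e2 : n-2-2 = n-4 := by ring
  simp only [deg, e1, e2] at *
  omega

/-- clean hub: both neighbours have distance-two pairs going outward -/
theorem clean_q (h : Sys n p q t) (v : ℤ) (hv : Clean p q t v) :
    q (v+1) = 1 ∧ q (v-3) = 1 := by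
  have hr := h.hub_range v hv.1
  obtain ⟨⟨h1, h2, h3⟩, h4, h5⟩ := hv
  have a := h.b v (by omega) (by omega)
  have a1 := h.a1 (v+1) (by omega) (by omega)
  have a2 := h.a2 (v-1) (by omega) (by omega)
  have a1' := h.a2 (v+1) (by omega) (by omega)
  have a2' := h.a1 (v-1) (by omega) (by omega)
  have d1 := h.deg2 (v+1) (by omega) (by omega)
  have d2 := h.deg2 (v-1) (by omega) (by omega)
  have p0 := fun k : ℤ => h.p0 (v+k)
  have q0 := fun k : ℤ => h.q0 (v+k)
  have t0 := fun k : ℤ => h.t0 (v+k)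
  have := p0 (-2)
  have := p0 (-1)
  have := p0 0
  have := p0 1
  have := q0 (-3)
  have := q0 (-2)
  have := q0 (-1)
  have := q0 0
  have := q0 1
  have := t0 (-3)
  have := t0 (-2)
  have := t0 (-1)
  have := t0 0
  have := t0 1
  clear p0 q0 t0
  unfold Ex deg at *
  ring_nf at *
  omega


theorem fl_eq (v : ℤ) (hv : ¬ Hub p q t v) : fl p q t v = 0 := if_neg (fun h => hv h.1)
theorem fr_eq (v : ℤ) (hv : ¬ Hub p q t v) : fr p q t v = 0 := if_neg (fun h => hv h.1)
theorem fl_le (v : ℤ) : 0 ≤ fl p q t v ∧ fl p q t v ≤ 1 := by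
  unfold fl; split_ifs <;> simp
theorem fr_le (v : ℤ) : 0 ≤ fr p q t v ∧ fr p q t v ≤ 1 := by
  unfold fr; split_ifs <;> simp

theorem sp_ex (h : Sys n p q t) (v : ℤ) (hE : Ex p q t v) : 1 ≤ sp p q t v := by
  have hH : ¬ Hub p q t v := fun hh => by
    have := hh.1
    unfold Ex at hE
    omega
  have e1 := fl_eq v hH
  have e2 := fr_eq v hH
  have e3 := fl_le (p := p) (q := q) (t := t) (v+1)
  have e4 := fr_le (p := p) (q := q) (t := t) (v-1)
  have t0 := h.t0 v
  have t1 := h.t0 (v-1)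
  have t2 := h.t0 (v-2)
  have key1 : fl p q t (v+1) = 1 → t v = 0 := by
    intro hf
    have hh : Hub p q t (v+1) := by
      by_contra hc
      have := fl_eq _ hc
      omega
    obtain ⟨h1, h2, h3⟩ := hh
    have := h.p0 (v+1)
    have := h.p0 (v)
    have := h.q0 (v+1)
    have := h.q0 (v-1)
    have := h.t0 (v-1)
    unfold deg at h1
    ring_nf at *
    omega
  have key2 : fr p q t (v-1) = 1 → t (v-2) = 0 := by
    intro hf
    have hh : Hub p q t (v-1) := by
      by_contra hc
      have := fr_eq _ hc
      omega
    obtain ⟨h1, h2, h3⟩ := hh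
    have := h.p0 (v-1)
    have := h.p0 (v-2)
    have := h.q0 (v-1)
    have := h.q0 (v-3)
    have := h.t0 (v-2)
    unfold deg at h1
    ring_nf at *
    omega
  unfold sp sl tau
  unfold Ex at hE
  omega

theorem sp_noex (v : ℤ) (hE : ¬ Ex p q t v) :
    sp p q t v = sl p q t v + fl p q t v + fr p q t v := by
  have e1 : fl p q t (v+1) = 0 := if_neg (fun hh => hE (by have := hh.2; simpa using this))
  have e2 : fr p q t (v-1) = 0 := if_neg (fun hh => hE (by have := hh.2; simpa using this))
  unfold sp
  omega

theorem sp_nonhub (h : Sys n p q t) (v : ℤ) (h1 : 1 ≤ v) (h2 : v ≤ n)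
    (hE : ¬ Ex p q t v) (hH : ¬ Hub p q t v) :
    sp p q t v = 1 - tau t v ∧ 0 ≤ sp p q t v := by
  have e := sp_noex v hE
  have e1 := fl_eq v hH
  have e2 := fr_eq v hH
  have d := h.deg2 v h1 h2
  have a := h.a1 v h1 h2
  have b := h.a2 v h1 h2
  have := h.p0 v
  have := h.p0 (v-1)
  have := h.q0 v
  have := h.q0 (v-2)
  have := h.t0 v
  have := h.t0 (v-1)
  have := h.t0 (v-2)
  unfold Hub at hH
  unfold sl at e
  unfold Ex at hE
  have hd : deg p q t v = 2 := by omega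
  have e' : sp p q t v = 1 - tau t v := by omega
  refine ⟨e', ?_⟩
  rw [e']
  unfold deg tau at *
  omega

theorem sp_nonclean (h : Sys n p q t) (v : ℤ) (h1 : 1 ≤ v) (h2 : v ≤ n)
    (hC : ¬ Clean p q t v) : 0 ≤ sp p q t v := by
  by_cases hE : Ex p q t v
  · have := h.sp_ex v hE
    omega
  by_cases hH : Hub p q t v
  · have e := sp_noex v hE
    have hb : 1 ≤ fl p q t v + fr p q t v := by
      have e3 := fl_le (p := p) (q := q) (t := t) v
      have e4 := fr_le (p := p) (q := q) (t := t) v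
      by_cases h3 : Ex p q t (v-1)
      · have : fl p q t v = 1 := if_pos ⟨hH, h3⟩
        omega
      by_cases h4 : Ex p q t (v+1)
      · have : fr p q t v = 1 := if_pos ⟨hH, h4⟩
        omega
      exact absurd ⟨hH, h3, h4⟩ hC
    obtain ⟨d1, d2, d3⟩ := hH
    have := h.p0 v
    have := h.p0 (v-1)
    have := h.q0 v
    have := h.q0 (v-2)
    have := h.t0 (v-1)
    unfold sl tau at e
    have d1' := d1
    unfold deg at d1'
    omega
  · exact (h.sp_nonhub v h1 h2 hE hH).2

theorem sp_clean (h : Sys n p q t) (v : ℤ) (hC : Clean p q t v) : -1 ≤ sp p q t v := by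
  obtain ⟨⟨d1, d2, d3⟩, -, -⟩ := hC
  have hE : ¬ Ex p q t v := by unfold Ex; omega
  have e := sp_noex v hE
  have e3 := fl_le (p := p) (q := q) (t := t) v
  have e4 := fr_le (p := p) (q := q) (t := t) v
  have := h.p0 v
  have := h.p0 (v-1)
  have := h.q0 v
  have := h.q0 (v-2)
  have := h.t0 (v-1)
  unfold sl tau at e
  have d1' := d1
  unfold deg at d1'
  omega

theorem end_sp (h : Sys n p q t) (hn : 5 ≤ n) (v : ℤ) (hv : v = 1 ∨ v = 2 ∨ v = n-1 ∨ v = n) :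
    1 ≤ sp p q t v ∧ (Ex p q t v → 3 ≤ sp p q t v) := by
  have e1 : ¬ Hub p q t v := fun hh => by have := h.hub_range _ hh; omega
  have e2 : ¬ Hub p q t (v-1) := fun hh => by
    have := h.hub_range _ hh
    obtain rfl : v = n-1 := by omega
    exact h.not_hubn hn (by rwa [show n-1-1 = n-2 by ring] at hh)
  have e3 : ¬ Hub p q t (v+1) := fun hh => by
    have := h.hub_range _ hh
    obtain rfl : v = 2 := by omega
    exact h.not_hub3 hn hh
  have f1 := fl_eq _ e1
  have f2 := fr_eq _ e1
  have f3 := fl_eq _ e3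
  have f4 := fr_eq _ e2
  have hl := h.left_end (by omega)
  have hr := h.right_end (by omega)
  have dg := h.deg2 v (by omega) (by omega)
  have key : tau t v ≤ deg p q t v - 2 := by
    have := h.p0 v
    have := h.p0 (v-1)
    have := h.q0 v
    have := h.q0 (v-2)
    unfold tau deg
    rcases hv with rfl | rfl | rfl | rfl
    · omega
    · norm_num at *
      omega
    · have e1 : n - 1 - 2 = n - 3 := by ring
      rw [e1] at *
      omega
    · omega
  unfold sp sl Ex
  omega

theorem left_extra (h : Sys n p q t) (hn : 5 ≤ n) :
    3 ≤ sp p q t 1 + sp p q t 2 + sp p q t 3 ∨ Ex p q t 4 := by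
  have s1 := h.end_sp hn 1 (by simp)
  have s2 := h.end_sp hn 2 (by simp)
  by_contra! hc
  obtain ⟨hc, h4⟩ := hc
  have hH := h.not_hub3 hn
  have s3 := h.sp_nonclean 3 (by omega) (by omega) (fun hh => hH hh.1)
  have x1 : ¬ Ex p q t 1 := fun hh => by have := s1.2 hh; omega
  have x2 : ¬ Ex p q t 2 := fun hh => by have := s2.2 hh; omega
  have x3 : ¬ Ex p q t 3 := fun hh => by have := h.sp_ex 3 hh; omega
  have s3' := (h.sp_nonhub 3 (by omega) (by omega) x3 hH).1
  have hd := h.d 1 (by omega) (by omega)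
  have hl := h.left_end (by omega)
  have p0 := h.p0
  have q0 := h.q0
  have t0 := h.t0
  have := p0 2
  have := p0 3
  have := p0 4
  have := q0 3
  have := q0 4
  have := t0 1
  have := t0 2
  have := t0 3
  have := t0 4
  have := h.ps 0
  have := h.qs 0
  have := h.ts 0
  have := h.qs (-1)
  have := h.ts (-1)
  clear p0 q0 t0
  unfold Ex deg at *
  unfold tau at *
  norm_num at *
  omega

theorem next_pos (h : Sys n p q t) (hn : 5 ≤ n) (v : ℤ) (hv : Clean p q t v) :
    ∃ u, v < u ∧ u ≤ n ∧ 1 ≤ sp p q t u ∧ (∀ w, v < w → w ≤ u → ¬ Clean p q t w) ∧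
      (n - 1 ≤ u → Ex p q t u) := by
  have hr := h.hub_range v hv.1
  have hcq := h.clean_q v hv
  have hvn : v ≠ n-2 := fun e => h.not_hubn hn (e ▸ hv.1)
  have ExC : ∀ w, Ex p q t w → ¬ Clean p q t w := fun w hw hc => by
    have := hc.1.1
    unfold Ex at hw
    omega
  obtain ⟨⟨h1, h2, h3⟩, h4, h5⟩ := hv
  have p0 := h.p0
  have q0 := h.q0
  have t0 := h.t0
  have dd : ∀ w, ¬ Ex p q t w → deg p q t w ≤ 2 := fun w hw => by unfold Ex at hw; omega
  have d1 := dd _ h5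
  -- structure at v, v+1
  have T1 : t (v+1) = 0 ∧ q (v-1) = 0 ∧ q v = 0 ∧ p v = 0 ∧ p (v+1) = 0 ∧ t (v-1) = 0 := by
    have := p0 v
    have := p0 (v-1)
    have := p0 (v+1)
    have := q0 v
    have := q0 (v-1)
    have := q0 (v-2)
    have := t0 (v-1)
    have := t0 (v+1)
    unfold deg at h1 d1
    rw [show v+1-1 = v by ring, show v+1-2 = v-1 by ring] at d1
    omega
  have C1 : ¬ Clean p q t (v+1) := fun hh => by
    have := hh.1.2.2
    omega
  have W2 : ∀ w, v < w → w ≤ v+2 → w = v+1 ∨ w = v+2 := by intros; omega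
  have W3 : ∀ w, v < w → w ≤ v+3 → w = v+1 ∨ w = v+2 ∨ w = v+3 := by intros; omega
  have W4 : ∀ w, v < w → w ≤ v+4 → w = v+1 ∨ w = v+2 ∨ w = v+3 ∨ w = v+4 := by intros; omega
  by_cases E2 : Ex p q t (v+2)
  · refine ⟨v+2, by omega, by omega, h.sp_ex _ E2, ?_, fun _ => E2⟩
    intro w hw1 hw2
    rcases W2 w hw1 hw2 with rfl | rfl
    · exact C1
    · exact ExC _ E2
  have d2 := dd _ E2
  have C2 : ¬ Clean p q t (v+2) := fun hh => by
    have := (h.clean_q _ hh).2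
    rw [show v+2-3 = v-1 by ring] at this
    omega
  by_cases E3 : Ex p q t (v+3)
  · refine ⟨v+3, by omega, by omega, h.sp_ex _ E3, ?_, fun _ => E3⟩
    intro w hw1 hw2
    rcases W3 w hw1 hw2 with rfl | rfl | rfl
    · exact C1
    · exact C2
    · exact ExC _ E3
  have d3 := dd _ E3
  have H2 : ¬ Hub p q t (v+2) := fun hh => C2 ⟨hh, by
    rwa [show v+2-1 = v+1 by ring], by rwa [show v+2+1 = v+3 by ring]⟩
  have T2 : t (v+2) = 0 := by
    by_contra hc
    refine H2 ⟨le_antisymm d2 (h.deg2 _ (by omega) (by omega)), ?_, ?_⟩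
    · rwa [show v+2-2 = v by ring]
    · have := t0 (v+2)
      omega
  have H3 : ¬ Hub p q t (v+3) := fun hh => by
    have := hh.2.1
    rw [show v+3-2 = v+1 by ring] at this
    omega
  have a2 := h.a2 (v+2) (by omega) (by omega)
  rw [show v+2-2 = v by ring] at a2
  have hd := h.d (v+1) (by omega)
  rw [show v+1-1 = v by ring, show v+1-2 = v-1 by ring, show v+1+1 = v+2 by ring,
    show v+1+2 = v+3 by ring, show v+1+3 = v+4 by ring] at hd
  have := p0 (v+2)
  have := p0 (v+3)
  have := p0 (v+4)
  have := q0 (v+2)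
  have := q0 (v+3)
  have := q0 (v+4)
  have := t0 (v+3)
  have := t0 (v+4)
  have := t0 (v+2)
  unfold deg at d2 d3
  rw [show v+2-1 = v+1 by ring, show v+2-2 = v by ring] at d2
  rw [show v+3-1 = v+2 by ring, show v+3-2 = v+1 by ring] at d3
  by_cases T3 : t (v+3) = 0
  · have vq := h.qs (v+1)
    refine ⟨v+3, by omega, by omega, ?_, ?_, ?_⟩
    · rw [(h.sp_nonhub _ (by omega) (by omega) E3 H3).1]
      unfold tau
      rw [show v+3-1 = v+2 by ring, show v+3-2 = v+1 by ring]
      omega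
    · intro w hw1 hw2
      rcases W3 w hw1 hw2 with rfl | rfl | rfl
      · exact C1
      · exact C2
      · exact fun hh => H3 hh.1
    · intro hu
      exfalso
      have re := h.right_end (by omega)
      by_cases hv3 : v + 3 = n
      · obtain rfl : v = n - 3 := by omega
        omega
      · obtain rfl : v = n - 4 := by omega
        rw [show n-1 = n-4+3 by ring, show n-2 = n-4+2 by ring, show n-3 = n-4+1 by ring] at re
        have := h.ps (n-4+4)
        have := h.qs (n-4+4)
        have := h.ts (n-4+4)
        have := h.qs (n-4+3)
        omega
  · have vt := h.ts (v+3) T3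
    have E4 : Ex p q t (v+4) := by
      by_contra E4
      have d4 := dd _ E4
      unfold deg at d4
      rw [show v+4-1 = v+3 by ring, show v+4-2 = v+2 by ring] at d4
      omega
    refine ⟨v+4, by omega, by omega, h.sp_ex _ E4, ?_, fun _ => E4⟩
    intro w hw1 hw2
    rcases W4 w hw1 hw2 with rfl | rfl | rfl | rfl
    · exact C1
    · exact C2
    · exact fun hh => H3 hh.1
    · exact ExC _ E4

theorem sum_sp (h : Sys n p q t) (hn : 5 ≤ n) (N : ℕ) (hN : (N:ℤ) = n) :
    5 ≤ ∑ i ∈ Finset.range N, sp p q t (i+1) := by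
  have s1 := h.end_sp hn 1 (by simp)
  have s2 := h.end_sp hn 2 (by simp)
  have sn := h.end_sp hn n (by simp)
  have sn' := h.end_sp hn (n-1) (by simp)
  have s3 := h.sp_nonclean 3 (by omega) (by omega) (fun hh => h.not_hub3 hn hh.1)
  have le := h.left_extra hn
  by_cases h5 : N = 5
  · subst h5
    simp only [Finset.sum_range_succ, Finset.sum_range_zero]
    norm_num at *
    subst hN
    norm_num at *
    rcases le with le | le
    · omega
    · have := sn'.2 le
      omega
  have inv : ∀ k : ℕ, 4 ≤ k → (k:ℤ) ≤ n - 2 →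
      2 ≤ ∑ i ∈ Finset.range k, sp p q t (i+1) ∧
      (3 ≤ ∑ i ∈ Finset.range k, sp p q t (i+1) ∨
        ∃ v, Clean p q t v ∧ v ≤ k ∧ ∀ w, v < w → w ≤ k → sp p q t w ≤ 0) := by
    intro k hk
    induction k, hk using Nat.le_induction with
    | base =>
      intro _
      suffices 3 ≤ ∑ i ∈ Finset.range 4, sp p q t (i+1) by omega
      simp only [Finset.sum_range_succ, Finset.sum_range_zero]
      norm_num
      by_cases hC : Clean p q t 4
      · have : Ex p q t 2 := by
          have := hC.1.2.1
          have := h.left_end (by omega)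
          have := h.p0 2
          have := h.q0 0
          have := h.t0 0
          have := h.t0 1
          norm_num [Ex, deg] at *
          omega
        have := s2.2 this
        have := h.sp_clean 4 hC
        omega
      · have := h.sp_nonclean 4 (by omega) (by omega) hC
        rcases le with le | le
        · omega
        · have := h.sp_ex 4 le
          omega
    | succ k hk ih =>
      intro hkn
      push_cast at hkn
      obtain ⟨i1, i2⟩ := ih (by omega)
      rw [Finset.sum_range_succ]
      by_cases hC : Clean p q t (k+1)
      · have c := h.sp_clean _ hC
        have i3 : 3 ≤ ∑ i ∈ Finset.range k, sp p q t (i+1) := by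
          rcases i2 with i2 | ⟨v, v1, v2, v3⟩
          · exact i2
          · obtain ⟨u, u1, u2, u3, u4, -⟩ := h.next_pos hn v v1
            exfalso
            by_cases hu : u ≤ k
            · have := v3 u u1 hu
              omega
            · exact u4 (k+1) (by omega) (by omega) hC
        refine ⟨by omega, Or.inr ⟨k+1, hC, by push_cast; omega, ?_⟩⟩
        intro w w1 w2
        push_cast at w2
        omega
      · have c := h.sp_nonclean (k+1) (by omega) (by omega) hC
        refine ⟨by omega, ?_⟩
        by_cases c1 : 1 ≤ sp p q t (k+1)
        · left
          omega
        rcases i2 with i2 | ⟨v, v1, v2, v3⟩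
        · left
          omega
        · refine Or.inr ⟨v, v1, by push_cast; omega, ?_⟩
          intro w w1 w2
          push_cast at w2
          by_cases hw : w ≤ k
          · exact v3 w w1 hw
          · obtain rfl : w = k+1 := by omega
            omega
  obtain ⟨M, rfl⟩ : ∃ M, N = M + 2 := ⟨N-2, by omega⟩
  push_cast at hN
  obtain ⟨i1, i2⟩ := inv M (by omega) (by omega)
  rw [Finset.sum_range_succ, Finset.sum_range_succ]
  push_cast
  rw [show (M:ℤ)+1 = n-1 by omega, show n-1+1 = n by ring]
  rcases i2 with i2 | ⟨v, v1, v2, v3⟩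
  · omega
  · obtain ⟨u, u1, u2, u3, -, u5⟩ := h.next_pos hn v v1
    have hu : ¬ u ≤ M := fun hu => by
      have := v3 u u1 hu
      omega
    have hE := u5 (by omega)
    have : u = n-1 ∨ u = n := by omega
    rcases this with rfl | rfl
    · have := sn'.2 hE
      omega
    · have := sn.2 hE
      omega

theorem shift (f : ℤ → ℤ) (N : ℕ) :
    ∑ i ∈ Finset.range N, f i = ∑ i ∈ Finset.range N, f (i+1) + f 0 - f N := by
  induction N with
  | zero => simp
  | succ k ih =>
    rw [Finset.sum_range_succ, Finset.sum_range_succ, ih]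
    push_cast
    ring

theorem zero_of {a : ℤ} {P : Prop} (h : a ≠ 0 → P) (hP : ¬ P) : a = 0 := by
  by_contra hc
  exact hP (h hc)

theorem sum_sl (h : Sys n p q t) (hn : 4 ≤ n) (N : ℕ) (hN : (N:ℤ) = n) :
    ∑ i ∈ Finset.range N, sl p q t (i+1) =
      6 * ∑ i ∈ Finset.range N, (p (i+1) + q (i+1) + t (i+1)) - 5 * n := by
  have P1 := shift p N
  have Q1 := shift q N
  have Q2 := shift (fun x => q (x-1)) N
  have T1 := shift t N
  have T2 := shift (fun x => t (x-1)) N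
  have zp0 := zero_of (h.ps 0) (by omega)
  have zpn := zero_of (h.ps n) (by omega)
  have zq0 := zero_of (h.qs 0) (by omega)
  have zqn := zero_of (h.qs n) (by omega)
  have zq0' := zero_of (h.qs (-1)) (by omega)
  have zqn' := zero_of (h.qs (n-1)) (by omega)
  have zt0 := zero_of (h.ts 0) (by omega)
  have ztn := zero_of (h.ts n) (by omega)
  have zt0' := zero_of (h.ts (-1)) (by omega)
  have ztn' := zero_of (h.ts (n-1)) (by omega)
  have e : ∀ i : ℕ, sl p q t (i+1) = 3 * p i + 3 * p (i+1) + 3 * q (i-1) + 3 * q (i+1)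
      + 2 * t (i-1) + 2 * t i + 2 * t (i+1) - 5 := by
    intro i
    unfold sl deg tau
    rw [show (i:ℤ)+1-1 = i by ring, show (i:ℤ)+1-2 = i-1 by ring]
    ring
  simp only [e, Finset.sum_add_distrib, Finset.sum_sub_distrib, ← Finset.mul_sum]
  simp only [hN, zero_sub, add_sub_cancel_right] at P1 Q1 Q2 T1 T2
  simp only [Finset.sum_const, Finset.card_range, nsmul_eq_mul, hN]
  omega

theorem sum_sp_eq (h : Sys n p q t) (hn : 5 ≤ n) (N : ℕ) (hN : (N:ℤ) = n) :
    ∑ i ∈ Finset.range N, sp p q t (i+1) = ∑ i ∈ Finset.range N, sl p q t (i+1) := by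
  have A := shift (fun x => fl p q t (x+1)) N
  have B := shift (fr p q t) N
  have z1 : fl p q t 1 = 0 := fl_eq _ (fun hh => by have := h.hub_range _ hh; omega)
  have z2 : fl p q t (n+1) = 0 := fl_eq _ (fun hh => by have := h.hub_range _ hh; omega)
  have z3 : fr p q t 0 = 0 := fr_eq _ (fun hh => by have := h.hub_range _ hh; omega)
  have z4 : fr p q t n = 0 := fr_eq _ (fun hh => by have := h.hub_range _ hh; omega)
  unfold sp
  simp only [Finset.sum_add_distrib, Finset.sum_sub_distrib, add_sub_cancel_right]
  simp only [hN, zero_add] at A B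
  omega

theorem bound5 (h : Sys n p q t) (hn : 5 ≤ n) (N : ℕ) (hN : (N:ℤ) = n) :
    5 * (n + 1) ≤ 6 * ∑ i ∈ Finset.range N, (p (i+1) + q (i+1) + t (i+1)) := by
  have a := h.sum_sp hn N hN
  rw [h.sum_sp_eq hn N hN, h.sum_sl (by omega) N hN] at a
  omega

theorem bound4 (h : Sys n p q t) (hn : n ≤ 4) (hn1 : 1 ≤ n) (N : ℕ) (hN : (N:ℤ) = n) :
    n ≤ ∑ i ∈ Finset.range N, (p (i+1) + q (i+1) + t (i+1)) := by
  have hN4 : N ≤ 4 := by omega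
  have hp := h.ps
  have hq := h.qs
  have ht := h.ts
  interval_cases N
  · omega
  · have := h.a1 1 (by omega) (by omega)
    have := hp 0
    have := hq (-1)
    have := ht (-1)
    have := hq 1
    norm_num at *
    omega
  · have := h.a1 1 (by omega) (by omega)
    have := hp 0
    have := hq (-1)
    have := ht (-1)
    have := hq 1
    norm_num at *
    omega
  · have := h.left_end (by norm_num at hN; omega)
    have := hq 2
    norm_num at *
    omega
  · have a := h.left_end (by norm_num at hN; omega)
    have b := h.right_end (by norm_num at hN; omega)
    norm_num at hN
    subst hN
    simp only [Finset.sum_range_succ, Finset.sum_range_zero]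
    norm_num at *
    have := h.p0 2
    have := h.q0 3
    have := h.p0 4
    have := h.q0 4
    have := h.t0 1
    have := h.t0 2
    have := h.t0 3
    have := h.t0 4
    omega

end Sys

/-- relational form of a `(1, ≤ 2)`-watching system on the path `1, …, n` -/
structure WS (n : ℤ) {ι : Type} (R : ι → ℤ → Prop) : Prop where
  supp : ∀ i y, R i y → 1 ≤ y ∧ y ≤ n
  span : ∀ i a b, R i a → R i b → a ≤ b + 2
  cov : ∀ x, 1 ≤ x → x ≤ n → ∃ i, R i x
  sep : ∀ a b c d, 1 ≤ a → a ≤ n → 1 ≤ b → b ≤ n → 1 ≤ c → c ≤ n → 1 ≤ d → d ≤ n →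
    (∀ i, (R i a ∨ R i b) ↔ (R i c ∨ R i d)) → (a = c ∨ a = d) ∧ (b = c ∨ b = d) ∧
      (c = a ∨ c = b) ∧ (d = a ∨ d = b)

namespace WS

def dl (x y : ℤ) : ℤ := if y < x then y else y + 1

theorem contract {n : ℤ} {ι : Type} {R : ι → ℤ → Prop} (h : WS n R) (i0 : ι) (x : ℤ)
    (hx1 : 1 ≤ x) (hx2 : x ≤ n)
    (hx : ∀ y, R i0 y ↔ y = x) :
    WS (n-1) (fun (i : {i : ι // i ≠ i0}) y => R i (dl x y)) := by
  have dn : ∀ y, dl x y ≠ x := by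
    intro y
    unfold dl
    split_ifs <;> omega
  have dr : ∀ y, 1 ≤ dl x y ∧ dl x y ≤ n ↔ 1 ≤ y ∧ y ≤ n-1 := by
    intro y
    unfold dl
    split_ifs <;> omega
  have di : ∀ y z, dl x y = dl x z ↔ y = z := by
    intro y z
    unfold dl
    split_ifs <;> omega
  constructor
  · intro i y hy
    exact (dr y).1 (h.supp _ _ hy)
  · intro i a b ha hb
    have := h.span _ _ _ ha hb
    unfold dl at this
    split_ifs at this <;> omega
  · intro y h1 h2
    obtain ⟨h3, h4⟩ := (dr y).2 ⟨h1, h2⟩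
    obtain ⟨i, hi⟩ := h.cov _ h3 h4
    refine ⟨⟨i, ?_⟩, hi⟩
    rintro rfl
    exact dn y ((hx _).1 hi)
  · intro a b c d a1 a2 b1 b2 c1 c2 d1 d2 H
    obtain ⟨a3, a4⟩ := (dr a).2 ⟨a1, a2⟩
    obtain ⟨b3, b4⟩ := (dr b).2 ⟨b1, b2⟩
    obtain ⟨c3, c4⟩ := (dr c).2 ⟨c1, c2⟩
    obtain ⟨d3, d4⟩ := (dr d).2 ⟨d1, d2⟩
    have := h.sep _ _ _ _ a3 a4 b3 b4 c3 c4 d3 d4 (by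
      intro i
      by_cases hi : i = i0
      · subst hi
        simp [hx, dn]
      · exact H ⟨i, hi⟩)
    simpa only [di] using this

def shape (k : ℕ) (x y : ℤ) : Prop := y = x ∨ (k ≠ 1 ∧ y = x+1) ∨ (k ≠ 0 ∧ y = x+2)

open Classical in
noncomputable def ind {ι : Type} (R : ι → ℤ → Prop) (k : ℕ) (x : ℤ) : ℤ :=
  if ∃ i, ∀ y, R i y ↔ shape k x y then 1 else 0

section
variable {n : ℤ} {ι : Type} {R : ι → ℤ → Prop}

theorem ind01 (k : ℕ) (x : ℤ) : 0 ≤ ind R k x ∧ ind R k x ≤ 1 := by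
  unfold ind
  split_ifs <;> simp

theorem ind_ne {k : ℕ} {x : ℤ} (h : ind R k x ≠ 0) : ∃ i, ∀ y, R i y ↔ shape k x y := by
  unfold ind at h
  by_contra hc
  exact h (if_neg hc)

theorem exists_shape (h : WS n R) (hs : ¬ ∃ i x, ∀ y, R i y ↔ y = x) (i : ι) (y : ℤ)
    (hy : R i y) : ∃ x k, k < 3 ∧ ind R k x = 1 ∧ ∀ z, R i z ↔ shape k x z := by
  suffices ∃ x k, k < 3 ∧ ∀ z, R i z ↔ shape k x z by
    obtain ⟨x, k, hk, hz⟩ := this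
    exact ⟨x, k, hk, if_pos ⟨i, hz⟩, hz⟩
  obtain ⟨m, hm, hmin⟩ : ∃ m, R i m ∧ ∀ z, R i z → m ≤ z := by
    by_cases h2 : R i (y-2)
    · exact ⟨y-2, h2, fun z hz => by have := h.span _ _ _ hy hz; omega⟩
    by_cases h1 : R i (y-1)
    · refine ⟨y-1, h1, fun z hz => ?_⟩
      have := h.span _ _ _ hy hz
      have : z ≠ y-2 := by rintro rfl; exact h2 hz
      omega
    · refine ⟨y, hy, fun z hz => ?_⟩
      have := h.span _ _ _ hy hz
      have : z ≠ y-2 := by rintro rfl; exact h2 hz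
      have : z ≠ y-1 := by rintro rfl; exact h1 hz
      omega
  have hz : ∀ z, R i z → z = m ∨ z = m+1 ∨ z = m+2 := fun z hz => by
    have := h.span _ _ _ hz hm
    have := hmin z hz
    omega
  by_cases h1 : R i (m+1) <;> by_cases h2 : R i (m+2)
  · refine ⟨m, 2, by omega, fun z => ?_⟩
    simp only [shape]
    constructor
    · intro hh
      have := hz z hh
      omega
    · rintro (rfl | ⟨-, rfl⟩ | ⟨-, rfl⟩) <;> assumption
  · refine ⟨m, 0, by omega, fun z => ?_⟩
    simp only [shape]
    constructor
    · intro hh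
      rcases hz z hh with h' | h' | h'
      · omega
      · omega
      · exact absurd (h' ▸ hh) h2
    · rintro (rfl | ⟨-, rfl⟩ | ⟨h', -⟩)
      · assumption
      · assumption
      · omega
  · refine ⟨m, 1, by omega, fun z => ?_⟩
    simp only [shape]
    constructor
    · intro hh
      rcases hz z hh with h' | h' | h'
      · omega
      · exact absurd (h' ▸ hh) h1
      · omega
    · rintro (rfl | ⟨h', -⟩ | ⟨-, rfl⟩)
      · assumption
      · omega
      · assumption
  · exfalso
    refine hs ⟨i, m, fun z => ⟨fun hh => ?_, fun hh => hh ▸ hm⟩⟩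
    rcases hz z hh with h' | h' | h'
    · exact h'
    · exact absurd (h' ▸ hh) h1
    · exact absurd (h' ▸ hh) h2

theorem anti (h : WS n R) (v w : ℤ) (h1 : 1 ≤ v) (h2 : v ≤ n) (hw : w ≠ v) :
    ∃ i, R i v ∧ ¬ R i w := by
  by_cases hr : 1 ≤ w ∧ w ≤ n
  · by_contra! hc
    have := h.sep v w w w h1 h2 hr.1 hr.2 hr.1 hr.2 hr.1 hr.2 (by
      intro i
      have := hc i
      tauto)
    omega
  · obtain ⟨i, hi⟩ := h.cov v h1 h2
    exact ⟨i, hi, fun hh => hr (h.supp _ _ hh)⟩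

theorem anti' (h : WS n R) (hs : ¬ ∃ i x, ∀ y, R i y ↔ y = x) (v w : ℤ) (h1 : 1 ≤ v)
    (h2 : v ≤ n) (hw : w ≠ v) :
    ∃ x, (ind R 0 x = 1 ∧ (v = x ∨ v = x+1) ∧ w ≠ x ∧ w ≠ x+1) ∨
      (ind R 1 x = 1 ∧ (v = x ∨ v = x+2) ∧ w ≠ x ∧ w ≠ x+2) ∨
      (ind R 2 x = 1 ∧ (v = x ∨ v = x+1 ∨ v = x+2) ∧ w ≠ x ∧ w ≠ x+1 ∧ w ≠ x+2) := by
  obtain ⟨i, i1, i2⟩ := h.anti v w h1 h2 hw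
  obtain ⟨x, k, hk, hx, hz⟩ := h.exists_shape hs i v i1
  rw [hz] at i1 i2
  refine ⟨x, ?_⟩
  interval_cases k <;> simp only [shape] at i1 i2
  · left
    refine ⟨hx, ?_⟩
    omega
  · right; left
    refine ⟨hx, ?_⟩
    omega
  · right; right
    refine ⟨hx, ?_⟩
    omega

theorem sh0 (x y : ℤ) : shape 0 x y ↔ y = x ∨ y = x+1 := by simp [shape]
theorem sh1 (x y : ℤ) : shape 1 x y ↔ y = x ∨ y = x+2 := by simp [shape]
theorem sh2 (x y : ℤ) : shape 2 x y ↔ y = x ∨ y = x+1 ∨ y = x+2 := by simp [shape]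

theorem sep' (h : WS n R) (hs : ¬ ∃ i x, ∀ y, R i y ↔ y = x) (a b c d : ℤ) (a1 : 1 ≤ a)
    (a2 : a ≤ n) (b1 : 1 ≤ b) (b2 : b ≤ n) (c1 : 1 ≤ c) (c2 : c ≤ n) (d1 : 1 ≤ d) (d2 : d ≤ n)
    (hne : a ≠ c ∧ a ≠ d) :
    ∃ x, (ind R 0 x = 1 ∧ ¬ ((a = x ∨ a = x+1 ∨ b = x ∨ b = x+1) ↔
        (c = x ∨ c = x+1 ∨ d = x ∨ d = x+1))) ∨
      (ind R 1 x = 1 ∧ ¬ ((a = x ∨ a = x+2 ∨ b = x ∨ b = x+2) ↔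
        (c = x ∨ c = x+2 ∨ d = x ∨ d = x+2))) ∨
      (ind R 2 x = 1 ∧ ¬ ((a = x ∨ a = x+1 ∨ a = x+2 ∨ b = x ∨ b = x+1 ∨ b = x+2) ↔
        (c = x ∨ c = x+1 ∨ c = x+2 ∨ d = x ∨ d = x+1 ∨ d = x+2))) := by
  have : ∃ i, ¬ ((R i a ∨ R i b) ↔ (R i c ∨ R i d)) := by
    by_contra! hc
    have := h.sep a b c d a1 a2 b1 b2 c1 c2 d1 d2 hc
    omega
  obtain ⟨i, hi⟩ := this
  obtain ⟨y, hy⟩ : ∃ y, R i y := by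
    by_contra! hc
    simp [hc] at hi
  obtain ⟨x, k, hk, hx, hz⟩ := h.exists_shape hs i y hy
  rw [hz, hz, hz, hz] at hi
  refine ⟨x, ?_⟩
  interval_cases k <;> simp only [sh0, sh1, sh2, or_assoc] at hi
  · exact Or.inl ⟨hx, hi⟩
  · exact Or.inr (Or.inl ⟨hx, hi⟩)
  · exact Or.inr (Or.inr ⟨hx, hi⟩)

theorem toSys (h : WS n R) (hs : ¬ ∃ i x, ∀ y, R i y ↔ y = x) :
    Sys n (ind R 0) (ind R 1) (ind R 2) := by
  have z0 := fun x => (ind01 (R := R) 0 x).1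
  have z1 := fun x => (ind01 (R := R) 1 x).1
  have z2 := fun x => (ind01 (R := R) 2 x).1
  constructor
  · exact ind01 0
  · exact ind01 1
  · exact ind01 2
  · intro x hx
    obtain ⟨i, hi⟩ := ind_ne hx
    have := h.supp i x ((hi x).2 (by simp [shape]))
    have := h.supp i (x+1) ((hi _).2 (by simp [shape]))
    omega
  · intro x hx
    obtain ⟨i, hi⟩ := ind_ne hx
    have := h.supp i x ((hi x).2 (by simp [shape]))
    have := h.supp i (x+2) ((hi _).2 (by simp [shape]))
    omega
  · intro x hx
    obtain ⟨i, hi⟩ := ind_ne hx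
    have := h.supp i x ((hi x).2 (by simp [shape]))
    have := h.supp i (x+2) ((hi _).2 (by simp [shape]))
    omega
  · intro v v1 v2
    have := z0 (v-1)
    have := z1 (v-2)
    have := z1 v
    have := z2 (v-2)
    obtain ⟨x, ⟨hx, hr⟩ | ⟨hx, hr⟩ | ⟨hx, hr⟩⟩ := h.anti' hs v (v+1) v1 v2 (by omega)
    · obtain rfl : x = v-1 := by omega
      omega
    · have : x = v-2 ∨ x = v := by omega
      rcases this with rfl | rfl <;> omega
    · obtain rfl : x = v-2 := by omega
      omega
  · intro v v1 v2
    have := z0 v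
    have := z1 (v-2)
    have := z1 v
    have := z2 v
    obtain ⟨x, ⟨hx, hr⟩ | ⟨hx, hr⟩ | ⟨hx, hr⟩⟩ := h.anti' hs v (v-1) v1 v2 (by omega)
    · obtain rfl : x = v := by omega
      omega
    · have : x = v-2 ∨ x = v := by omega
      rcases this with rfl | rfl <;> omega
    · obtain rfl : x = v := by omega
      omega
  · intro v v1 v2
    have := z0 (v-1)
    have := z0 v
    have := z1 (v-2)
    have := z2 (v-2)
    have := z2 (v-1)
    obtain ⟨x, ⟨hx, hr⟩ | ⟨hx, hr⟩ | ⟨hx, hr⟩⟩ := h.anti' hs v (v+2) v1 v2 (by omega)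
    · have : x = v-1 ∨ x = v := by omega
      rcases this with rfl | rfl <;> omega
    · obtain rfl : x = v-2 := by omega
      omega
    · have : x = v-2 ∨ x = v-1 := by omega
      rcases this with rfl | rfl <;> omega
  · intro v v1 v2
    have := z0 (v-1)
    have := z0 v
    have := z1 v
    have := z2 v
    have := z2 (v-1)
    obtain ⟨x, ⟨hx, hr⟩ | ⟨hx, hr⟩ | ⟨hx, hr⟩⟩ := h.anti' hs v (v-2) v1 v2 (by omega)
    · have : x = v-1 ∨ x = v := by omega
      rcases this with rfl | rfl <;> omega
    · obtain rfl : x = v := by omega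
      omega
    · have : x = v ∨ x = v-1 := by omega
      rcases this with rfl | rfl <;> omega
  · intro v v1 v2
    have := z0 (v-2)
    have := z0 (v+1)
    have := z1 (v-3)
    have := z1 (v+1)
    have := z2 (v-3)
    have := z2 (v+1)
    obtain ⟨x, ⟨hx, hr⟩ | ⟨hx, hr⟩ | ⟨hx, hr⟩⟩ := h.sep' hs (v-1) v (v+1) v (by omega) (by omega)
      (by omega) (by omega) (by omega) (by omega) (by omega) (by omega) (by omega)
    · have : x = v-2 ∨ x = v+1 := by omega
      rcases this with rfl | rfl <;> omega
    · have : x = v-3 ∨ x = v+1 := by omega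
      rcases this with rfl | rfl <;> omega
    · have : x = v-3 ∨ x = v+1 := by omega
      rcases this with rfl | rfl <;> omega
  · intro v v1 v2
    have := z0 (v-1)
    have := z1 (v-2)
    have := z1 (v-1)
    have := z1 (v+1)
    have := z2 (v-2)
    obtain ⟨x, ⟨hx, hr⟩ | ⟨hx, hr⟩ | ⟨hx, hr⟩⟩ := h.sep' hs v (v+2) (v+1) (v+2) (by omega)
      (by omega) (by omega) (by omega) (by omega) (by omega) (by omega) (by omega) (by omega)
    · obtain rfl : x = v-1 := by omega
      omega
    · have : x = v-2 ∨ x = v-1 ∨ x = v+1 := by omega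
      rcases this with rfl | rfl | rfl <;> omega
    · obtain rfl : x = v-2 := by omega
      omega
  · intro v v1 v2
    have := z0 v
    have := z1 v
    have := z1 (v-1)
    have := z1 (v-3)
    have := z2 v
    obtain ⟨x, ⟨hx, hr⟩ | ⟨hx, hr⟩ | ⟨hx, hr⟩⟩ := h.sep' hs v (v-2) (v-1) (v-2) (by omega)
      (by omega) (by omega) (by omega) (by omega) (by omega) (by omega) (by omega) (by omega)
    · obtain rfl : x = v := by omega
      omega
    · have : x = v ∨ x = v-1 ∨ x = v-3 := by omega
      rcases this with rfl | rfl | rfl <;> omega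
    · obtain rfl : x = v := by omega
      omega
  · intro v v1 v2
    have := z0 (v-1)
    have := z0 (v+1)
    have := z0 (v+3)
    have := z1 (v-2)
    have := z1 (v-1)
    have := z1 (v+2)
    have := z1 (v+3)
    have := z2 (v-2)
    have := z2 (v+3)
    obtain ⟨x, ⟨hx, hr⟩ | ⟨hx, hr⟩ | ⟨hx, hr⟩⟩ := h.sep' hs v (v+3) (v+1) (v+2) (by omega)
      (by omega) (by omega) (by omega) (by omega) (by omega) (by omega) (by omega) (by omega)
    · have : x = v-1 ∨ x = v+1 ∨ x = v+3 := by omega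
      rcases this with rfl | rfl | rfl <;> omega
    · have : x = v-2 ∨ x = v-1 ∨ x = v+2 ∨ x = v+3 := by omega
      rcases this with rfl | rfl | rfl | rfl <;> omega
    · have : x = v-2 ∨ x = v+3 := by omega
      rcases this with rfl | rfl <;> omega

open Classical in
theorem card_ge [Fintype ι] (N : ℕ) :
    ∑ i ∈ Finset.range N, (ind R 0 (i+1) + ind R 1 (i+1) + ind R 2 (i+1)) ≤ Fintype.card ι := by
  let S : Finset (ℕ × ℕ) := (Finset.range N ×ˢ Finset.range 3).filter
    (fun z => ∃ i, ∀ y, R i y ↔ shape z.2 (z.1+1) y)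
  have e : ∑ i ∈ Finset.range N, (ind R 0 (i+1) + ind R 1 (i+1) + ind R 2 (i+1)) = (S.card : ℤ) := by
    rw [Finset.card_filter, Finset.sum_product]
    push_cast
    refine Finset.sum_congr rfl fun i _ => ?_
    simp only [Finset.sum_range_succ, Finset.sum_range_zero, zero_add, ind]
    congr!
  rw [e]
  have hS : ∀ z ∈ S, z.2 < 3 ∧ ∃ i, ∀ y, R i y ↔ shape z.2 (z.1+1) y := by
    intro z hz
    simp only [S, Finset.mem_filter, Finset.mem_product, Finset.mem_range] at hz
    exact ⟨hz.1.2, hz.2⟩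
  choose g hg using fun z : {z // z ∈ S} => (hS z.1 z.2).2
  have := Fintype.card_le_of_injective g (by
    rintro ⟨⟨x, k⟩, hz⟩ ⟨⟨x', k'⟩, hz'⟩ hh
    have e1 := hg ⟨_, hz⟩
    have e2 := hg ⟨_, hz'⟩
    have k1 := (hS _ hz).1
    have k2 := (hS _ hz').1
    rw [hh] at e1
    have e3 : ∀ y, shape k (x+1) y ↔ shape k' (x'+1) y := fun y => (e1 y).symm.trans (e2 y)
    simp only at k1 k2
    have q1 := e3 (x+1)
    have q2 := e3 (x'+1)
    have q3 := e3 (x+2)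
    have q4 := e3 (x+3)
    unfold shape at q1 q2 q3 q4
    have : x = x' := by omega
    subst this
    have : k = k' := by
      interval_cases k <;> interval_cases k' <;> omega
    subst this
    rfl)
  rw [Fintype.card_coe] at this
  exact_mod_cast this

end

theorem lower (N : ℕ) : ∀ {ι : Type} [Fintype ι] {R : ι → ℤ → Prop}, WS N R →
    min N ((5 * (N + 1) + 5) / 6) ≤ Fintype.card ι := by
  induction N with
  | zero => intros; simp
  | succ N ih =>
    intro ι _ R h
    classical
    by_cases hs : ∃ i x, ∀ y, R i y ↔ y = x
    · obtain ⟨i, x, hx⟩ := hs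
      have hr := h.supp i x ((hx x).2 rfl)
      have hc := h.contract i x hr.1 hr.2 hx
      have e : ((N+1 : ℕ) : ℤ) - 1 = N := by push_cast; ring
      rw [e] at hc
      have := ih hc
      rw [Fintype.card_subtype_compl, Fintype.card_subtype_eq] at this
      have : 0 < Fintype.card ι := Fintype.card_pos_iff.2 ⟨i⟩
      omega
    · have hS := h.toSys hs
      have hc := card_ge (R := R) (N+1)
      by_cases h5 : 5 ≤ N+1
      · have := hS.bound5 (by exact_mod_cast h5) (N+1) rfl
        push_cast at *
        omega
      · have := hS.bound4 (by push_cast; omega) (by push_cast; omega) (N+1) rfl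
        push_cast at *
        omega

theorem add_one {n : ℤ} {ι : Type} {R : ι → ℤ → Prop} (h : WS n R) (hn : 0 ≤ n) :
    WS (n+1) (fun (i : Option ι) y => i.elim (y = n+1) (fun j => R j y)) := by
  have hf : ∀ i, ¬ R i (n+1) := fun i hi => by
    have := h.supp _ _ hi
    omega
  constructor
  · rintro (_ | i) y hy
    · simp only [Option.elim] at hy
      omega
    · have := h.supp i y hy
      omega
  · rintro (_ | i) a b ha hb
    · simp only [Option.elim] at ha hb
      omega
    · exact h.span i a b ha hb
  · intro x x1 x2
    by_cases hx : x = n+1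
    · exact ⟨none, hx⟩
    · obtain ⟨i, hi⟩ := h.cov x x1 (by omega)
      exact ⟨some i, hi⟩
  · intro a b c d a1 a2 b1 b2 c1 c2 d1 d2 H
    have H0 : (a = n+1 ∨ b = n+1) ↔ (c = n+1 ∨ d = n+1) := H none
    have H1 : ∀ i, (R i a ∨ R i b) ↔ (R i c ∨ R i d) := fun i => H (some i)
    have S := h.sep
    have red : ∀ x y z, (x = n+1) → 1 ≤ y → y ≤ n+1 → 1 ≤ z → z ≤ n+1 →
        (∀ i, (R i x ∨ R i y) ↔ (R i x ∨ R i z)) → y = z := by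
      intro x y z hx y1 y2 z1 z2 hh
      subst hx
      simp only [hf, false_or] at hh
      by_cases hy : y = n+1
      · by_cases hz : z = n+1
        · omega
        · obtain ⟨i, hi⟩ := h.cov z z1 (by omega)
          exact absurd (hy ▸ (hh i).2 hi) (hf i)
      · obtain ⟨i, hi⟩ := h.cov y y1 (by omega)
        by_cases hz : z = n+1
        · exact absurd (hz ▸ (hh i).1 hi) (hf i)
        · have := S y y z z y1 (by omega) y1 (by omega) z1 (by omega) z1 (by omega)
            (by simpa using hh)
          omega
    by_cases ha : a = n+1
    · by_cases hc : c = n+1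
      · have := red a b d ha b1 b2 d1 d2 (by
          intro i
          have := H1 i
          rw [hc, ← ha] at this
          exact this)
        omega
      · have hd : d = n+1 := by omega
        have := red a b c ha b1 b2 c1 c2 (by
          intro i
          have := H1 i
          rw [hd, ← ha] at this
          rw [this, or_comm])
        omega
    · by_cases hb : b = n+1
      · by_cases hc : c = n+1
        · have := red b a d hb a1 a2 d1 d2 (by
            intro i
            have := H1 i
            rw [hc, ← hb] at this
            rw [← this, or_comm])
          omega
        · have hd : d = n+1 := by omega
          have := red b a c hb a1 a2 c1 c2 (by
            intro i
            have := H1 i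
            rw [hd, ← hb] at this
            rw [or_comm, this, or_comm])
          omega
      · exact S a b c d a1 (by omega) b1 (by omega) c1 (by omega) d1 (by omega) H1

theorem add_many {N : ℕ} {ι : Type} [Fintype ι] {R : ι → ℤ → Prop} (h : WS N R) (r : ℕ) :
    ∃ (κ : Type) (_ : Fintype κ) (Q : κ → ℤ → Prop), WS (N+r : ℕ) Q ∧
      Fintype.card κ = Fintype.card ι + r := by
  induction r with
  | zero => exact ⟨ι, inferInstance, R, by simpa using h, rfl⟩
  | succ r ih =>
    obtain ⟨κ, i, Q, hQ, hc⟩ := ih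
    refine ⟨Option κ, inferInstance,
      fun (i : Option κ) y => i.elim (y = ((N+r:ℕ):ℤ)+1) (fun j => Q j y), ?_, ?_⟩
    · have e : ((N + (r+1) : ℕ) : ℤ) = ((N + r : ℕ) : ℤ) + 1 := by push_cast; ring
      rw [e]
      exact hQ.add_one (by omega)
    · rw [Fintype.card_option, hc]
      ring

theorem empty_ws : WS (0:ℕ) (fun (_ : Empty) (_ : ℤ) => False) := by
  constructor
  · intro i; exact i.elim
  · intro i; exact i.elim
  · intro x h1 h2; simp at h2; omega
  · intro a b c d h1 h2; simp at h2; omega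

theorem periodic (k : ℕ) (hk : 1 ≤ k) :
    WS (6*k-1 : ℕ) (fun (i : Fin (5*k)) y =>
      1 ≤ y ∧ y ≤ 6*k-1 ∧ ((i:ℤ)+1 = lo y ∨ (i:ℤ)+1 = hi y)) := by
  have hN : ((6*k-1 : ℕ) : ℤ) = 6*k-1 := by omega
  have rl : ∀ y : ℤ, 1 ≤ y → y ≤ 6*k-1 → 1 ≤ lo y ∧ lo y ≤ 5*k := by
    intro y h1 h2
    unfold lo
    split_ifs <;> omega
  have rh : ∀ y : ℤ, 1 ≤ y → y ≤ 6*k-1 → 1 ≤ hi y ∧ hi y ≤ 5*k := by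
    intro y h1 h2
    unfold hi
    split_ifs <;> omega
  have idx : ∀ u : ℤ, 1 ≤ u → u ≤ 5*k → ∃ i : Fin (5*k), (i:ℤ)+1 = u := by
    intro u h1 h2
    refine ⟨⟨(u-1).toNat, by omega⟩, ?_⟩
    simp only
    omega
  rw [hN]
  constructor
  · intro i y hy
    exact ⟨hy.1, hy.2.1⟩
  · rintro i a b ⟨-, -, ha⟩ ⟨-, -, hb⟩
    generalize (i:ℤ)+1 = u at ha hb
    unfold lo hi at ha hb
    split_ifs at ha hb <;> omega
  · intro x x1 x2
    obtain ⟨i, hi⟩ := idx (lo x) (rl x x1 x2).1 (rl x x1 x2).2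
    exact ⟨i, x1, x2, Or.inl hi⟩
  · have main : ∀ a b c d : ℤ, 1 ≤ a → a ≤ 6*k-1 → 1 ≤ b → b ≤ 6*k-1 → 1 ≤ c → c ≤ 6*k-1 →
        1 ≤ d → d ≤ 6*k-1 →
        (∀ u : ℤ, 1 ≤ u → u ≤ 5*k → ((u = lo a ∨ u = hi a) ∨ (u = lo b ∨ u = hi b) ↔
          (u = lo c ∨ u = hi c) ∨ (u = lo d ∨ u = hi d))) → a = c ∨ a = d := by
      intro a b c d a1 a2 b1 b2 c1 c2 d1 d2 H
      have A1 := (H (lo a) (rl a a1 a2).1 (rl a a1 a2).2).1 (by simp)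
      have A2 := (H (hi a) (rh a a1 a2).1 (rh a a1 a2).2).1 (by simp)
      have C1 := (H (lo c) (rl c c1 c2).1 (rl c c1 c2).2).2 (by simp)
      have C2 := (H (hi c) (rh c c1 c2).1 (rh c c1 c2).2).2 (by simp)
      have D1 := (H (lo d) (rl d d1 d2).1 (rl d d1 d2).2).2 (by simp)
      have D2 := (H (hi d) (rh d d1 d2).1 (rh d d1 d2).2).2 (by simp)
      simp only [or_assoc] at A1 A2 C1 C2 D1 D2
      rcases two_edges (lohi a) (lohi b) (lohi c) (lohi d) A1 A2 C1 C2 D1 D2 with e | e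
      · exact Or.inl (lohi_inj _ _ e.1 e.2)
      · exact Or.inr (lohi_inj _ _ e.1 e.2)
    intro a b c d a1 a2 b1 b2 c1 c2 d1 d2 H
    have H' : ∀ u : ℤ, 1 ≤ u → u ≤ 5*k → ((u = lo a ∨ u = hi a) ∨ (u = lo b ∨ u = hi b) ↔
          (u = lo c ∨ u = hi c) ∨ (u = lo d ∨ u = hi d)) := by
      intro u h1 h2
      obtain ⟨i, rfl⟩ := idx u h1 h2
      have := H i
      simp only [a1, a2, b1, b2, c1, c2, d1, d2, true_and] at this
      exact this
    refine ⟨main a b c d a1 a2 b1 b2 c1 c2 d1 d2 H', main b a c d b1 b2 a1 a2 c1 c2 d1 d2 ?_,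
      main c d a b c1 c2 d1 d2 a1 a2 b1 b2 ?_, main d c a b d1 d2 c1 c2 a1 a2 b1 b2 ?_⟩
    · intro u h1 h2
      rw [or_comm, H' u h1 h2]
    · intro u h1 h2
      rw [H' u h1 h2]
    · intro u h1 h2
      rw [or_comm, ← H' u h1 h2]

theorem upper (N : ℕ) :
    ∃ (κ : Type) (_ : Fintype κ) (Q : κ → ℤ → Prop), WS N Q ∧
      Fintype.card κ ≤ min N ((5 * (N + 1) + 5) / 6) := by
  by_cases h5 : N < 5
  · obtain ⟨κ, i, Q, h1, h2⟩ := empty_ws.add_many N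
    rw [zero_add] at h1
    refine ⟨κ, i, Q, h1, ?_⟩
    rw [h2]
    simp
    omega
  · obtain ⟨κ, i, Q, h1, h2⟩ := (periodic ((N+1)/6) (by omega)).add_many ((N+1) % 6)
    rw [show 6 * ((N+1)/6) - 1 + (N+1) % 6 = N by omega] at h1
    refine ⟨κ, i, Q, h1, ?_⟩
    rw [h2, Fintype.card_fin]
    omega

end WS

theorem toWS (n : ℕ) (W : Finset (Fin n × Finset (Fin n)))
    (hW : IsWatchingSystemLe (pathG n) 2 W) :
    WS n (fun (w : {w // w ∈ W}) (y : ℤ) => ∃ x : Fin n, x ∈ w.1.2 ∧ (x:ℤ) + 1 = y) := by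
  obtain ⟨h1, h2, h3⟩ := hW
  have vx : ∀ a : ℤ, 1 ≤ a → a ≤ n → ∃ x : Fin n, (x:ℤ) + 1 = a := by
    intro a a1 a2
    refine ⟨⟨(a-1).toNat, by omega⟩, ?_⟩
    simp only
    omega
  have inj : ∀ x y : Fin n, (x:ℤ)+1 = (y:ℤ)+1 → x = y := by
    intro x y h
    apply Fin.ext
    omega
  constructor
  · rintro w y ⟨x, -, rfl⟩
    have := x.2
    omega
  · rintro w a b ⟨x, hx, rfl⟩ ⟨y, hy, rfl⟩
    have e1 := h1 w.1 w.2 x hx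
    have e2 := h1 w.1 w.2 y hy
    simp only [pathG, SimpleGraph.fromRel_adj, Fin.ext_iff] at e1 e2
    omega
  · intro a a1 a2
    obtain ⟨x, rfl⟩ := vx a a1 a2
    obtain ⟨w, hw⟩ := h2 {x} (by simp) (by simp)
    simp only [wLabelSet, Finset.mem_filter, Finset.mem_singleton, exists_eq_left] at hw
    exact ⟨⟨w, hw.1⟩, x, hw.2, rfl⟩
  · intro a b c d a1 a2 b1 b2 c1 c2 d1 d2 H
    obtain ⟨a, rfl⟩ := vx a a1 a2
    obtain ⟨b, rfl⟩ := vx b b1 b2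
    obtain ⟨c, rfl⟩ := vx c c1 c2
    obtain ⟨d, rfl⟩ := vx d d1 d2
    have key : ∀ (w : {w // w ∈ W}) (z : Fin n),
        (∃ x : Fin n, x ∈ w.1.2 ∧ (x:ℤ) + 1 = (z:ℤ)+1) ↔ z ∈ w.1.2 := by
      intro w z
      constructor
      · rintro ⟨x, hx, e⟩
        rw [← inj _ _ e]
        exact hx
      · intro hz
        exact ⟨z, hz, rfl⟩
    simp only [key] at H
    have := h3 {a, b} {c, d} (by simp) (by simp) Finset.card_le_two Finset.card_le_two (by
      ext w
      simp only [wLabelSet, Finset.mem_filter, Finset.mem_insert, Finset.mem_singleton,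
        exists_eq_or_imp, exists_eq_left]
      constructor
      · rintro ⟨hw, hh⟩
        exact ⟨hw, (H ⟨w, hw⟩).1 hh⟩
      · rintro ⟨hw, hh⟩
        exact ⟨hw, (H ⟨w, hw⟩).2 hh⟩)
    have ea : a ∈ ({c, d} : Finset (Fin n)) := this ▸ (by simp)
    have eb : b ∈ ({c, d} : Finset (Fin n)) := this ▸ (by simp)
    have ec : c ∈ ({a, b} : Finset (Fin n)) := this ▸ (by simp)
    have ed : d ∈ ({a, b} : Finset (Fin n)) := this ▸ (by simp)
    simp only [Finset.mem_insert, Finset.mem_singleton] at ea eb ec ed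
    refine ⟨?_, ?_, ?_, ?_⟩
    · rcases ea with rfl | rfl <;> simp
    · rcases eb with rfl | rfl <;> simp
    · rcases ec with rfl | rfl <;> simp
    · rcases ed with rfl | rfl <;> simp

theorem card_two_form {n : ℕ} (A : Finset (Fin n)) (h1 : A.Nonempty) (h2 : A.card ≤ 2) :
    ∃ a b, A = {a, b} := by
  have h3 := Finset.card_pos.2 h1
  have : A.card = 1 ∨ A.card = 2 := by omega
  rcases this with h | h
  · obtain ⟨a, rfl⟩ := Finset.card_eq_one.1 h
    exact ⟨a, a, by simp⟩
  · obtain ⟨a, b, -, rfl⟩ := Finset.card_eq_two.1 h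
    exact ⟨a, b, rfl⟩

open Classical in
theorem ofWS (n : ℕ) (hn : 1 ≤ n) {ι : Type} [Fintype ι] {R : ι → ℤ → Prop} (h : WS n R) :
    ∃ W : Finset (Fin n × Finset (Fin n)), IsWatchingSystemLe (pathG n) 2 W ∧
      W.card ≤ Fintype.card ι := by
  have vr : ∀ x : Fin n, 1 ≤ (x:ℤ)+1 ∧ (x:ℤ)+1 ≤ n := by
    intro x
    have := x.2
    omega
  have cen : ∀ i, ∃ v : Fin n, ∀ x : Fin n, R i ((x:ℤ)+1) → x = v ∨ (pathG n).Adj v x := by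
    intro i
    by_cases hne : ∃ x : Fin n, R i ((x:ℤ)+1)
    · let S : Finset (Fin n) := Finset.univ.filter (fun x => R i ((x:ℤ)+1))
      have hS : S.Nonempty := by
        obtain ⟨x, hx⟩ := hne
        exact ⟨x, by simp [S, hx]⟩
      have m1 : R i ((S.min' hS : ℤ)+1) := by
        have := S.min'_mem hS
        simpa [S] using this
      have m2 : ∀ x : Fin n, R i ((x:ℤ)+1) → S.min' hS ≤ x := fun x hx =>
        S.min'_le x (by simp [S, hx])
      generalize S.min' hS = m at m1 m2
      by_cases hm : (m:ℕ) + 1 < n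
      · refine ⟨⟨m+1, hm⟩, fun x hx => ?_⟩
        have a1 : (m:ℕ) ≤ x := m2 x hx
        have a2 := h.span _ _ _ hx m1
        simp only [pathG, SimpleGraph.fromRel_adj, Fin.ext_iff, ne_eq]
        omega
      · refine ⟨m, fun x hx => ?_⟩
        have a1 : (m:ℕ) ≤ x := m2 x hx
        left
        apply Fin.ext
        have := x.2
        omega
    · push Not at hne
      exact ⟨⟨0, hn⟩, fun x hx => absurd hx (hne x)⟩
  choose v hv using cen
  let Z : ι → Finset (Fin n) := fun i => Finset.univ.filter (fun x => R i ((x:ℤ)+1))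
  have hZ : ∀ i x, x ∈ Z i ↔ R i ((x:ℤ)+1) := by
    intro i x
    simp [Z]
  refine ⟨Finset.univ.image (fun i => (v i, Z i)), ⟨?_, ?_, ?_⟩, ?_⟩
  · intro w hw x hx
    simp only [Finset.mem_image, Finset.mem_univ, true_and] at hw
    obtain ⟨i, rfl⟩ := hw
    exact hv i x ((hZ i x).1 hx)
  · rintro A ⟨x, hx⟩ -
    obtain ⟨i, hi⟩ := h.cov _ (vr x).1 (vr x).2
    refine ⟨(v i, Z i), ?_⟩
    simp only [wLabelSet, Finset.mem_filter, Finset.mem_image, Finset.mem_univ, true_and]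
    exact ⟨⟨i, rfl⟩, x, hx, (hZ i x).2 hi⟩
  · intro A B hA hB cA cB H
    obtain ⟨a, b, rfl⟩ := card_two_form A hA cA
    obtain ⟨c, d, rfl⟩ := card_two_form B hB cB
    have := h.sep _ _ _ _ (vr a).1 (vr a).2 (vr b).1 (vr b).2 (vr c).1 (vr c).2 (vr d).1 (vr d).2
      (by
        intro i
        have := Finset.ext_iff.1 H (v i, Z i)
        simp only [wLabelSet, Finset.mem_filter, Finset.mem_image, Finset.mem_univ, true_and,
          Finset.mem_insert, Finset.mem_singleton, exists_eq_or_imp, exists_eq_left,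
          exists_apply_eq_apply, hZ] at this
        exact this)
    have conv : ∀ x y : Fin n, (x:ℤ)+1 = (y:ℤ)+1 ↔ x = y := by
      intro x y
      rw [Fin.ext_iff]
      omega
    simp only [conv] at this
    obtain ⟨e1, e2, e3, e4⟩ := this
    apply Finset.Subset.antisymm
    · intro x hx
      simp only [Finset.mem_insert, Finset.mem_singleton] at hx ⊢
      rcases hx with rfl | rfl <;> assumption
    · intro x hx
      simp only [Finset.mem_insert, Finset.mem_singleton] at hx ⊢
      rcases hx with rfl | rfl <;> assumption
  · exact Finset.card_image_le.trans (by simp)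

/-- For every `n ≥ 1`, the minimum size of a `(1, ≤ 2)`-watching system in `P_n` equals
`min(n, ⌈5(n+1)/6⌉)`; in particular it is `n` if `n ≤ 10` and `⌈5(n+1)/6⌉` if `n ≥ 5`. -/
theorem watchingNumberLe_two_path (n : ℕ) (hn : 1 ≤ n) :
    watchingNumberLe (pathG n) 2 = min n ((5 * (n + 1) + 5) / 6) ∧
    (n ≤ 10 → watchingNumberLe (pathG n) 2 = n) ∧
    (5 ≤ n → watchingNumberLe (pathG n) 2 = (5 * (n + 1) + 5) / 6) := by
  have main : watchingNumberLe (pathG n) 2 = min n ((5 * (n + 1) + 5) / 6) := by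
    obtain ⟨κ, i, Q, h1, h2⟩ := WS.upper n
    obtain ⟨W, hW, hc⟩ := ofWS n hn h1
    unfold watchingNumberLe
    apply le_antisymm
    · refine le_trans (Nat.sInf_le ?_) (hc.trans h2)
      exact ⟨W, hW, rfl⟩
    · obtain ⟨W', hW', hc'⟩ := Nat.sInf_mem (s := {k | ∃ W : Finset (Fin n × Finset (Fin n)),
        IsWatchingSystemLe (pathG n) 2 W ∧ W.card = k}) ⟨_, W, hW, rfl⟩
      rw [← hc']
      have := WS.lower n (toWS n W' hW')
      rwa [Fintype.card_coe] at this
  rw [main]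
  omega
end

section
/- For every n ≥ 1 and every ℓ ≥ 3, the minimum size of a (1, ≤ ℓ)-watching system in the path P_n on n vertices equals n. -/
theorem card_le_two_aux {n : ℕ} (S : Finset (Fin n)) (a b : ℤ)
    (h : ∀ y ∈ S, ((y : ℕ) : ℤ) = a ∨ ((y : ℕ) : ℤ) = b) : S.card ≤ 2 := by
  have h1 : S.card ≤ ({a, b} : Finset ℤ).card := by
    apply Finset.card_le_card_of_injOn (fun y : Fin n => ((y : ℕ) : ℤ))
    · intro y hy
      have := h y hy
      simpa using this
    · intro y _ z _ hyz
      apply Fin.ext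
      simpa using hyz
  exact h1.trans Finset.card_le_two

theorem sep_aux {n ℓ : ℕ} (hℓ : 3 ≤ ℓ) {G : SimpleGraph (Fin n)}
    {W : Finset (Fin n × Finset (Fin n))}
    (hW : IsWatchingSystemLe G ℓ W) (x : Fin n) (a b : ℤ)
    (ha : ((x : ℕ) : ℤ) ≠ a) (hb : ((x : ℕ) : ℤ) ≠ b) :
    ∃ w ∈ W, x ∈ w.2 ∧ ∀ y ∈ w.2, ((y : ℕ) : ℤ) ≠ a ∧ ((y : ℕ) : ℤ) ≠ b := by
  obtain ⟨_, h2, h3⟩ := hW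
  set A : Finset (Fin n) :=
    Finset.univ.filter (fun y : Fin n => ((y : ℕ) : ℤ) = a ∨ ((y : ℕ) : ℤ) = b) with hA
  have hc : A.card ≤ 2 := card_le_two_aux A a b (by intro y hy; simpa [hA] using hy)
  have hx : x ∉ A := by simp [hA, ha, hb]
  by_contra hcon
  push Not at hcon
  have key : ∀ w ∈ W, x ∈ w.2 → ∃ y ∈ A, y ∈ w.2 := by
    intro w hw hxw
    obtain ⟨y, hy, hyab⟩ := hcon w hw hxw
    refine ⟨y, ?_, hy⟩
    simp only [hA, Finset.mem_filter, Finset.mem_univ, true_and]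
    by_cases h : ((y : ℕ) : ℤ) = a
    · exact Or.inl h
    · exact Or.inr (hyab h)
  rcases A.eq_empty_or_nonempty with hE | hne
  · obtain ⟨w, hw⟩ := h2 {x} (Finset.singleton_nonempty x) (by simp; omega)
    simp only [wLabelSet, Finset.mem_filter, Finset.mem_singleton, exists_eq_left] at hw
    obtain ⟨y, hy, _⟩ := key w hw.1 hw.2
    simp [hE] at hy
  · have := h3 (insert x A) A (Finset.insert_nonempty _ _) hne
      ((Finset.card_insert_le _ _).trans (by omega)) (by omega) (by
        ext w
        simp only [wLabelSet, Finset.mem_filter]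
        refine and_congr_right fun hw => ?_
        constructor
        · rintro ⟨y, hy, hyw⟩
          rcases Finset.mem_insert.1 hy with rfl | hy
          · exact key w hw hyw
          · exact ⟨y, hy, hyw⟩
        · rintro ⟨y, hy, hyw⟩
          exact ⟨y, Finset.mem_insert_of_mem hy, hyw⟩)
    exact hx (this ▸ Finset.mem_insert_self x A)

theorem zone_aux {n ℓ : ℕ} {W : Finset (Fin n × Finset (Fin n))}
    (hW : IsWatchingSystemLe (pathG n) ℓ W) {w : Fin n × Finset (Fin n)} (hw : w ∈ W)
    {y z : Fin n} (hy : y ∈ w.2) (hz : z ∈ w.2) : (y : ℕ) ≤ (z : ℕ) + 2 := by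
  have h1 := hW.1 w hw y hy
  have h2 := hW.1 w hw z hz
  simp only [pathG, SimpleGraph.fromRel_adj, Fin.ext_iff] at h1 h2
  omega

theorem two_aux {n : ℕ} {W : Finset (Fin n × Finset (Fin n))} (x : Fin n)
    {u v : Fin n × Finset (Fin n)} (hu : u ∈ W) (hv : v ∈ W) (hxu : x ∈ u.2) (hxv : x ∈ v.2)
    (huv : u ≠ v) (hcu : u.2.card ≤ 2) (hcv : v.2.card ≤ 2) :
    (1 : ℚ) ≤ ∑ w ∈ W.filter (fun w => x ∈ w.2), (1 : ℚ) / w.2.card := by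
  have hsub : ({u, v} : Finset (Fin n × Finset (Fin n))) ⊆ W.filter (fun w => x ∈ w.2) := by
    intro t ht
    rcases Finset.mem_insert.1 ht with rfl | ht
    · simp [hu, hxu]
    · rw [Finset.mem_singleton] at ht
      subst ht
      simp [hv, hxv]
  have h := Finset.sum_le_sum_of_subset_of_nonneg (f := fun w => (1 : ℚ) / w.2.card) hsub
    (by intros; positivity)
  rw [Finset.sum_pair huv] at h
  have half : ∀ t : Fin n × Finset (Fin n), x ∈ t.2 → t.2.card ≤ 2 →
      (1 : ℚ) / 2 ≤ (1 : ℚ) / t.2.card := by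
    intro t hxt hct
    have hp : 0 < t.2.card := Finset.card_pos.2 ⟨x, hxt⟩
    apply one_div_le_one_div_of_le
    · exact_mod_cast hp
    · exact_mod_cast hct
  have := half u hxu hcu
  have := half v hxv hcv
  linarith

theorem one_aux {n : ℕ} {W : Finset (Fin n × Finset (Fin n))} (x : Fin n)
    {u : Fin n × Finset (Fin n)} (hu : u ∈ W) (hxu : x ∈ u.2)
    (h1 : ∀ y ∈ u.2, y = x) :
    (1 : ℚ) ≤ ∑ w ∈ W.filter (fun w => x ∈ w.2), (1 : ℚ) / w.2.card := by
  have hu2 : u.2 = {x} := by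
    ext y
    simp only [Finset.mem_singleton]
    exact ⟨h1 y, fun h => h ▸ hxu⟩
  have h := Finset.single_le_sum (f := fun w : Fin n × Finset (Fin n) => (1 : ℚ) / w.2.card)
    (s := W.filter (fun w => x ∈ w.2)) (by intros; positivity)
    (show u ∈ _ by simp [hu, hxu])
  simpa [hu2] using h

theorem local_aux {n ℓ : ℕ} (hℓ : 3 ≤ ℓ) {W : Finset (Fin n × Finset (Fin n))}
    (hW : IsWatchingSystemLe (pathG n) ℓ W) (x : Fin n) :
    (1 : ℚ) ≤ ∑ w ∈ W.filter (fun w => x ∈ w.2), (1 : ℚ) / w.2.card := by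
  obtain ⟨u, hu, hxu, hu'⟩ := sep_aux hℓ hW x ((x : ℕ) - 1 : ℤ) ((x : ℕ) + 1 : ℤ)
    (by omega) (by omega)
  by_cases h1 : ∀ y ∈ u.2, y = x
  · exact one_aux x hu hxu h1
  push Not at h1
  obtain ⟨y, hy, hyx⟩ := h1
  have hyx' : (y : ℕ) ≠ x := fun h => hyx (Fin.ext h)
  have a1 := zone_aux hW hu hy hxu
  have a2 := zone_aux hW hu hxu hy
  have a3 := hu' y hy
  -- the other vertex of the zone of u is y = x ± 2
  have hcu : u.2.card ≤ 2 := by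
    apply card_le_two_aux _ (x : ℕ) (y : ℕ)
    intro z hz
    have b1 := zone_aux hW hu hz hxu
    have b2 := zone_aux hW hu hxu hz
    have b3 := hu' z hz
    have b4 := zone_aux hW hu hz hy
    have b5 := zone_aux hW hu hy hz
    omega
  obtain ⟨v, hv, hxv, hv'⟩ := sep_aux hℓ hW x ((y : ℕ) : ℤ)
    ((x : ℕ) - (((y : ℕ) : ℤ) - (x : ℕ)) / 2 : ℤ) (by omega) (by omega)
  have huv : u ≠ v := by
    rintro rfl
    exact (hv' y hy).1 rfl
  refine two_aux x hu hv hxu hxv huv hcu ?_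
  by_cases h1 : ∀ z ∈ v.2, z = x
  · apply card_le_two_aux _ (x : ℕ) (x : ℕ)
    intro z hz
    simp [h1 z hz]
  push Not at h1
  obtain ⟨t, ht, htx⟩ := h1
  have htx' : (t : ℕ) ≠ x := fun h => htx (Fin.ext h)
  have c1 := zone_aux hW hv ht hxv
  have c2 := zone_aux hW hv hxv ht
  have c3 := hv' t ht
  apply card_le_two_aux _ (x : ℕ) (t : ℕ)
  intro z hz
  have b1 := zone_aux hW hv hz hxv
  have b2 := zone_aux hW hv hxv hz
  have b3 := hv' z hz
  have b4 := zone_aux hW hv hz ht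
  have b5 := zone_aux hW hv ht hz
  omega

theorem lower_aux {n ℓ : ℕ} (hℓ : 3 ≤ ℓ) {W : Finset (Fin n × Finset (Fin n))}
    (hW : IsWatchingSystemLe (pathG n) ℓ W) : n ≤ W.card := by
  have h1 : (n : ℚ) ≤ ∑ x : Fin n, ∑ w ∈ W.filter (fun w => x ∈ w.2), (1 : ℚ) / w.2.card := by
    have := Finset.sum_le_sum (s := (Finset.univ : Finset (Fin n)))
      (fun x _ => local_aux hℓ hW x)
    simpa using this
  have h2 : ∑ x : Fin n, ∑ w ∈ W.filter (fun w => x ∈ w.2), (1 : ℚ) / w.2.card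
      = ∑ w ∈ W, ∑ x ∈ w.2, (1 : ℚ) / w.2.card := by
    apply Finset.sum_comm'
    intro x w
    simp [and_comm]
  have h3 : ∑ w ∈ W, ∑ x ∈ w.2, (1 : ℚ) / w.2.card ≤ ∑ w ∈ W, (1 : ℚ) := by
    apply Finset.sum_le_sum
    intro w _
    rw [Finset.sum_const, nsmul_eq_mul, mul_one_div]
    exact div_self_le_one _
  rw [h2] at h1
  have h4 := h1.trans h3
  simp only [Finset.sum_const, nsmul_eq_mul, mul_one] at h4
  exact_mod_cast h4

theorem upper_aux (n ℓ : ℕ) : ∃ W : Finset (Fin n × Finset (Fin n)),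
    IsWatchingSystemLe (pathG n) ℓ W ∧ W.card = n := by
  have hl : ∀ (A : Finset (Fin n)) (x : Fin n),
      (x, ({x} : Finset (Fin n))) ∈ wLabelSet
        (Finset.univ.image (fun v : Fin n => (v, ({v} : Finset (Fin n))))) A ↔ x ∈ A := by
    intro A x
    simp [wLabelSet]
  refine ⟨Finset.univ.image (fun v : Fin n => (v, {v})), ⟨?_, ?_, ?_⟩, ?_⟩
  · intro w hw x hx
    obtain ⟨v, _, rfl⟩ := Finset.mem_image.1 hw
    left
    simpa using hx
  · rintro A ⟨x, hx⟩ _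
    exact ⟨_, (hl A x).2 hx⟩
  · intro A B _ _ _ _ hAB
    ext x
    rw [← hl A x, ← hl B x, hAB]
  · rw [Finset.card_image_of_injective]
    · simp
    · intro a b h
      exact (Prod.ext_iff.1 h).1

/-- For every `n ≥ 1` and every `ℓ ≥ 3`, the minimum size of a `(1, ≤ ℓ)`-watching
system in `P_n` equals `n`. -/
theorem watchingNumberLe_ge_three_path (n ℓ : ℕ) (hn : 1 ≤ n) (hℓ : 3 ≤ ℓ) :
    watchingNumberLe (pathG n) ℓ = n := by
  apply le_antisymm
  · exact Nat.sInf_le (upper_aux n ℓ)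
  · apply le_csInf
    · exact ⟨n, upper_aux n ℓ⟩
    · rintro k ⟨W, hW, rfl⟩
      exact lower_aux hℓ hW
end

section
/- For every n ≥ 7, the only (1, ≤ 2)-identifying code in the cycle C_n on n vertices is the full vertex set V(C_n). -/
/-- `C` is a `(1, ≤ ℓ)`-identifying code of `G`: for every nonempty set `A` of at most
`ℓ` vertices the set `(∪_{x∈A} B_G(x,1)) ∩ C` is nonempty, and these sets are pairwise
distinct for distinct such `A` (here `B_G(x,1) = N_G[x]`). -/
def IsIdCodeLe {V : Type} (G : SimpleGraph V) (ℓ : ℕ) (C : Finset V) : Prop :=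
  (∀ A : Finset V, A.Nonempty → A.card ≤ ℓ → ∃ c ∈ C, ∃ x ∈ A, c = x ∨ G.Adj x c) ∧
  (∀ A B : Finset V, A.Nonempty → B.Nonempty → A.card ≤ ℓ → B.card ≤ ℓ →
    (∀ c ∈ C, (∃ x ∈ A, c = x ∨ G.Adj x c) ↔ (∃ x ∈ B, c = x ∨ G.Adj x c)) → A = B)

/-- closed neighbourhood, arithmetically -/
def nbr (n x c : ℕ) : Prop :=
  c = x ∨ c = x + 1 ∨ x = c + 1 ∨ (x = 0 ∧ c + 1 = n) ∨ (c = 0 ∧ x + 1 = n)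

theorem ball_iff (n : ℕ) (hn : 7 ≤ n) (x c : Fin n) :
    (c = x ∨ (cycleG n).Adj x c) ↔ nbr n x c := by
  have key : ∀ i j : Fin n, ((i : ℕ) + 1) % n = (j : ℕ) ↔
      ((j : ℕ) = i + 1 ∨ ((j : ℕ) = 0 ∧ (i : ℕ) + 1 = n)) := by
    intro i j
    have hi := i.2
    have hj := j.2
    rcases Nat.lt_or_ge ((i : ℕ) + 1) n with h | h
    · rw [Nat.mod_eq_of_lt h]; omega
    · have : (i : ℕ) + 1 = n := by omega
      rw [this, Nat.mod_self]; omega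
  simp only [cycleG, SimpleGraph.fromRel_adj, key, nbr, Fin.ext_iff, ne_eq]
  omega

theorem shift (n : ℕ) (v : Fin n) (k : ℕ) (hk : k < n) :
    ∃ w : Fin n, (w : ℕ) = v + k ∨ (w : ℕ) + n = v + k := by
  have hv := v.2
  rcases Nat.lt_or_ge ((v : ℕ) + k) n with h | h
  · exact ⟨⟨v + k, h⟩, Or.inl rfl⟩
  · exact ⟨⟨v + k - n, by omega⟩, Or.inr (by simp only []; omega)⟩

theorem sep (n : ℕ) (hn : 7 ≤ n) (x a b b' : Fin n)
    (h : ∀ c : Fin n, (nbr n x c ∨ nbr n a c) ↔ (nbr n b c ∨ nbr n b' c)) :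
    x = b ∨ x = b' := by
  by_contra hx
  have main : ∀ b b' : Fin n, x ≠ b → x ≠ b' →
      (∀ c : Fin n, (nbr n x c ∨ nbr n a c) ↔ (nbr n b c ∨ nbr n b' c)) → 
      nbr n b x → False := by
    clear h hx b b'
    intro b b' h1 h2 h h3
    obtain ⟨p1, hp1⟩ := shift n x 1 (by omega)
    obtain ⟨p2, hp2⟩ := shift n x 2 (by omega)
    obtain ⟨m1, hm1⟩ := shift n x (n - 1) (by omega)
    obtain ⟨m2, hm2⟩ := shift n x (n - 2) (by omega)
    have e1 := (h p1).1 (Or.inl (by unfold nbr; omega))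
    have e2 := (h m1).1 (Or.inl (by unfold nbr; omega))
    have f1 := (h p2).2
    have f2 := (h m2).2
    rw [Ne, Fin.ext_iff] at h1 h2
    clear h
    have hx := x.2
    have ha := a.2
    have hb := b.2
    have hb' := b'.2
    have hb1 : b = p1 ∨ b = m1 := by
      simp only [Fin.ext_iff]; unfold nbr at h3; omega
    have g1 : nbr n b p2 ∨ nbr n b' p2 := by
      rcases hb1 with rfl | rfl
      · left; unfold nbr; omega
      · have : nbr n b' p1 := e1.resolve_left (by unfold nbr; omega)
        right; unfold nbr at this ⊢; omega
    have g2 : nbr n b m2 ∨ nbr n b' m2 := by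
      rcases hb1 with rfl | rfl
      · have : nbr n b' m1 := e2.resolve_left (by unfold nbr; omega)
        right; unfold nbr at this ⊢; omega
      · left; unfold nbr; omega
    have k1 := (f1 g1).resolve_left (by unfold nbr; omega)
    have k2 := (f2 g2).resolve_left (by unfold nbr; omega)
    clear f1 f2 g1 g2 hb1 e1 e2 h1 h2 h3
    unfold nbr at k1 k2
    omega
  push Not at hx
  rcases (h x).1 (Or.inl (Or.inl rfl)) with h3 | h3
  · exact main b b' hx.1 hx.2 h h3
  · exact main b' b hx.2 hx.1 (fun c => (h c).trans or_comm) h3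

theorem two_form {n : ℕ} (A : Finset (Fin n)) (h0 : A.Nonempty) (h2 : A.card ≤ 2) (x : Fin n)
    (hx : x ∈ A) : ∃ a, A = {x, a} := by
  have := Finset.card_pos.2 h0
  have h : A.card = 1 ∨ A.card = 2 := by omega
  rcases h with h | h
  · obtain ⟨y, rfl⟩ := Finset.card_eq_one.1 h
    exact ⟨x, by simp at hx; simp [hx]⟩
  · obtain ⟨y, z, -, rfl⟩ := Finset.card_eq_two.1 h
    simp only [Finset.mem_insert, Finset.mem_singleton] at hx
    rcases hx with rfl | rfl
    · exact ⟨z, rfl⟩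
    · exact ⟨y, Finset.pair_comm _ _⟩

theorem sub_of (n : ℕ) (hn : 7 ≤ n) (A B : Finset (Fin n)) (hA : A.Nonempty) (hB : B.Nonempty)
    (cA : A.card ≤ 2) (cB : B.card ≤ 2)
    (h : ∀ c : Fin n, (∃ x ∈ A, nbr n x c) ↔ (∃ x ∈ B, nbr n x c)) : A ⊆ B := by
  intro x hx
  obtain ⟨a, rfl⟩ := two_form A hA cA x hx
  obtain ⟨b, hb⟩ := id hB
  obtain ⟨b', rfl⟩ := two_form B hB cB b hb
  simp only [Finset.mem_insert, Finset.mem_singleton, exists_eq_or_imp, exists_eq_left] at h ⊢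
  exact sep n hn x a b b' h

/-- For every `n ≥ 7`, the only `(1, ≤ 2)`-identifying code in `C_n` is the full
vertex set. -/
theorem idCodeLe_two_cycle_eq_univ (n : ℕ) (hn : 7 ≤ n) :
    IsIdCodeLe (cycleG n) 2 (Finset.univ : Finset (Fin n)) ∧
    ∀ C : Finset (Fin n), IsIdCodeLe (cycleG n) 2 C → C = Finset.univ := by
  constructor
  · constructor
    · rintro A ⟨x, hx⟩ -
      exact ⟨x, Finset.mem_univ _, x, hx, Or.inl rfl⟩
    · intro A B hA hB cA cB h
      simp only [ball_iff n hn, Finset.mem_univ, true_imp_iff] at h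
      exact (sub_of n hn A B hA hB cA cB h).antisymm
        (sub_of n hn B A hB hA cB cA (fun c => (h c).symm))
  · rintro C ⟨-, h⟩
    by_contra hC
    obtain ⟨v, hv⟩ : ∃ v, v ∉ C := by
      by_contra hh
      push Not at hh
      exact hC (Finset.eq_univ_iff_forall.2 hh)
    obtain ⟨x, hx⟩ := shift n v (n - 3) (by omega)
    obtain ⟨y, hy⟩ := shift n v (n - 2) (by omega)
    obtain ⟨z, hz⟩ := shift n v (n - 1) (by omega)
    have := h {x, y} {x, z} (by simp) (by simp) Finset.card_le_two Finset.card_le_two (by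
      intro c hc
      have hcv : (c : ℕ) ≠ v := fun e => hv (Fin.ext e ▸ hc)
      have h1 := c.2
      have h2 := v.2
      simp only [ball_iff n hn, Finset.mem_insert, Finset.mem_singleton, exists_eq_or_imp,
        exists_eq_left]
      unfold nbr
      constructor <;> intro h <;> omega)
    have hy' : y ∈ ({x, z} : Finset (Fin n)) := this ▸ (by simp)
    simp only [Finset.mem_insert, Finset.mem_singleton, Fin.ext_iff] at hy'
    have h2 := v.2
    omega
end
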